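/- The entropy S of ternary square-free words satisfies exp(S) < 1.30193812; equivalently, lim_{n→∞} (1/n) log s_n < log(1.30193812), where s_n is the number of ternary square-free words of length n. -/

import Mathlib

/-- A word `w` is square-free if whenever `w = x ++ y ++ y ++ z`,
then `y` is the empty word. -/
def SquareFree {α : Type*} (w : List α) : Prop :=
  ∀ x y z : List α, w = x ++ y ++ y ++ z → y = []

/-- `s n` is the number of ternary square-free words of length `n`. -/
noncomputable def s (n : ℕ) : ℕ :=
  Nat.card {w : List (Fin 3) // w.length = n ∧ SquareFree w}

/-! Proof idea.  A ternary word without two equal adjacent letters is determined, up to a permutation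
of the letters, by the bits that tell whether a letter equals the one two places before.
We use a binary decision tree on these bits that assigns to every square-free word `w` (of length
at least 50) a weight `F w ≥ 1` such that the total weight of the square-free words `a :: w` is at
most `1.30193811 * F w`.  The tree is an approximate Perron eigenvector of the transfer matrix of
the words that avoid squares of period at most 25.  The required inequalities are checked by
kernel evaluation.
-/

/-- Decision trees: `l v` is a leaf with weight `v`, `d` a leaf for paths that are squares,
`n a b` a node with the branch `a` for a new letter and `b` for a letter
equal to the one two places before. -/
inductive WTree : Type
  | l (v : ℕ) : WTree
  | d : WTree
  | n (a b : WTree) : WTree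

namespace WTree

/-- branch for a new letter -/
noncomputable def lc (t : WTree) : WTree := WTree.rec (fun v => l v) d (fun a _ _ _ => a) t

/-- branch for a repeated letter -/
noncomputable def rc (t : WTree) : WTree := WTree.rec (fun v => l v) d (fun _ b _ _ => b) t

/-- maximal weight -/
noncomputable def mx (t : WTree) : ℕ :=
  WTree.rec (fun v => v) 0 (fun _ _ x y => bif Nat.ble x y then y else x) t

/-- the depth is at most `k` -/
noncomputable def dep (t : WTree) : ℕ → Bool :=
  WTree.rec (fun _ _ => true) (fun _ => true)
    (fun _ _ f g k => Nat.rec false (fun k _ => f k && g k) k) t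

/-- comparison of lists of numbers -/
noncomputable def eqL (u : List ℕ) : List ℕ → Bool :=
  List.rec (fun v => List.rec true (fun _ _ _ => false) v)
    (fun x _ f v => List.rec false (fun y v' _ => Nat.beq x y && f v') v) u

/-- All weights are positive and all `d` are reached by squares; `acc` is the reversed path. -/
noncomputable def ok (t : WTree) : List ℕ → ℕ → ℕ → ℕ → Bool :=
  WTree.rec (fun v _ _ _ _ => Nat.ble 1 v)
    (fun acc _ _ _ => eqL (acc.take (acc.length / 2)) (acc.drop (acc.length / 2)))
    (fun _ _ f g acc x y z => g (x :: acc) y x z && f (z :: acc) y z x) t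

/-- The weight inequalities. -/
noncomputable def chk (N D : ℕ) (t : WTree) : WTree → WTree → Bool :=
  WTree.rec (fun v a b => Nat.ble ((mx a + mx b) * D) (N * v))
    (fun _ _ => true)
    (fun _ _ f g a b => f (lc a) (lc b) && g (rc a) (rc b)) t

/-- The weight of the word `x :: y :: r`. -/
def look : WTree → Fin 3 → Fin 3 → List (Fin 3) → ℕ
  | l v, _, _, _ => v
  | d, _, _, _ => 0
  | n _ _, _, _, [] => 0
  | n a b, x, y, z :: r => if z = x then look b y z r else look a y z r

theorem eqL_sound : ∀ u v : List ℕ, eqL u v = true → u = v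
  | [], [], _ => rfl
  | [], _ :: _, h => by simp [eqL] at h
  | _ :: _, [], h => by simp [eqL] at h
  | x :: u, y :: v, h => by
    have h' : (Nat.beq x y && eqL u v) = true := h
    rw [Bool.and_eq_true] at h'
    rw [Nat.eq_of_beq_eq_true h'.1, eqL_sound u v h'.2]

theorem look_le_mx (t : WTree) : ∀ x y r, look t x y r ≤ mx t := by
  induction t with
  | l v => intro x y r; exact le_refl _
  | d => intro x y r; exact le_refl _
  | n a b iha ihb =>
    intro x y r
    have hmx : mx (n a b) = bif Nat.ble (mx a) (mx b) then mx b else mx a := rfl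
    have h1 : mx a ≤ mx (n a b) ∧ mx b ≤ mx (n a b) := by
      rw [hmx]
      cases h : Nat.ble (mx a) (mx b)
      · have : ¬ (mx a ≤ mx b) := fun hh => by
          rw [Nat.ble_eq_true_of_le hh] at h; cases h
        simp only [cond_false]; omega
      · have := Nat.le_of_ble_eq_true h
        simp only [cond_true]; omega
    cases r with
    | nil => simp [look]
    | cons z r =>
      simp only [look]
      split
      · exact (ihb _ _ _).trans h1.2
      · exact (iha _ _ _).trans h1.1

theorem look_child (t : WTree) (x y z : Fin 3) (r : List (Fin 3)) :
    look t x y (z :: r) = if z = x then look (rc t) y z r else look (lc t) y z r := by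
  cases t with
  | l v => simp [look, rc, lc]
  | d => simp [look, rc, lc]
  | n a b => rfl

theorem chk_sound (N D : ℕ) (t : WTree) : ∀ (a b : WTree) (k : ℕ) (x y : Fin 3) (r : List (Fin 3)),
    chk N D t a b = true → dep t k = true → k ≤ r.length → 1 ≤ look t x y r →
    (look a x y r + look b x y r) * D ≤ N * look t x y r := by
  induction t with
  | l v =>
    intro a b k x y r hc _ _ _
    have h : (mx a + mx b) * D ≤ N * v := Nat.le_of_ble_eq_true hc
    have h1 := look_le_mx a x y r
    have h2 := look_le_mx b x y r
    have h3 : look (l v) x y r = v := by simp [look]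
    rw [h3]; exact le_trans (Nat.mul_le_mul_right _ (Nat.add_le_add h1 h2)) h
  | d =>
    intro a b k x y r _ _ _ h
    simp [look] at h
  | n t0 t1 ih0 ih1 =>
    intro a b k x y r hc hd hk hl
    have hc' : (chk N D t0 (lc a) (lc b) && chk N D t1 (rc a) (rc b)) = true := hc
    rw [Bool.and_eq_true] at hc'
    cases k with
    | zero => exact absurd hd (by simp [dep])
    | succ k =>
      have hd' : (dep t0 k && dep t1 k) = true := hd
      rw [Bool.and_eq_true] at hd'
      cases r with
      | nil => simp at hk
      | cons z r =>
        have hk' : k ≤ r.length := by simpa using hk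
        rw [look_child a, look_child b, look_child (n t0 t1)]
        rw [look_child (n t0 t1)] at hl
        by_cases hz : z = x
        · simp only [hz, if_true] at hl ⊢
          exact ih1 _ _ k _ _ _ hc'.2 hd'.2 hk' hl
        · simp only [hz, if_false] at hl ⊢
          exact ih0 _ _ k _ _ _ hc'.1 hd'.1 hk' hl

theorem ok_sound (σ : ℕ → Fin 3)
    (t : WTree) : ∀ (k : ℕ) (acc : List ℕ) (x y z : ℕ) (r : List (Fin 3)),
    (∀ c : Fin 3, c = σ x ∨ c = σ y ∨ c = σ z) →
    ok t (y :: x :: acc) x y z = true → dep t k = true → k ≤ r.length →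
    SquareFree (((y :: x :: acc).map σ).reverse ++ r) →
    1 ≤ look t (σ x) (σ y) r := by
  induction t with
  | l v =>
    intro k acc x y z r _ ho _ _ _
    have h : 1 ≤ v := Nat.le_of_ble_eq_true ho
    simpa [look] using h
  | d =>
    intro k acc x y z r _ ho _ _ hs
    exfalso
    have h := eqL_sound _ _ ho
    generalize hL : y :: x :: acc = L at *
    have hlen : 2 ≤ L.length := by rw [← hL]; simp
    have hp : 1 ≤ L.length / 2 := by omega
    generalize L.length / 2 = p at *
    have e : L = L.take p ++ L.take p := by
      conv_lhs => rw [← List.take_append_drop p L, ← h]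
    have h2 := hs [] ((L.take p).map σ).reverse r (by
      conv_lhs => rw [e]
      simp)
    have h3 := congrArg List.length h2
    rw [List.length_reverse, List.length_map, List.length_take, List.length_nil] at h3
    omega
  | n a b iha ihb =>
    intro k acc x y z r hc ho hd hk hs
    have ho' : (ok b (x :: y :: x :: acc) y x z && ok a (z :: y :: x :: acc) y z x) = true := ho
    rw [Bool.and_eq_true] at ho'
    cases k with
    | zero => exact absurd hd (by simp [dep])
    | succ k =>
      have hd' : (dep a k && dep b k) = true := hd
      rw [Bool.and_eq_true] at hd'
      cases r with
      | nil => simp at hk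
      | cons w r =>
        have hk' : k ≤ r.length := by simpa using hk
        rw [look_child]
        by_cases hz : w = σ x
        · simp only [hz, if_true]
          refine ihb k (x :: acc) y x z r (fun c => ?_) ho'.1 hd'.2 hk' ?_
          · have := hc c; tauto
          · rw [hz] at hs
            simpa using hs
        · simp only [hz, if_false]
          have hzy : w ≠ σ y := by
            intro h
            have := hs ((acc.map σ).reverse ++ [σ x]) [σ y] r (by rw [h]; simp)
            simp at this
          have hw : w = σ z := by have := hc w; tauto
          rw [hw] at hs ⊢
          refine iha k (x :: acc) y z x r (fun c => ?_) ho'.2 hd'.1 hk' ?_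
          · have := hc c; tauto
          · simpa using hs

theorem third_exists (x y : Fin 3) (h : x ≠ y) :
    ∃ z, z ≠ y ∧ ∀ c : Fin 3, c = x ∨ c = y ∨ c = z := by
  revert x y; decide

/-- A square-free word that is long enough has a positive weight. -/
theorem look_pos (t : WTree) (k : ℕ) (ho : ok t [1, 0] 0 1 2 = true) (hd : dep t k = true)
    (x y : Fin 3) (r : List (Fin 3)) (hk : k ≤ r.length) (hs : SquareFree (x :: y :: r)) :
    1 ≤ look t x y r := by
  have hxy : x ≠ y := by
    intro h
    have := hs [] [y] r (by simp [h])
    simp at this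
  obtain ⟨z, _, hz⟩ := third_exists x y hxy
  exact ok_sound (fun i => if i = 0 then x else if i = 1 then y else z) t k [] 0 1 2 r
    (by simpa using hz) ho hd hk (by simpa using hs)

end WTree

open WTree

/-- weight of a word -/
def wt (t : WTree) : List (Fin 3) → ℕ
  | x :: y :: r => look t x y r
  | _ => 0

theorem SquareFree.tail' {a : Fin 3} {w : List (Fin 3)} (h : SquareFree (a :: w)) :
    SquareFree w := fun x y z e => h (a :: x) y z (by simp [e])

/-- the square-free words of length `n` -/
noncomputable def sqf (n : ℕ) : Finset (List (Fin 3)) :=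
  (Set.Finite.subset (List.finite_length_eq (Fin 3) n)
    (fun w (h : w ∈ {w : List (Fin 3) | w.length = n ∧ SquareFree w}) => h.1)).toFinset

theorem mem_sqf (n : ℕ) (w : List (Fin 3)) : w ∈ sqf n ↔ w.length = n ∧ SquareFree w := by
  simp [sqf]

theorem s_eq (n : ℕ) : s n = (sqf n).card := by
  rw [s, ← Nat.card_eq_finsetCard]
  exact Nat.card_congr (Equiv.subtypeEquivRight fun w => (mem_sqf n w).symm)

theorem s_le (t : WTree) (k : ℕ) (ho : ok t [1, 0] 0 1 2 = true) (hd : dep t k = true)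
    (n : ℕ) (hn : k + 2 ≤ n) : s n ≤ ∑ w ∈ sqf n, wt t w := by
  rw [s_eq, Finset.card_eq_sum_ones]
  refine Finset.sum_le_sum fun w hw => ?_
  rw [mem_sqf] at hw
  match w, hw with
  | [], h => simp at h; omega
  | [_], h => simp at h; omega
  | x :: y :: r, h =>
    exact look_pos t k ho hd x y r (by have := h.1; simp at this; omega) h.2

theorem step (N D : ℕ) (t0 t1 : WTree) (k : ℕ) (ho : ok (n t0 t1) [1, 0] 0 1 2 = true)
    (hd : dep (n t0 t1) k = true) (hc : chk N D (n t0 t1) t0 t1 = true)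
    (m : ℕ) (hm : k + 2 ≤ m) :
    (∑ w ∈ sqf (m + 1), wt (n t0 t1) w) * D ≤ N * ∑ w ∈ sqf m, wt (n t0 t1) w := by
  have hmap : ∀ w ∈ sqf (m + 1), w.tail ∈ sqf m := by
    intro w hw
    rw [mem_sqf] at hw ⊢
    cases w with
    | nil => simp at hw
    | cons a w => exact ⟨by simpa using hw.1, hw.2.tail'⟩
  rw [← Finset.sum_fiberwise_of_maps_to hmap, Finset.sum_mul, Finset.mul_sum]
  refine Finset.sum_le_sum fun w hw => ?_
  rw [mem_sqf] at hw
  match w, hw with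
  | [], h => simp at h; omega
  | [_], h => simp at h; omega
  | x :: y :: r, h =>
    have hk : k ≤ r.length := by have := h.1; simp at this; omega
    have hpos := look_pos _ k ho hd x y r hk h.2
    have hxy : x ≠ y := by
      intro e
      have := h.2 [] [y] r (by simp [e])
      simp at this
    obtain ⟨z, hz', hz⟩ := third_exists x y hxy
    have hsub : (sqf (m + 1)).filter (fun v => v.tail = x :: y :: r) ⊆
        {z :: x :: y :: r, y :: x :: y :: r} := by
      intro v hv
      rw [Finset.mem_filter, mem_sqf] at hv
      obtain ⟨⟨hl, hs⟩, ht⟩ := hv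
      cases v with
      | nil => simp at hl
      | cons c v =>
        simp only [List.tail_cons] at ht
        subst ht
        rcases hz c with e | e | e
        · have := hs [] [x] (y :: r) (by simp [e])
          simp at this
        · simp [e]
        · simp [e]
    have h1 := chk_sound N D _ _ _ k x y r hc hd hk hpos
    have e1 : wt (n t0 t1) (z :: x :: y :: r) = look t0 x y r := by
      simp [wt, look, hz'.symm]
    have e2 : wt (n t0 t1) (y :: x :: y :: r) = look t1 x y r := by
      simp [wt, look]
    have h2 := (Finset.sum_le_sum_of_subset (f := wt (n t0 t1)) hsub)
    rw [Finset.sum_pair (by simpa using hz'), e1, e2] at h2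
    exact (Nat.mul_le_mul_right _ h2).trans h1

theorem bound_of_cert (t0 t1 : WTree) (k : ℕ) (ho : ok (n t0 t1) [1, 0] 0 1 2 = true)
    (hd : dep (n t0 t1) k = true) (hc : chk 130193811 100000000 (n t0 t1) t0 t1 = true) :
    ∃ C : ℝ, 1 ≤ C ∧ ∀ m : ℕ, k + 2 ≤ m → (s m : ℝ) ≤ C * (1.30193811 : ℝ) ^ m := by
  refine ⟨max 1 (∑ w ∈ sqf (k + 2), wt (n t0 t1) w : ℕ), le_max_left _ _, fun m hm => ?_⟩
  have hmain : ∀ m : ℕ, k + 2 ≤ m → ((∑ w ∈ sqf m, wt (n t0 t1) w : ℕ) : ℝ) ≤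
      max 1 ((∑ w ∈ sqf (k + 2), wt (n t0 t1) w : ℕ) : ℝ) * (1.30193811 : ℝ) ^ m := by
    intro m hm
    induction m, hm using Nat.le_induction with
    | base =>
      refine (le_max_right 1 _).trans (le_mul_of_one_le_right (by positivity) ?_)
      exact one_le_pow₀ (by norm_num)
    | succ m hm ih =>
      have h := step 130193811 100000000 t0 t1 k ho hd hc m hm
      have h' : ((∑ w ∈ sqf (m + 1), wt (n t0 t1) w : ℕ) : ℝ) * 100000000 ≤
          130193811 * ((∑ w ∈ sqf m, wt (n t0 t1) w : ℕ) : ℝ) := by exact_mod_cast h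
      rw [pow_succ]
      linarith
  exact le_trans (by exact_mod_cast s_le _ k ho hd m hm) (hmain m hm)

theorem final (k : ℕ) (C : ℝ) (hC : 1 ≤ C)
    (h : ∀ m : ℕ, k + 2 ≤ m → (s m : ℝ) ≤ C * (1.30193811 : ℝ) ^ m) (S : ℝ)
    (hS : Filter.Tendsto (fun n : ℕ => Real.log (s n) / n) Filter.atTop (nhds S)) :
    Real.exp S < 1.30193812 := by
  have hlim : Filter.Tendsto (fun m : ℕ => Real.log C / m + Real.log 1.30193811) Filter.atTop
      (nhds (0 + Real.log 1.30193811)) :=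
    (tendsto_const_div_atTop_nhds_zero_nat _).add tendsto_const_nhds
  have hle : S ≤ 0 + Real.log 1.30193811 := by
    refine le_of_tendsto_of_tendsto hS hlim ?_
    filter_upwards [Filter.eventually_ge_atTop (k + 2)] with m hm
    have hm0 : (0 : ℝ) < m := by exact_mod_cast (by omega : 0 < m)
    have hlog : Real.log (s m) ≤ Real.log C + m * Real.log 1.30193811 := by
      have h1 : Real.log (C * (1.30193811 : ℝ) ^ m) = Real.log C + m * Real.log 1.30193811 := by
        rw [Real.log_mul (by positivity) (by positivity), Real.log_pow]
      rw [← h1]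
      rcases Nat.eq_zero_or_pos (s m) with h0 | h0
      · rw [h0, Nat.cast_zero, Real.log_zero, h1]
        have := Real.log_nonneg hC
        have := Real.log_nonneg (show (1 : ℝ) ≤ 1.30193811 by norm_num)
        positivity
      · exact Real.log_le_log (by exact_mod_cast h0) (h m hm)
    rw [div_le_iff₀ hm0, add_mul, div_mul_cancel₀ _ hm0.ne']
    linarith
  calc Real.exp S ≤ Real.exp (Real.log 1.30193811) := Real.exp_le_exp.2 (by linarith)
    _ = 1.30193811 := Real.exp_log (by norm_num)
    _ < 1.30193812 := by norm_num

set_option maxRecDepth 100000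

/-- the certificate, words that start with three different letters -/
noncomputable def cert0 : WTree :=
(n (n (n d (n (n (n (n (l 259823) (n (n (n (n (l 120670) (n (n d (l 1)) (l 1))) (n (n (n (n (l 215528) 
(n (n (n (n (l 214490) (n (n (n (l 213741) (n (n (n (n (l 212736) (n (n (n (n (l 203325) (n (n (n (l 189682) 
(n (n (n (n (l 171389) (n (n (n (n (l 1) (n d (l 1))) (l 119306)) (l 119306)) (l 119306))) (l 171389)) 
(l 171389)) (l 171389))) (l 203325)) (l 203325))) (l 209876)) (l 209876)) (l 209876))) (l 212736)) (l 212736)) 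
(l 212736))) (l 214490)) (l 214490))) (n (n (l 213570) (n (n (n (n (l 211866) (n (n (n (n (l 190371) 
(n (n (n (l 176556) (n (n (n (n (l 95544) (n (n (n (l 1) d) (l 1)) (l 95544))) (l 95544)) (l 149291)) 
(l 149291))) (l 190371)) (l 190371))) (l 201450)) (l 208367)) (l 208367))) (l 211866)) (l 211866)) (l 211866))) 
(l 214850))) (n (n (n (l 214790) (n (n (l 214627) (n (n (n (l 214283) (n (n (n (n (l 213930) 
(n (n (n (n (l 209390) (n (n (n (l 201301) (n (n (n (n (l 186642) (n (n (l 162766) (n (n (n (l 119306) 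
(n (n (l 1) (n d (l 1))) (l 119306))) (l 119306)) (l 162766))) (l 162766))) (l 186642)) (l 201301)) (l 201301))) 
(l 209390)) (l 209390))) (l 210784)) (l 212632)) (l 212632))) (l 213930)) (l 213930)) (l 213930))) (l 214627)) 
(l 214627))) (l 214790))) (l 214790)) (l 214850))) (l 215338))) (l 215528)) (n (n (n (n (l 215018) (n (n (l 213468) 
(n (n (n (n (l 208266) (n (n (n (n (l 193086) (n (n (n (l 161908) (n (n (l 95676) (n (n (n (n (l 1) 
d) (l 1)) (l 95676)) (l 95676))) (l 161908))) (l 161908)) (l 193086))) (l 193086)) (l 204535)) (l 204535))) 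
(l 211192)) (l 211192)) (l 211192))) (l 215018))) (n (n (n (l 214818) (n (n (l 214606) (n (n (n (l 214383) 
(n (n (n (n (l 213068) (n (n (n (n (l 208499) (n (n (n (l 208499) (n (n (l 186677) (n (n (n (l 162801) 
(n (n (n (l 119219) (n (n (l 1) (n d (l 1))) (l 119219))) (l 119219)) (l 162801))) (l 162801)) (l 186677))) 
(l 200278))) (l 208499)) (l 208499))) (l 208499)) (l 211415)) (l 211415))) (l 213770)) (l 213770)) (l 213770))) 
(l 214606)) (l 214606))) (l 214818))) (n (n (n (n (l 214363) (n (n (n (l 214097) (n (n (n (n (l 213023) 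
(n (n (n (n (l 210347) (n (n (n (l 204098) (n (n (l 196338) (n (n (n (l 171014) (n (n (l 171014) 
(n (n (n (n (l 1) (n d (l 1))) (l 118997)) (l 118997)) (l 118997))) (l 171014))) (l 171014)) (l 196338))) 
(l 196338))) (l 204098)) (l 210347))) (l 210347)) (l 211788)) (l 211788))) (l 213627)) (l 213627)) (l 213627))) 
(l 214363)) (l 214363))) (n (n (l 214076) (n (n (n (n (l 212255) (n (n (n (n (l 207173) (n (n (n (l 196833) 
(n (n (l 187695) (n (n (n (l 148638) (n (n (l 95528) (n (n (n (l 1) d) (l 1)) (l 95528))) (l 95528))) 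
(l 148638)) (l 187695))) (l 187695))) (l 196833)) (l 207173))) (l 207173)) (l 210414)) (l 210414))) (l 213279)) 
(l 213279)) (l 213279))) (l 214525))) (l 214525)) (l 214747))) (l 214895))) (l 215655)) (l 215822))) (l 216287))) 
(n (n (n (n (l 215329) (n (n (n (n (l 213962) (n (n (l 212822) (n (n (n (n (l 206463) (n (n (n (n (l 199686) 
(n (n (l 183733) (n (n (n (n (l 94790) (n (n (n (n (l 1) d) (l 1)) (l 94790)) (l 94790))) (l 160739)) 
(l 160739)) (l 160739))) (l 199686))) (l 199686)) (l 206463)) (l 206463))) (l 211178)) (l 211178)) (l 211178))) 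
(l 213962))) (n (n (l 213867) (n (n (n (l 213699) (n (n (l 213302) (n (n (n (n (l 211088) (n (n (n (n (l 207549) 
(n (n (l 203721) (n (n (n (n (l 186775) (n (n (n (l 148013) (n (n (l 94790) (n (n (n (l 1) 
d) (l 1)) (l 94790))) (l 94790))) (l 148013)) (l 186775))) (l 186775)) (l 195913)) (l 195913))) (l 207549))) 
(l 207549)) (l 211088)) (l 211088))) (l 212727)) (l 212727)) (l 212727))) (l 213699))) (l 213699)) (l 213867))) 
(l 213867))) (n (n (n (n (l 212650) (n (n (n (l 212523) (n (n (l 212177) (n (n (n (n (l 210656) 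
(n (n (n (n (l 207756) (n (n (l 201719) (n (n (n (n (l 187347) (n (n (l 173999) (n (n (n (n (l 93104) 
(n (n (n (l 1) d) (l 1)) (l 93104))) (l 93104)) (l 146812)) (l 146812))) (l 187347))) (l 187347)) (l 201719)) 
(l 201719))) (l 207756))) (l 207756)) (l 210656)) (l 210656))) (l 211747)) (l 211747)) (l 211747))) (l 212523))) 
(l 212523)) (l 212650))) (n (n (n (n (l 206821) (n (n (n (n (l 191547) (n (n (l 163270) (n (n (n (n (l 119546) 
(n (n (l 1) (n d (l 1))) (l 119546))) (l 119546)) (l 163270)) (l 163270))) (l 191547))) (l 191547)) (l 206821)) 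
(l 206821))) (l 210513)) (l 210513)) (l 210513))) (l 214409)) (l 214409))) (l 215329))) (n (n (n (n (l 213803) 
(n (n (n (l 212390) (n (n (n (n (l 207836) (n (n (n (n (l 200945) (n (n (l 170863) (n (n (n (l 170863) 
(n (n (n (n (l 1) (n d (l 1))) (l 119056)) (l 119056)) (l 119056))) (l 170863)) (l 170863))) (l 189167))) 
(l 200945)) (l 207836)) (l 207836))) (l 211003)) (l 211003)) (l 211003))) (n (n (n (n (l 213585) (n (n (l 213241) 
(n (n (n (n (l 211678) (n (n (n (n (l 210152) (n (n (l 202412) (n (n (n (l 190851) (n (n (n (n (l 159868) 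
(n (n (l 94657) (n (n (n (n (l 1) d) (l 1)) (l 94657)) (l 94657))) (l 159868))) (l 159868)) (l 190851)) 
(l 190851))) (l 202412)) (l 202412))) (l 207032))) (l 210152)) (l 211678)) (l 211678))) (l 212867)) (l 212867)) 
(l 212867))) (l 213585))) (l 213585)) (l 213714)) (l 213714))) (l 213803))) (n (n (l 212135) (n (n (n (n (l 201889) 
(n (n (n (n (l 201889) (n (n (l 149201) (n (n (n (l 95266) (n (n (n (l 1) d) (l 1)) (l 95266))) 
(l 95266)) (l 149201))) (l 176457))) (l 201889)) (l 201889)) (l 201889))) (l 209755)) (l 209755)) (l 209755))) 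
(l 214412))) (n (n (n (l 214237) (n (n (n (n (l 213793) (n (n (l 213323) (n (n (n (n (l 211374) 
(n (n (n (n (l 208366) (n (n (l 203455) (n (n (n (l 198192) (n (n (l 160100) (n (n (n (l 94889) 
(n (n (n (n (l 1) d) (l 1)) (l 94889)) (l 94889))) (l 160100)) (l 160100))) (l 183094))) (l 198192)) (l 203455))) 
(l 203455))) (l 208366)) (l 211374)) (l 211374))) (l 213037)) (l 213037)) (l 213037))) (l 213793))) (l 213793)) 
(n (n (n (l 213350) (n (n (n (n (l 210999) (n (n (n (n (l 206337) (n (n (l 200814) (n (n (n (l 186116) 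
(n (n (l 162531) (n (n (n (l 119072) (n (n (l 1) (n d (l 1))) (l 119072))) (l 119072)) (l 162531))) 
(l 162531))) (l 186116)) (l 200814))) (l 200814))) (l 206337)) (l 210999)) (l 210999))) (l 212980)) (l 212980)) 
(l 212980))) (l 213961)) (l 213961))) (l 214237))) (l 214353)) (l 214454))) (l 215320))) (l 216009)) (l 216520))) 
(l 217512))) (n (n (n (n (l 278842) (n (n (n (n (l 278198) (n (n (n (l 276909) (n (n (n (n (l 276492) 
(n (n (n (n (l 273216) (n (n (n (l 268467) (n (n (n (n (l 262099) (n (n (n (n (l 202439) (n (n (n (l 115959) 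
(n (n d (l 1)) (l 1))) (l 202439)) (l 202439))) (l 243969)) (l 243969)) (l 243969))) (l 262099)) (l 262099)) 
(l 262099))) (l 273216)) (l 273216))) (l 275496)) (l 275496)) (l 275496))) (l 276492)) (n (n (n (l 276272) 
(n (n (l 276272) (n (n (n (n (l 274791) (n (n (n (l 273108) (n (n (n (n (l 266299) (n (n (n (n (l 249338) 
(n (n (n (l 209723) (n (n (l 160532) (n (n (n (l 1) d) (l 1)) (l 160532))) (l 160532))) (l 209723)) 
(l 249338))) (l 249338)) (l 258467)) (l 258467))) (l 270127)) (l 270127)) (l 270127))) (l 274791)) (l 274791))) 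
(l 275822)) (l 275822)) (l 275822))) (l 276272))) (l 276272)) (l 276492))) (l 276492))) (n (n (n (l 277170) 
(n (n (n (n (l 271634) (n (n (n (l 263241) (n (n (n (n (l 234374) (n (n (n (n (l 190690) (n (n (l 1) 
(n d (l 1))) (l 116026))) (l 190690)) (l 234374)) (l 234374))) (l 254451)) (l 254451)) (l 254451))) (l 271634)) 
(l 271634))) (l 275491)) (l 275491)) (l 275491))) (l 277170)) (l 277170))) (l 277817))) (n (n (n (n (l 276917) 
(n (n (n (l 276917) (n (n (n (n (l 271090) (n (n (n (l 271090) (n (n (n (n (l 234152) (n (n (n (l 234152) 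
(n (n (n (n (l 1) (n d (l 1))) (l 116080)) (l 190424)) (l 190424))) (l 234152)) (l 234152))) (l 252464)) 
(l 264191)) (l 264191))) (l 271090)) (l 271090))) (l 273978)) (l 275828)) (l 275828))) (l 276917)) (l 276917))) 
(l 277372)) (n (n (n (n (l 276994) (n (n (n (n (l 269511) (n (n (n (l 264702) (n (n (n (n (l 236502) 
(n (n (n (l 203244) (n (n (l 116080) (n (n d (l 1)) (l 1))) (l 203244))) (l 203244)) (l 236502))) (l 236502)) 
(l 255211)) (l 255211))) (l 269511)) (l 269511))) (l 273368)) (l 275776)) (l 275776))) (n (n (l 276656) 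
(n (n (n (l 276656) (n (n (n (n (l 274195) (n (n (n (l 272479) (n (n (n (n (l 263513) (n (n (n (l 257036) 
(n (n (l 233343) (n (n (n (l 189830) (n (n (l 1) (n d (l 1))) (l 116080))) (l 189830)) (l 233343))) 
(l 233343))) (l 257036)) (l 263513))) (l 263513)) (l 269038)) (l 269038))) (l 274195)) (l 274195))) (l 275545)) 
(l 276385)) (l 276385))) (l 276656)) (l 276656))) (l 276862))) (l 276994)) (l 277071))) (l 278110))) (n (n (n (n (l 229329) 
(n (n (n (l 162445) (n (n (n (n (l 1) d) (l 1)) (l 162445)) (l 162445))) (l 229329)) (l 229329))) (n (n (n (n (l 252405) 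
(n (n (n (l 252183) (n (n (l 252183) (n (n (n (n (l 250293) (n (n (n (l 249025) (n (n (n (n (l 245011) 
(n (n (l 227131) (n (n (n (l 212878) (n (n (n (n (l 162388) (n (n (n (l 1) d) (l 1)) (l 162388))) 
(l 162388)) (l 185591)) (l 185591))) (l 227131)) (l 227131))) (l 238095))) (l 245011)) (l 249025)) (l 249025))) 
(l 250293)) (l 250293))) (l 251111)) (l 251747)) (l 251747))) (l 252183))) (l 252183)) (l 252405))) (l 252405)) 
(n (n (n (l 252317) (n (n (n (n (l 252194) (n (n (n (n (l 250614) (n (n (n (l 247798) (n (n (n (n (l 242695) 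
(n (n (l 234384) (n (n (n (l 219256) (n (n (l 177726) (n (n (n (l 90048) (n (n d (l 1)) (l 1))) 
(l 177726)) (l 177726))) (l 219256))) (l 219256)) (l 234384))) (l 234384))) (l 242695)) (l 247798)) (l 247798))) 
(l 250614)) (l 250614))) (l 251099)) (l 251743)) (l 251743))) (l 252194)) (l 252194)) (l 252194))) (l 252437)) 
(l 252437))) (l 252494))) (l 267840)) (l 267861))) (l 278756))) (l 279022)) (n (n (n (n (l 276739) (n (n (n (n (l 273547) 
(n (n (n (l 272699) (n (n (n (n (l 268251) (n (n (n (l 263004) (n (n (l 249254) (n (n (n (n (l 230942) 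
(n (n (n (n (l 1) (n d (l 1))) (l 119041)) (l 193348)) (l 193348))) (l 230942)) (l 230942)) (l 230942))) 
(l 263004))) (l 263004)) (l 268251))) (l 268251)) (l 271202)) (l 271202))) (n (n (n (n (l 273247) (n (n (l 273051) 
(n (n (n (n (l 271863) (n (n (n (l 270496) (n (n (l 266777) (n (n (n (n (l 250436) (n (n (n (n (l 219275) 
(n (n (l 154417) (n (n (n (n (l 1) d) (l 1)) (l 154417)) (l 154417))) (l 219275))) (l 219275)) (l 250436)) 
(l 250436))) (l 262157)) (l 262157)) (l 262157))) (l 270496))) (l 270496)) (l 271863))) (l 271863)) (l 272652)) 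
(l 272652))) (l 273247))) (l 273247)) (l 273458)) (l 273458))) (l 273547))) (n (n (n (n (l 272770) (n (n (l 272507) 
(n (n (n (l 272298) (n (n (n (n (l 271557) (n (n (n (l 269172) (n (n (l 269172) (n (n (n (n (l 248856) 
(n (n (n (l 235235) (n (n (n (n (l 192110) (n (n (l 1) (n d (l 1))) (l 117803))) (l 192110)) (l 235235)) 
(l 235235))) (l 248856)) (l 248856))) (l 257646)) (l 264482)) (l 264482))) (l 269172))) (l 269172)) (l 271557))) 
(l 271557)) (l 271897)) (l 271897))) (l 272507)) (l 272507))) (l 272668))) (l 272770)) (n (n (n (n (l 265240) 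
(n (n (n (l 250811) (n (n (l 236559) (n (n (n (n (l 155025) (n (n (n (l 1) d) (l 1)) (l 155025))) 
(l 155025)) (l 209297)) (l 209297))) (l 250811))) (l 250811)) (l 265240))) (l 265240)) (l 270291)) (l 270291))) 
(l 274155))) (n (n (n (n (l 272670) (n (n (n (n (l 267386) (n (n (n (l 256533) (n (n (l 233478) 
(n (n (n (n (l 200173) (n (n (l 119056) (n (n d (l 1)) (l 1))) (l 200173))) (l 200173)) (l 233478)) 
(l 233478))) (l 256533))) (l 256533)) (l 267386))) (l 267386)) (l 271371)) (l 271371))) (n (n (n (n (l 273413) 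
(n (n (l 273141) (n (n (n (n (l 272073) (n (n (n (l 268981) (n (n (l 263183) (n (n (n (n (l 257920) 
(n (n (l 219489) (n (n (n (l 154632) (n (n (n (n (l 1) d) (l 1)) (l 154632)) (l 154632))) (l 219489)) 
(l 219489))) (l 242643))) (l 257920)) (l 263183)) (l 263183))) (l 268981))) (l 268981)) (l 272073))) (l 272073)) 
(l 273141)) (l 273141))) (l 273413))) (l 273413)) (l 273689)) (l 273689))) (l 273804)) (l 273804))) (l 276520))) 
(n (n (n (n (l 238673) (n (n (n (l 194904) (n (n (l 1) (n d (l 1))) (l 120126))) (n (n (n (l 194731) 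
(n (n (l 194375) (n (n (n (n (l 192314) (n (n (n (l 190128) (n (n (l 186033) (n (n (n (l 167858) 
(n (n (n (n (l 129076) (n (n (l 74777) (n (n (n (l 1) d) (l 1)) (l 74777))) (l 74777))) (l 129076)) 
(l 167858)) (l 167858))) (l 186033)) (l 186033))) (l 186033))) (l 190128)) (l 192314))) (l 192314)) (l 193629)) 
(l 193629))) (l 194731))) (l 194731)) (l 194904))) (l 238547))) (n (n (l 238446) (n (n (n (n (l 238095) 
(n (n (l 237777) (n (n (n (n (l 235714) (n (n (n (l 235714) (n (n (l 226873) (n (n (n (l 215424) 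
(n (n (n (l 184223) (n (n (l 118269) (n (n (n (n (l 1) d) (l 1)) (l 118269)) (l 118269))) (l 184223))) 
(l 184223)) (l 215424))) (l 215424)) (l 226873))) (l 230603))) (l 235714)) (l 235714))) (l 235714)) (l 237030)) 
(l 237030))) (l 238095))) (n (n (n (n (l 237637) (n (n (n (n (l 236047) (n (n (n (l 236047) (n (n (l 228450) 
(n (n (n (l 220139) (n (n (n (l 204968) (n (n (l 163469) (n (n (n (l 119825) (n (n d (l 1)) 
(l 1))) (l 163469)) (l 163469))) (l 204968))) (l 204968)) (l 220139))) (l 220139)) (l 228450))) (l 233185))) 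
(l 236047)) (l 236047))) (l 236047)) (l 237062)) (l 237062))) (l 237882)) (l 237882)) (l 237882))) (l 238446)) 
(l 238446))) (l 238673))) (n (n (n (n (l 262286) (n (n (n (n (l 261940) (n (n (l 261667) (n (n (n (n (l 260455) 
(n (n (n (l 257684) (n (n (l 253879) (n (n (n (l 247102) (n (n (l 231150) (n (n (n (n (l 142173) 
(n (n (n (n (l 1) d) (l 1)) (l 142173)) (l 142173))) (l 208053)) (l 208053)) (l 208053))) (l 247102))) 
(l 247102)) (l 253879))) (l 253879))) (l 257684)) (l 260455))) (l 260455)) (l 261108)) (l 261108))) (l 261940))) 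
(n (n (n (n (l 261566) (n (n (n (n (l 260635) (n (n (n (l 258460) (n (n (l 255758) (n (n (n (l 246943) 
(n (n (l 246943) (n (n (n (n (l 187414) (n (n (n (l 119767) (n (n d (l 1)) (l 1))) (l 187414)) 
(l 187414))) (l 228836)) (l 228836)) (l 228836))) (l 246943))) (l 246943)) (l 255758))) (l 255758))) (l 258460)) 
(l 260635))) (l 260635)) (l 261136)) (l 261136))) (l 261777)) (l 261777)) (l 261777))) (l 262286)) (l 262286))) 
(n (n (n (n (l 261486) (n (n (n (l 261216) (n (n (n (n (l 259802) (n (n (n (l 258780) (n (n (l 255042) 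
(n (n (n (l 248178) (n (n (l 218232) (n (n (n (l 218232) (n (n (n (n (l 1) (n d (l 1))) (l 119709)) 
(l 194228)) (l 194228))) (l 218232)) (l 218232))) (l 236544))) (l 248178)) (l 255042))) (l 255042))) (l 258780)) 
(l 259802))) (l 259802)) (l 260673)) (l 260673))) (l 261486)) (l 261486))) (n (n (l 261236) (n (n (n (n (l 258832) 
(n (n (n (l 254602) (n (n (l 248196) (n (n (n (l 248196) (n (n (l 196247) (n (n (n (l 141990) 
(n (n (n (l 1) d) (l 1)) (l 141990))) (l 141990)) (l 196247))) (l 223509))) (l 248196)) (l 248196))) (l 248196))) 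
(l 254602)) (l 258832))) (l 258832)) (l 260312)) (l 260312))) (l 261699))) (n (n (n (n (l 261198) (n (n (n (n (l 259429) 
(n (n (n (l 255830) (n (n (l 252649) (n (n (n (l 239053) (n (n (l 220566) (n (n (n (l 187313) 
(n (n (l 119709) (n (n d (l 1)) (l 1))) (l 187313))) (l 187313)) (l 220566))) (l 220566))) (l 239053)) 
(l 252649))) (l 252649))) (l 255830)) (l 259429))) (l 259429)) (l 260557)) (l 260557))) (l 261555)) (l 261555)) 
(l 261555))) (l 262417))) (l 262460)) (l 262700))) (l 263008))) (l 283997)) (l 284106))) (l 289895))) (n (n (n (n (l 277497) 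
(n (n (n (n (l 265346) (n (n (n (l 263845) (n (n (l 261699) (n (n (n (n (l 258599) (n (n (l 251049) 
(n (n (n (n (l 225720) (n (n (n (n (l 151808) (n (n (n (l 1) d) (l 1)) (l 151808))) (l 151808)) 
(l 207556)) (l 207556))) (l 239968)) (l 239968)) (l 239968))) (l 258599))) (l 258599)) (l 261699)) (l 261699))) 
(l 263845))) (n (n (n (n (l 261509) (n (n (n (n (l 259150) (n (n (l 253597) (n (n (n (n (l 222636) 
(n (n (n (n (l 189640) (n (n (l 111960) (n (n d (l 1)) (l 1))) (l 189640))) (l 189640)) (l 222636)) 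
(l 222636))) (l 245592)) (l 245592)) (l 245592))) (l 259150))) (l 259150)) (l 261509)) (l 261509))) (n (n (n (n (l 262614) 
(n (n (l 262180) (n (n (n (n (l 261550) (n (n (l 259877) (n (n (n (n (l 252266) (n (n (n (n (l 244836) 
(n (n (l 207148) (n (n (n (l 150860) (n (n (n (n (l 1) d) (l 1)) (l 150860)) (l 150860))) (l 207148)) 
(l 207148))) (l 229643))) (l 244836)) (l 252266)) (l 252266))) (l 258058)) (l 258058)) (l 258058))) (l 261550))) 
(l 261550)) (l 262180)) (l 262180))) (l 262614))) (l 262614)) (n (n (n (l 262255) (n (n (n (n (l 261433) 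
(n (n (l 259148) (n (n (n (n (l 249654) (n (n (n (n (l 235009) (n (n (l 211097) (n (n (n (l 185470) 
(n (n (l 1) (n d (l 1))) (l 111960))) (l 185470)) (l 211097))) (l 211097))) (l 235009)) (l 249654)) (l 249654))) 
(l 257754)) (l 257754)) (l 257754))) (l 261433))) (l 261433)) (l 262255)) (l 262255))) (l 262820)) (l 262820))) 
(l 263019))) (l 263227)) (l 263273))) (l 265283))) (n (n (n (n (l 239512) (n (n (l 239512) (n (n (n (n (l 1) 
(n d (l 1))) (l 112974)) (l 187421)) (l 187421))) (l 239512))) (l 239512)) (n (n (n (n (l 264796) (n (n (n (n (l 264256) 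
(n (n (l 263824) (n (n (n (n (l 262797) (n (n (l 261843) (n (n (n (n (l 256059) (n (n (n (l 249403) 
(n (n (l 231291) (n (n (n (n (l 151727) (n (n (n (n (l 1) d) (l 1)) (l 151727)) (l 151727))) (l 208797)) 
(l 208797)) (l 208797))) (l 249403))) (l 249403)) (l 256059))) (l 256059)) (l 259899)) (l 259899))) (l 262797))) 
(l 262797)) (l 263824)) (l 263824))) (l 264256))) (l 264256)) (n (n (n (l 263901) (n (n (n (n (l 262562) 
(n (n (l 261236) (n (n (n (n (l 256037) (n (n (n (l 240980) (n (n (l 212750) (n (n (n (n (l 187124) 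
(n (n (l 1) (n d (l 1))) (l 112736))) (l 187124)) (l 212750)) (l 212750))) (l 240980))) (l 240980)) (l 256037))) 
(l 256037)) (l 261236)) (l 261236))) (l 262562))) (l 262562)) (l 263901)) (l 263901))) (l 264463)) (l 264463))) 
(l 264664))) (n (n (n (l 264384) (n (n (l 263640) (n (n (n (n (l 262306) (n (n (l 260758) (n (n (n (n (l 250717) 
(n (n (n (l 250717) (n (n (l 207666) (n (n (n (l 151921) (n (n (n (l 1) d) (l 1)) (l 151921))) 
(l 151921)) (l 207666))) (l 225830))) (l 250717)) (l 250717))) (l 250717)) (l 257122)) (l 257122))) (l 262306))) 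
(l 262306)) (l 263640)) (l 263640))) (l 264384))) (n (n (n (n (l 263613) (n (n (n (n (l 262382) (n (n (l 261049) 
(n (n (n (n (l 255150) (n (n (n (l 241657) (n (n (l 223130) (n (n (n (l 190134) (n (n (l 112462) 
(n (n d (l 1)) (l 1))) (l 190134))) (l 190134)) (l 223130))) (l 223130))) (l 241657)) (l 255150))) (l 255150)) 
(l 258331)) (l 258331))) (l 262382))) (l 262382)) (l 263613)) (l 263613))) (l 264184)) (l 264184)) (l 264184))) 
(l 264874))) (l 264920)) (l 265108))) (l 265255))) (n (n (n (n (l 274217) (n (n (n (n (l 271696) (n (n (l 271445) 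
(n (n (n (l 271071) (n (n (n (n (l 270067) (n (n (l 267954) (n (n (n (n (l 264887) (n (n (l 256739) 
(n (n (n (n (l 219684) (n (n (n (n (l 183506) (n (n (l 1) (n d (l 1))) (l 109528))) (l 183506)) 
(l 219684)) (l 219684))) (l 247884)) (l 247884)) (l 247884))) (l 264887))) (l 264887)) (l 267954)) (l 267954))) 
(l 270067))) (l 270067)) (l 271071)) (l 271071))) (l 271445)) (l 271445))) (l 271595))) (n (n (l 271575) 
(n (n (n (n (l 271046) (n (n (n (n (l 270036) (n (n (l 267935) (n (n (n (n (l 262932) (n (n (l 258286) 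
(n (n (n (n (l 230126) (n (n (n (l 197717) (n (n (l 109528) (n (n d (l 1)) (l 1))) (l 197717))) 
(l 197717)) (l 230126))) (l 230126)) (l 248822)) (l 248822))) (l 262932))) (l 262932)) (l 267935)) (l 267935))) 
(l 270036))) (l 270036)) (l 271046)) (l 271046))) (l 271426)) (l 271426)) (l 271426))) (l 271696))) (n (n (n (n (l 264903) 
(n (n (l 253084) (n (n (n (n (l 219768) (n (n (l 162217) (n (n (n (n (l 1) d) (l 1)) (l 162217)) 
(l 162217))) (l 219768))) (l 219768)) (l 253084)) (l 253084))) (l 264903))) (l 264903)) (l 271745)) (l 271745))) 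
(l 274217))) (n (n (n (n (l 271979) (n (n (n (n (l 266662) (n (n (l 256819) (n (n (n (n (l 241599) 
(n (n (l 199985) (n (n (n (l 111791) (n (n d (l 1)) (l 1))) (l 199985)) (l 199985))) (l 241599))) (l 241599)) 
(l 256819)) (l 256819))) (l 266662))) (l 266662)) (l 271979)) (l 271979))) (n (n (l 272835) (n (n (n (l 272388) 
(n (n (n (n (l 270538) (n (n (l 266971) (n (n (n (n (l 266971) (n (n (l 245148) (n (n (n (l 221248) 
(n (n (n (l 185070) (n (n (l 1) (n d (l 1))) (l 111791))) (l 185070)) (l 221248))) (l 221248)) (l 245148))) 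
(l 258758))) (l 266971)) (l 266971)) (l 266971))) (l 270538))) (l 270538)) (l 272388)) (l 272388))) (l 272835)) 
(l 272835))) (l 273094))) (n (n (n (l 272777) (n (n (l 272777) (n (n (n (n (l 270337) (n (n (l 265739) 
(n (n (n (n (l 255383) (n (n (l 255383) (n (n (n (l 215877) (n (n (l 161472) (n (n (n (l 1) 
d) (l 1)) (l 161472))) (l 161472))) (l 215877)) (l 255383))) (l 255383))) (l 255383)) (l 265739)) (l 265739))) 
(l 270337))) (l 270337)) (l 272777)) (l 272777))) (l 272777))) (l 272777)) (l 273264))) (l 273348))) (l 276273)) 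
(l 276448))) (l 277357))) (n (n (n (n (l 261662) (n (n (n (n (l 258547) (n (n (l 256526) (n (n (n (n (l 253400) 
(n (n (l 244853) (n (n (n (l 226740) (n (n (n (n (l 164111) (n (n (n (n (l 1) d) (l 1)) (l 164111)) 
(l 164111))) (l 203781)) (l 203781)) (l 203781))) (l 244853)) (l 244853))) (l 253400))) (l 253400)) (l 256526)) 
(l 256526))) (l 258547))) (n (n (n (n (l 256962) (n (n (n (n (l 254563) (n (n (l 244092) (n (n (n (l 244092) 
(n (n (n (n (l 184615) (n (n (n (l 94436) (n (n d (l 1)) (l 1))) (l 184615)) (l 184615))) (l 226058)) 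
(l 226058)) (l 226058))) (l 244092)) (l 244092))) (l 250463))) (l 254563)) (l 256962)) (l 256962))) (l 258065)) 
(n (n (n (n (l 257766) (n (n (n (l 257566) (n (n (n (n (l 256933) (n (n (l 254112) (n (n (n (l 251864) 
(n (n (n (n (l 243899) (n (n (n (l 218282) (n (n (l 218282) (n (n (n (n (l 1) (n d (l 1))) (l 94436)) 
(l 167886)) (l 167886))) (l 218282))) (l 218282)) (l 243899))) (l 243899)) (l 247559)) (l 247559))) (l 254112)) 
(l 254112))) (l 255842))) (l 256933)) (l 257566)) (l 257566))) (l 257766)) (l 257766))) (l 257895)) (l 257996)) 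
(l 257996))) (l 258065))) (n (n (n (n (l 257325) (n (n (n (l 256918) (n (n (l 256378) (n (n (n (n (l 255888) 
(n (n (l 252312) (n (n (n (l 246275) (n (n (n (n (l 231883) (n (n (l 217635) (n (n (n (n (l 161776) 
(n (n (n (l 1) d) (l 1)) (l 161776))) (l 161776)) (l 217635)) (l 217635))) (l 231883))) (l 231883)) (l 246275)) 
(l 246275))) (l 252312)) (l 252312))) (l 254466))) (l 255888)) (l 256378)) (l 256378))) (l 256918))) (n (n (n (n (l 256374) 
(n (n (n (n (l 255843) (n (n (l 253148) (n (n (n (l 249124) (n (n (n (n (l 238339) (n (n (l 215639) 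
(n (n (n (n (l 182689) (n (n (l 95141) (n (n d (l 1)) (l 1))) (l 182689))) (l 182689)) (l 215639)) 
(l 215639))) (l 238339))) (l 238339)) (l 249124)) (l 249124))) (l 253148)) (l 253148))) (l 254756))) (l 255843)) 
(l 256374)) (l 256374))) (l 256788)) (l 256788)) (l 256788))) (l 257325))) (n (n (n (n (l 253623) (n (n (l 237821) 
(n (n (n (l 209560) (n (n (n (n (l 169777) (n (n (l 1) (n d (l 1))) (l 95429))) (l 169777)) (l 209560)) 
(l 209560))) (l 237821)) (l 237821))) (l 246703))) (l 253623)) (l 257325)) (l 257325))) (l 260100)) (l 260100))) 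
(l 261018))) (n (n (l 261186) (n (n (n (n (l 257408) (n (n (n (n (l 257408) (n (n (l 239067) 
(n (n (n (l 220292) (n (n (n (l 187131) (n (n (l 95637) (n (n d (l 1)) (l 1))) (l 187131))) (l 187131)) 
(l 220292))) (l 220292)) (l 239067))) (l 248555))) (l 257408)) (l 257408)) (l 257408))) (n (n (n (n (l 259257) 
(n (n (l 258525) (n (n (n (n (l 258525) (n (n (l 254043) (n (n (n (l 249134) (n (n (n (l 241704) 
(n (n (l 203695) (n (n (n (l 163999) (n (n (n (n (l 1) d) (l 1)) (l 163999)) (l 163999))) (l 203695)) 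
(l 203695))) (l 226654))) (l 241704)) (l 249134))) (l 249134)) (l 254043))) (l 256838))) (l 258525)) (l 258525)) 
(l 258525))) (l 259257))) (l 259257)) (n (n (n (l 258682) (n (n (n (n (l 258682) (n (n (l 252282) 
(n (n (n (l 246757) (n (n (n (l 232076) (n (n (l 208470) (n (n (n (l 168653) (n (n (l 1) (n d 
(l 1))) (l 95637))) (l 168653)) (l 208470))) (l 208470))) (l 232076)) (l 246757))) (l 246757)) (l 252282))) 
(l 255733))) (l 258682)) (l 258682)) (l 258682))) (l 259637)) (l 259637))) (l 259926))) (l 260238)) (l 260358))) 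
(l 262032))) (n (n (n (n (l 222525) (n (n (n (l 166411) (n (n (l 166238) (n (n (n (l 165472) 
(n (n (n (n (l 163836) (n (n (l 161546) (n (n (n (l 158391) (n (n (l 151909) (n (n (n (n (l 114379) 
(n (n (n (l 74575) (n (n (l 1) (n d (l 1))) (l 1))) (l 74575)) (l 114379))) (l 114379)) (l 138329)) 
(l 138329))) (l 158391))) (l 158391)) (l 161546))) (l 161546))) (l 163836)) (l 165472)) (l 165472))) (l 166238)) 
(l 166238))) (l 166238))) (n (n (n (l 1) d) (l 1)) (l 166411))) (l 166503))) (n (n (n (n (l 222351) (n (n (n (n (l 221938) 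
(n (n (n (l 221494) (n (n (n (n (l 220689) (n (n (l 219378) (n (n (n (l 216992) (n (n (l 210440) 
(n (n (n (l 196609) (n (n (n (n (l 182403) (n (n (n (n (l 1) (n d (l 1))) (l 56022)) (l 130279)) 
(l 130279))) (l 182403)) (l 182403)) (l 182403))) (l 210440)) (l 210440))) (l 216992))) (l 216992)) (l 219378))) 
(l 219378))) (l 220689)) (l 221494)) (l 221494))) (l 221938)) (l 221938))) (l 222015)) (n (n (n (n (l 221438) 
(n (n (n (n (l 220391) (n (n (l 218681) (n (n (n (l 216849) (n (n (l 203590) (n (n (n (l 180890) 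
(n (n (n (n (l 147859) (n (n (l 56022) (n (n d (l 1)) (l 1))) (l 147859))) (l 147859)) (l 180890)) 
(l 180890))) (l 203590)) (l 203590))) (l 211594))) (l 216849)) (l 218681))) (l 218681))) (l 220391)) (l 221438)) 
(l 221438))) (l 222017)) (l 222017)) (l 222017))) (l 222280))) (l 222351)) (n (n (n (n (l 221696) (n (n (l 220751) 
(n (n (n (n (l 218625) (n (n (l 218625) (n (n (n (l 210511) (n (n (l 199338) (n (n (n (l 166175) 
(n (n (l 166175) (n (n (n (n (l 1) d) (l 1)) (l 166175)) (l 166175))) (l 166175))) (l 166175)) (l 199338))) 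
(l 199338))) (l 210511)) (l 218625))) (l 218625))) (l 218625)) (l 220751)) (l 220751))) (l 221696))) (n (n (n (n (l 220877) 
(n (n (n (n (l 219255) (n (n (l 217332) (n (n (n (l 212216) (n (n (l 204006) (n (n (n (l 188878) 
(n (n (l 147429) (n (n (n (l 55521) (n (n d (l 1)) (l 1))) (l 147429)) (l 147429))) (l 188878))) (l 188878)) 
(l 204006))) (l 204006))) (l 212216)) (l 217332))) (l 217332))) (l 219255)) (l 220877)) (l 220877))) (l 221567)) 
(l 221567)) (l 221567))) (l 222410)) (l 222410))) (l 222506))) (l 262361)) (l 262496))) (l 281079))) (l 284656)) 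
(l 294034))) (l 298533))) (n (n (n (n (l 417081) (n (n (n (n (l 305126) (n (n (n d (n (n (n (n (l 211246) 
(n (n (n (n (l 210034) (n (n (n (l 208381) (n (n (n (n (l 206164) (n (n (n (n (l 185396) (n (n (n (l 155293) 
(n (n (n (n (l 114928) (n (n d (l 1)) (l 1))) (l 114928)) (l 114928)) (l 114928))) (l 185396)) (l 185396))) 
(l 199853)) (l 199853)) (l 199853))) (l 206164)) (l 206164)) (l 206164))) (l 210034)) (l 210034))) (l 210828)) 
(n (n (n (l 210696) (n (n (l 210337) (n (n (n (l 209577) (n (n (n (n (l 208797) (n (n (n (n (l 198781) 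
(n (n (n (l 180931) (n (n (n (n (l 148584) (n (n (l 95899) (n (n (n (l 1) d) (l 1)) (l 95899))) 
(l 95899))) (l 148584)) (l 180931)) (l 180931))) (l 198781)) (l 198781))) (l 201857)) (l 205935)) (l 205935))) 
(l 208797)) (l 208797)) (l 208797))) (l 210337)) (l 210337))) (l 210696))) (l 210696)) (l 210828))) (l 210828))) 
(l 211246)) (n (n (n (l 211120) (n (n (n (l 210949) (n (n (l 210481) (n (n (n (l 209989) (n (n (n (n (l 207089) 
(n (n (n (n (l 197007) (n (n (n (l 197007) (n (n (l 148854) (n (n (n (l 96169) (n (n (n (l 1) 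
d) (l 1)) (l 96169))) (l 96169)) (l 148854))) (l 178867))) (l 197007)) (l 197007))) (l 197007)) (l 203441)) 
(l 203441))) (l 208637)) (l 208637)) (l 208637))) (l 210481)) (l 210481))) (l 210949))) (n (n (n (n (l 210433) 
(n (n (n (l 209847) (n (n (n (n (l 207477) (n (n (n (n (l 201573) (n (n (n (l 187783) (n (n (l 170660) 
(n (n (n (l 114779) (n (n (l 114779) (n (n d (l 1)) (l 1))) (l 114779))) (l 114779)) (l 170660))) (l 170660))) 
(l 187783)) (l 201573))) (l 201573)) (l 204751)) (l 204751))) (l 208810)) (l 208810)) (l 208810))) (l 210433)) 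
(l 210433))) (l 210792)) (l 210792)) (l 210792))) (l 211120))) (l 211120)) (l 211290))) (l 211344))) (n (n (n (n (l 210919) 
(n (n (l 209164) (n (n (n (l 205444) (n (n (n (n (l 192581) (n (n (n (n (l 158877) (n (n (l 96482) 
(n (n (n (n (l 1) d) (l 2)) (l 96482)) (l 96482))) (l 158877))) (l 158877)) (l 192581)) (l 192581))) (l 200729)) 
(l 200729)) (l 200729))) (l 209164)) (l 209164))) (l 210919))) (n (n (n (n (l 208872) (n (n (n (l 205950) 
(n (n (n (n (l 195902) (n (n (n (n (l 180695) (n (n (l 114316) (n (n (n (l 114316) (n (n d 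
(l 1)) (l 2))) (l 114316)) (l 114316))) (l 154705))) (l 180695)) (l 195902)) (l 195902))) (l 202890)) (l 202890)) 
(l 202890))) (l 208872)) (l 208872))) (l 210214)) (n (n (n (l 209992) (n (n (l 209384) (n (n (n (l 208034) 
(n (n (n (n (l 202846) (n (n (n (n (l 192560) (n (n (l 180373) (n (n (n (l 147940) (n (n (l 95897) 
(n (n (n (l 1) d) (l 2)) (l 95897))) (l 95897))) (l 147940)) (l 180373))) (l 180373))) (l 192560)) (l 202846)) 
(l 202846))) (l 207219)) (l 207219)) (l 207219))) (l 209384)) (l 209384))) (l 209992))) (l 209992)) (l 210214))) 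
(l 210214))) (l 211561)) (l 211636))) (l 212277))) (n (n (n (n (l 359045) (n (n (n (n (l 357729) (n (n (n (l 355003) 
(n (n (n (n (l 354232) (n (n (n (n (l 347003) (n (n (n (l 336524) (n (n (n (n (l 322473) (n (n (n (n (l 190826) 
(n (n d (l 190826)) (l 190826))) (l 282467)) (l 282467)) (l 282467))) (l 322473)) (l 322473)) (l 322473))) 
(l 347003)) (l 347003))) (l 352035)) (l 352035)) (l 352035))) (l 354232)) (l 354232)) (l 354232))) (n (n (n (l 355579) 
(n (n (n (n (l 343364) (n (n (n (l 324843) (n (n (n (n (l 261146) (n (n (n (n (l 164752) d) 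
(l 164752)) (l 261146)) (l 261146))) (l 305448)) (l 305448)) (l 305448))) (l 343364)) (l 343364))) (l 351875)) 
(l 351875)) (l 351875))) (l 355579)) (l 355579))) (l 356887))) (n (n (n (n (l 354901) (n (n (n (l 354901) 
(n (n (n (n (l 342043) (n (n (n (l 342043) (n (n (n (n (l 260536) (n (n (n (l 260536) (n (n d 
(l 164046)) (l 164046))) (l 260536)) (l 260536))) (l 300943)) (l 326822)) (l 326822))) (l 342043)) (l 342043))) 
(l 348418)) (l 352500)) (l 352500))) (l 354901)) (l 354901))) (l 355907)) (n (n (n (n (l 355071) (n (n (n (n (l 338561) 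
(n (n (n (l 327949) (n (n (n (n (l 265723) (n (n (n (l 192334) (n d (l 192334))) (l 192334)) (l 265723))) 
(l 265723)) (l 307006)) (l 307006))) (l 338561)) (l 338561))) (l 347071)) (l 352383)) (l 352383))) (n (n (l 354326) 
(n (n (n (l 354326) (n (n (n (n (l 348895) (n (n (n (l 345109) (n (n (n (n (l 325326) (n (n (n (l 311033) 
(n (n (l 258752) (n (n (n (l 162737) d) (l 162737)) (l 258752))) (l 258752))) (l 311033)) (l 325326))) 
(l 325326)) (l 337517)) (l 337517))) (l 348895)) (l 348895))) (l 351874)) (l 353728)) (l 353728))) (l 354326)) 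
(l 354326))) (l 354781))) (l 355071)) (l 355242))) (l 357534))) (n (n (n (l 358453) (n (n (l 358328) 
(n (n (n (l 358063) (n (n (n (n (l 357792) (n (n (n (n (l 354305) (n (n (n (l 348091) (n (n (n (n (l 336831) 
(n (n (l 318492) (n (n (n (l 285110) (n (n (l 193469) (n (n d (l 193469)) (l 193469))) (l 285110))) 
(l 285110)) (l 318492))) (l 318492))) (l 336831)) (l 348091)) (l 348091))) (l 354305)) (l 354305))) (l 355376)) 
(l 356795)) (l 356795))) (l 357792)) (l 357792)) (l 357792))) (l 358328)) (l 358328))) (l 358453))) (l 358453)) 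
(l 358498))) (l 358899))) (l 359430)) (n (n (n (n (l 344574) (n (n (n (n (l 340738) (n (n (n (l 339064) 
(n (n (n (n (l 329247) (n (n (n (l 317670) (n (n (l 287329) (n (n (n (n (l 246922) (n (n d 
(l 163967)) (l 163967))) (l 246922)) (l 246922)) (l 246922))) (l 317670))) (l 317670)) (l 329247))) (l 329247)) 
(l 335760)) (l 335760))) (l 340738)) (l 340738))) (n (n (n (n (l 341950) (n (n (l 341371) (n (n (n (l 340909) 
(n (n (n (n (l 339273) (n (n (n (l 334012) (n (n (l 334012) (n (n (n (n (l 289182) (n (n (n (l 259126) 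
(n (n (n (n (l 163967) d) (l 163967)) (l 259126)) (l 259126))) (l 289182)) (l 289182))) (l 308577)) 
(l 323662)) (l 323662))) (l 334012))) (l 334012)) (l 339273))) (l 339273)) (l 340025)) (l 340025))) (l 341371)) 
(l 341371))) (l 341726))) (l 341950)) (l 342080)) (l 342080))) (n (n (n (n (l 338964) (n (n (n (n (l 327304) 
(n (n (n (l 303356) (n (n (l 252482) (n (n (n (n (l 178992) (n d (l 178992))) (l 178992)) (l 252482)) 
(l 252482))) (l 303356))) (l 303356)) (l 327304))) (l 327304)) (l 336098)) (l 336098))) (l 341211)) (l 341211)) 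
(l 341211))) (l 344150))) (n (n (n (n (l 261307) (n (n (n (l 165004) d) (l 165004)) (l 261307))) (n (n (l 261145) 
(n (n (n (l 260973) (n (n (n (n (l 259964) (n (n (n (n (l 256454) (n (n (n (l 256454) (n (n (l 239692) 
(n (n (n (l 221353) (n (n (n (l 187876) (n (n (l 96303) (n (n d (l 96303)) (l 96303))) (l 187876))) 
(l 187876)) (l 221353))) (l 221353)) (l 239692))) (l 250140))) (l 256454)) (l 256454))) (l 256454)) (l 258694)) 
(l 258694))) (l 260503)) (l 260503)) (l 260503))) (l 261145)) (l 261145))) (l 261307))) (n (n (n (n (l 313924) 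
(n (n (n (l 313720) (n (n (n (n (l 312895) (n (n (n (n (l 310840) (n (n (n (l 306039) (n (n (l 300079) 
(n (n (n (l 280627) (n (n (l 280627) (n (n (n (n (l 149269) (n (n d (l 149269)) (l 149269))) (l 240672)) 
(l 240672)) (l 240672))) (l 280627))) (l 280627)) (l 300079))) (l 300079))) (l 306039)) (l 310840))) (l 310840)) 
(l 311946)) (l 311946))) (l 313359)) (l 313359)) (l 313359))) (l 313924)) (l 313924))) (n (n (n (n (l 312846) 
(n (n (n (l 312249) (n (n (n (n (l 309128) (n (n (n (l 306874) (n (n (l 298626) (n (n (n (l 283479) 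
(n (n (l 217400) (n (n (n (l 217400) (n (n d (l 164434)) (l 164434))) (l 217400)) (l 217400))) (l 257807))) 
(l 283479)) (l 298626))) (l 298626))) (l 306874)) (l 309128))) (l 309128)) (l 311052)) (l 311052))) (l 312846)) 
(l 312846))) (l 313316)) (n (n (n (n (l 312211) (n (n (n (n (l 308307) (n (n (n (l 300365) (n (n (l 293345) 
(n (n (n (l 263345) (n (n (l 222551) (n (n (n (l 149174) (n d (l 149174))) (l 149174)) (l 222551))) 
(l 222551))) (l 263345)) (l 293345))) (l 293345))) (l 300365)) (l 308307))) (l 308307)) (l 310796)) (l 310796))) 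
(l 312997)) (l 312997)) (l 312997))) (l 313954))) (l 314049)) (l 314219))) (l 314405))) (l 359403)) (l 359559))) 
(l 371472))) (n (n (n (n (l 360535) (n (n (n (n (l 335950) (n (n (l 334980) (n (n (n (n (l 329995) 
(n (n (n (n (l 324790) (n (n (l 312536) (n (n (n (n (l 244217) (n (n (n (n (l 171408) (n d 
(l 171408))) (l 171408)) (l 244217)) (l 244217))) (l 294874)) (l 294874)) (l 294874))) (l 324790))) (l 324790)) 
(l 329995)) (l 329995))) (n (n (l 332889) (n (n (n (l 331642) (n (n (n (n (l 329828) (n (n (l 324785) 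
(n (n (n (n (l 303837) (n (n (n (n (l 271520) (n (n (l 218755) (n (n (n (l 162208) d) (l 162208)) 
(l 218755))) (l 218755))) (l 271520)) (l 303837)) (l 303837))) (l 321709)) (l 321709)) (l 321709))) (l 329828))) 
(l 329828)) (l 331642)) (l 331642))) (l 332889)) (l 332889))) (l 333328))) (l 333617)) (l 333717))) (l 335856))) 
(n (n (n (n (l 279219) (n (n (l 279219) (n (n d (l 164274)) (l 164274))) (l 279219))) (l 279219)) 
(n (n (n (n (l 335536) (n (n (l 334802) (n (n (n (l 333562) (n (n (n (n (l 330606) (n (n (l 327680) 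
(n (n (n (n (l 316208) (n (n (n (l 282983) (n (n (l 220692) (n (n (n (n (l 164145) d) (l 164145)) 
(l 220692)) (l 220692))) (l 282983))) (l 282983)) (l 316208))) (l 316208)) (l 327680)) (l 327680))) (l 330606))) 
(l 330606)) (l 333562)) (l 333562))) (l 334802)) (l 334802))) (l 335244))) (n (n (l 335231) (n (n (n (n (l 333530) 
(n (n (n (n (l 330813) (n (n (l 327872) (n (n (n (n (l 314855) (n (n (n (l 285082) (n (n (l 244200) 
(n (n (n (l 171391) (n d (l 171391))) (l 171391)) (l 244200))) (l 244200))) (l 285082)) (l 314855))) 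
(l 314855)) (l 321875)) (l 321875))) (l 330813))) (l 330813)) (l 333530)) (l 333530))) (l 334790)) (l 334790)) 
(l 334790))) (l 335536))) (l 335637)) (l 335766))) (l 335877))) (n (n (n (n (l 358048) (n (n (n (n (l 357841) 
(n (n (l 357288) (n (n (n (l 356461) (n (n (n (n (l 354246) (n (n (l 349584) (n (n (n (n (l 342817) 
(n (n (l 324837) (n (n (n (n (l 243070) (n (n (n (n (l 163242) d) (l 163242)) (l 243070)) (l 243070))) 
(l 305297)) (l 305297)) (l 305297))) (l 342817))) (l 342817)) (l 349584)) (l 349584))) (l 354246))) (l 354246)) 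
(l 356461)) (l 356461))) (l 357288)) (l 357288))) (l 357618))) (n (n (l 357575) (n (n (n (n (l 356407) 
(n (n (n (n (l 354179) (n (n (l 349542) (n (n (n (n (l 338503) (n (n (l 328250) (n (n (n (n (l 266114) 
(n (n (n (l 194599) (n d (l 194599))) (l 194599)) (l 266114))) (l 266114)) (l 307367)) (l 307367))) 
(l 338503))) (l 338503)) (l 349542)) (l 349542))) (l 354179))) (l 354179)) (l 356407)) (l 356407))) (l 357245)) 
(l 357245)) (l 357245))) (l 357841))) (l 357950)) (l 358048))) (n (n (n (n (l 353470) (n (n (n (n (l 341738) 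
(n (n (l 320018) (n (n (n (n (l 286433) (n (n (l 194608) (n (n d (l 194608)) (l 194608))) (l 286433))) 
(l 286433)) (l 320018)) (l 320018))) (l 341738))) (l 341738)) (l 353470)) (l 353470))) (n (n (l 355361) 
(n (n (n (l 354373) (n (n (n (n (l 350292) (n (n (l 342421) (n (n (n (n (l 342421) (n (n (l 294265) 
(n (n (n (l 241527) (n (n (n (l 161698) d) (l 161698)) (l 241527))) (l 241527)) (l 294265))) (l 324297))) 
(l 342421)) (l 342421)) (l 342421))) (l 350292))) (l 350292)) (l 354373)) (l 354373))) (l 355361)) (l 355361))) 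
(l 355932))) (l 356307)) (l 356491))) (l 359484)) (l 359606))) (l 360493))) (n (n (n (n (l 366536) (n (n (n (l 362128) 
(n (n (n (n (l 358630) (n (n (n (n (l 353337) (n (n (l 330230) (n (n (n (l 330230) (n (n (n (n (l 198988) 
(n (n d (l 198988)) (l 198988))) (l 290437)) (l 290437)) (l 290437))) (l 330230)) (l 330230))) (l 344290))) 
(l 353337)) (l 358630)) (l 358630))) (l 361063)) (n (n (n (n (l 360405) (n (n (n (l 359963) (n (n (n (n (l 358566) 
(n (n (l 352342) (n (n (n (l 347381) (n (n (n (n (l 329805) (n (n (n (l 273278) (n (n (l 273278) 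
(n (n d (l 162074)) (l 162074))) (l 273278))) (l 273278)) (l 329805))) (l 329805)) (l 337882)) (l 337882))) 
(l 352342)) (l 352342))) (l 356159))) (l 358566)) (l 359963)) (l 359963))) (l 360405)) (l 360405))) (l 360689)) 
(l 360911)) (l 360911))) (l 361063))) (n (n (n (n (l 357241) (n (n (l 356977) (n (n (n (n (l 355777) 
(n (n (n (n (l 354605) (n (n (l 348659) (n (n (n (l 339780) (n (n (n (n (l 315981) (n (n (l 265892) 
(n (n (n (n (l 193184) (n d (l 193184))) (l 193184)) (l 265892)) (l 265892))) (l 315981))) (l 315981)) 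
(l 339780)) (l 339780))) (l 348659)) (l 348659))) (l 352208))) (l 354605)) (l 355777)) (l 355777))) (l 356690)) 
(l 356690)) (l 356690))) (l 357241))) (n (n (n (n (l 349071) (n (n (l 314203) (n (n (n (l 251842) 
(n (n (n (n (l 164057) d) (l 164057)) (l 251842)) (l 251842))) (l 314203)) (l 314203))) (l 333801))) 
(l 349071)) (l 357241)) (l 357241))) (l 363145)) (l 363145))) (l 365115))) (n (n (l 365097) (n (n (n (n (l 356962) 
(n (n (n (n (l 356962) (n (n (l 316492) (n (n (n (l 275064) (n (n (n (l 201889) (n d (l 201889))) 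
(l 201889)) (l 275064))) (l 275064)) (l 316492))) (l 337428))) (l 356962)) (l 356962)) (l 356962))) (n (n (l 361882) 
(n (n (n (l 359775) (n (n (n (n (l 359775) (n (n (l 345652) (n (n (n (l 333460) (n (n (n (l 301065) 
(n (n (l 248977) (n (n (n (l 161115) d) (l 161115)) (l 248977))) (l 248977))) (l 301065)) (l 333460))) 
(l 333460)) (l 345652))) (l 353268))) (l 359775)) (l 359775)) (l 359775))) (l 361882)) (l 361882))) (l 362518))) 
(l 363004)) (l 363269))) (l 366846))) (n (n (n (n (l 367407) (n (n (n (l 367204) (n (n (l 366823) 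
(n (n (n (l 365131) (n (n (n (n (l 361521) (n (n (l 356468) (n (n (n (l 349508) (n (n (l 335204) 
(n (n (n (n (l 252389) (n (n (n (l 164558) d) (l 164558)) (l 252389))) (l 252389)) (l 305238)) (l 305238))) 
(l 349508))) (l 349508)) (l 356468))) (l 356468))) (l 361521)) (l 365131)) (l 365131))) (l 366823)) (l 366823))) 
(l 366823))) (l 367204)) (l 367407))) (n (n (n (n (l 367023) (n (n (n (n (l 366112) (n (n (n (l 365132) 
(n (n (n (n (l 363356) (n (n (l 360463) (n (n (n (l 355197) (n (n (l 340740) (n (n (n (l 310220) 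
(n (n (n (n (l 278874) (n (n d (l 163856)) (l 163856))) (l 278874)) (l 278874)) (l 278874))) (l 340740)) 
(l 340740))) (l 355197))) (l 355197)) (l 360463))) (l 360463))) (l 363356)) (l 365132)) (l 365132))) (l 366112)) 
(l 366112))) (l 366281)) (n (n (n (n (l 365008) (n (n (n (n (l 362697) (n (n (l 358925) (n (n (n (l 354882) 
(n (n (l 325624) (n (n (n (l 275535) (n (n (n (n (l 202648) (n d (l 202648))) (l 202648)) (l 275535)) 
(l 275535))) (l 325624)) (l 325624))) (l 343286))) (l 354882)) (l 358925))) (l 358925))) (l 362697)) (l 365008)) 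
(l 365008))) (l 366285)) (l 366285)) (l 366285))) (l 366866))) (l 367023)) (n (n (n (l 366683) (n (n (n (n (l 364877) 
(n (n (n (n (l 361296) (n (n (l 357054) (n (n (n (l 345764) (n (n (l 327648) (n (n (n (l 294267) 
(n (n (l 202806) (n (n d (l 202806)) (l 202806))) (l 294267))) (l 294267)) (l 327648))) (l 327648))) 
(l 345764)) (l 357054))) (l 357054))) (l 361296)) (l 364877)) (l 364877))) (l 366399)) (l 366399)) (l 366399))) 
(l 367153)) (l 367153))) (l 367364))) (l 367661)) (l 367738))) (l 368623))) (l 375064)) (l 375516))) (l 384377))) 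
(n (n (n (n (l 214182) (n (n (n (n (l 213688) (n (n (n (l 212697) (n (n (n (n (l 212377) (n (n (n (n (l 209860) 
(n (n (n (l 206213) (n (n (n (n (l 201322) (n (n (n (n (l 155496) (n (n (n (l 89070) (n (n (n d 
(l 1)) (l 2)) (l 2))) (l 155496)) (l 155496))) (l 187396)) (l 187396)) (l 187396))) (l 201322)) (l 201322)) 
(l 201322))) (l 209860)) (l 209860))) (l 211612)) (l 211612)) (l 211612))) (l 212377)) (n (n (n (l 212208) 
(n (n (l 212208) (n (n (n (n (l 211070) (n (n (n (l 209777) (n (n (n (n (l 204548) (n (n (n (n (l 191520) 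
(n (n (n (l 161090) (n (n (l 123307) (n (n (n (l 2) (n d (l 1))) (l 2)) (l 123307))) (l 123307))) 
(l 161090)) (l 191520))) (l 191520)) (l 198531)) (l 198531))) (l 207488)) (l 207488)) (l 207488))) (l 211070)) 
(l 211070))) (l 211862)) (l 211862)) (l 211862))) (l 212208))) (l 212208)) (l 212377))) (l 212377))) (n (n (n (l 212897) 
(n (n (n (n (l 208645) (n (n (n (l 202198) (n (n (n (n (l 180026) (n (n (n (n (l 146471) (n (n (l 2) 
(n (n d (l 1)) (l 2))) (l 89121))) (l 146471)) (l 180026)) (l 180026))) (l 195447)) (l 195447)) (l 195447))) 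
(l 208645)) (l 208645))) (l 211608)) (l 211608)) (l 211608))) (l 212897)) (l 212897))) (l 213394))) (n (n (n (n (l 212703) 
(n (n (n (l 212703) (n (n (n (n (l 208227) (n (n (n (l 208227) (n (n (n (n (l 179855) (n (n (n (l 179855) 
(n (n (n (n (l 2) (n (n d (l 1)) (l 2))) (l 89163)) (l 146267)) (l 146267))) (l 179855)) (l 179855))) 
(l 193920)) (l 202929)) (l 202929))) (l 208227)) (l 208227))) (l 210446)) (l 211867)) (l 211867))) (l 212703)) 
(l 212703))) (l 213053)) (n (n (n (n (l 212762) (n (n (n (n (l 207015) (n (n (n (l 203321) (n (n (n (n (l 181660) 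
(n (n (n (l 156114) (n (n (l 89163) (n (n (n d (l 1)) (l 2)) (l 2))) (l 156114))) (l 156114)) (l 181660))) 
(l 181660)) (l 196031)) (l 196031))) (l 207015)) (l 207015))) (l 209977)) (l 211827)) (l 211827))) (n (n (l 212503) 
(n (n (n (l 212503) (n (n (n (n (l 210612) (n (n (n (l 209295) (n (n (n (n (l 202408) (n (n (n (l 197433) 
(n (n (l 179234) (n (n (n (l 145811) (n (n (l 2) (n (n d (l 1)) (l 2))) (l 89163))) (l 145811)) (l 179234))) 
(l 179234))) (l 197433)) (l 202408))) (l 202408)) (l 206652)) (l 206652))) (l 210612)) (l 210612))) (l 211649)) 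
(l 212295)) (l 212295))) (l 212503)) (l 212503))) (l 212661))) (l 212762)) (l 212822))) (l 213620))) (n (n (n (n (l 176150) 
(n (n (n (l 124776) (n (n (n (n (l 2) (n d (l 1))) (l 2)) (l 124776)) (l 124776))) (l 176150)) (l 176150))) 
(n (n (n (n (l 193876) (n (n (n (l 193705) (n (n (l 193705) (n (n (n (n (l 192253) (n (n (n (l 191279) 
(n (n (n (n (l 188196) (n (n (l 174462) (n (n (n (l 163515) (n (n (n (n (l 124733) (n (n (n (l 2) 
(n d (l 1))) (l 2)) (l 124733))) (l 124733)) (l 142554)) (l 142554))) (l 174462)) (l 174462))) (l 182884))) 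
(l 188196)) (l 191279)) (l 191279))) (l 192253)) (l 192253))) (l 192881)) (l 193370)) (l 193370))) (l 193705))) 
(l 193705)) (l 193876))) (l 193876)) (n (n (n (l 193808) (n (n (n (n (l 193714) (n (n (n (n (l 192500) 
(n (n (n (l 190337) (n (n (n (n (l 186417) (n (n (l 180034) (n (n (n (l 168413) (n (n (l 136513) 
(n (n (n (l 69167) (n (n (n d (l 1)) (l 2)) (l 2))) (l 136513)) (l 136513))) (l 168413))) (l 168413)) 
(l 180034))) (l 180034))) (l 186417)) (l 190337)) (l 190337))) (l 192500)) (l 192500))) (l 192873)) (l 193367)) 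
(l 193367))) (l 193714)) (l 193714)) (l 193714))) (l 193900)) (l 193900))) (l 193944))) (l 205731)) (l 205747))) 
(l 214116))) (n d (l 214320))) (n (n (n (n (l 330481) (n (n (n (n (l 327894) (n (n (n (l 323476) 
(n (n (n (n (l 320059) (n (n (n (l 316029) (n (n (l 305467) (n (n (n (n (l 291402) (n (n (n (n (l 114012) 
(n (n d (l 114012)) (l 114012))) (l 205449)) (l 262525)) (l 262525))) (l 291402)) (l 291402)) (l 291402))) 
(l 316029))) (l 316029)) (l 320059))) (l 320059)) (l 322326)) (l 322326))) (n (n (n (n (l 320041) (n (n (l 319890) 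
(n (n (n (n (l 318978) (n (n (n (l 317928) (n (n (l 315071) (n (n (n (n (l 302519) (n (n (n (n (l 278584) 
(n (n (l 228766) (n (n (n (n (l 110156) (n d (l 110156))) (l 110156)) (l 228766)) (l 228766))) (l 278584))) 
(l 278584)) (l 302519)) (l 302519))) (l 311522)) (l 311522)) (l 311522))) (l 317928))) (l 317928)) (l 318978))) 
(l 318978)) (l 319584)) (l 319584))) (l 320041))) (n (n (n (l 313230) (n (n (l 294440) (n (n (n (n (l 209885) 
(n (n (n (n (l 209885) d) (l 209885)) (l 209885)) (l 209885))) (l 274798)) (l 274798)) (l 274798))) 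
(l 313230))) (l 313230)) (l 320041))) (l 320203)) (l 324059))) (l 326075))) (n (n (n (n (l 327137) (n (n (l 326936) 
(n (n (n (l 326775) (n (n (n (n (l 326206) (n (n (n (l 324374) (n (n (l 324374) (n (n (n (n (l 308769) 
(n (n (n (l 298306) (n (n (n (n (l 265182) (n (n (l 117619) (n (n d (l 117619)) (l 117619))) (l 208105))) 
(l 265182)) (l 298306)) (l 298306))) (l 308769)) (l 308769))) (l 315520)) (l 320771)) (l 320771))) (l 324374))) 
(l 324374)) (l 326206))) (l 326206)) (l 326467)) (l 326467))) (l 326936)) (l 326936))) (l 327059))) (l 327137)) 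
(n (n (n (n (l 321354) (n (n (n (l 310271) (n (n (l 299324) (n (n (n (n (l 236696) (n (n (n (l 117619) 
(n d (l 117619))) (l 117619)) (l 236696))) (l 236696)) (l 278384)) (l 278384))) (l 310271))) (l 310271)) 
(l 321354))) (n (n (l 320061) (n (n (n (l 318711) (n (n (n (l 315177) (n (n (l 311349) (n (n (n (n (l 291513) 
(n (n (n (l 256600) (n (n (l 203734) (n (n (n (l 203734) d) (l 203734)) (l 203734))) (l 203734))) 
(l 256600)) (l 291513))) (l 291513)) (l 303723)) (l 303723))) (l 315177))) (l 315177)) (l 318711))) (l 318711)) 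
(l 320061))) (l 320739))) (l 325234)) (l 325234))) (l 328202))) (n (n (n (n (l 327028) (n (n (n (n (l 322969) 
(n (n (n (l 314633) (n (n (l 296924) (n (n (n (n (l 271342) (n (n (l 209036) (n (n (n d (l 117587)) 
(l 117587)) (l 117587))) (l 271342))) (l 271342)) (l 296924)) (l 296924))) (l 314633))) (l 314633)) (l 322969))) 
(n (n (l 322147) (n (n (n (l 321081) (n (n (n (l 318177) (n (n (l 312038) (n (n (n (n (l 301031) 
(n (n (l 288248) (n (n (n (n (l 205382) (n (n (n (l 205382) d) (l 205382)) (l 205382))) (l 205382)) 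
(l 258248)) (l 258248))) (l 301031))) (l 301031)) (l 312038)) (l 312038))) (l 318177))) (l 318177)) (l 321081))) 
(l 321081)) (l 322147))) (l 322494))) (l 326031)) (l 326031))) (n (n (n (n (l 327599) (n (n (l 327390) 
(n (n (n (n (l 326570) (n (n (n (l 324195) (n (n (l 319741) (n (n (n (n (l 315699) (n (n (l 286179) 
(n (n (n (l 236361) (n (n (n (n (l 117587) (n d (l 117587))) (l 117587)) (l 236361)) (l 236361))) 
(l 286179)) (l 286179))) (l 303964))) (l 315699)) (l 319741)) (l 319741))) (l 324195))) (l 324195)) (l 326570))) 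
(l 326570)) (l 327390)) (l 327390))) (l 327599))) (l 327599)) (l 327811)) (l 327811))) (l 328022)) (l 328022))) 
(l 330312))) (n (n (n (n (l 301579) (n (n (n (n (l 267661) (n (n (n (l 267661) (n (n (l 266954) 
(n (n (n (l 266180) (n (n (n (l 264768) (n (n (l 260906) (n (n (n (l 256844) (n (n (n (n (l 232908) 
(n (n (n (n (l 149708) (n (n (n (l 149708) d) (l 149708)) (l 149708))) (l 149708)) (l 202803)) (l 202803))) 
(l 245691)) (l 245691)) (l 245691))) (l 260906)) (l 260906))) (l 264768))) (l 264768)) (l 266180))) (l 266180)) 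
(l 266954))) (l 267394))) (l 267661)) (l 267661))) (n (n (l 117952) (n (n d (l 117952)) (l 117952))) 
(l 210223))) (n (n (n (n (l 267622) (n (n (l 266702) (n (n (n (l 265694) (n (n (n (l 264168) 
(n (n (l 256361) (n (n (n (l 248209) (n (n (n (n (l 214527) (n (n (l 149575) (n (n (n (n (l 149575) 
d) (l 149575)) (l 149575)) (l 149575))) (l 214527))) (l 214527)) (l 248209)) (l 248209))) (l 256361)) (l 256361))) 
(l 261077))) (l 264168)) (l 265694))) (l 265694)) (l 266702))) (l 267276))) (n (n (l 267349) (n (n (n (n (l 265766) 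
(n (n (n (l 264087) (n (n (l 260941) (n (n (n (l 246981) (n (n (n (n (l 217192) (n (n (l 175484) 
(n (n (n (l 118047) (n d (l 118047))) (l 118047)) (l 175484))) (l 175484))) (l 217192)) (l 246981)) 
(l 246981))) (l 260941)) (l 260941))) (l 260941))) (l 264087)) (l 265766))) (l 265766)) (l 266776)) (l 266776))) 
(l 267622))) (l 267622)) (l 267755))) (l 301429))) (n (n (l 295097) (n (n (n (n (l 288375) (n (n (l 288130) 
(n (n (n (n (l 286546) (n (n (n (l 286546) (n (n (l 279755) (n (n (n (l 270961) (n (n (n (l 246995) 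
(n (n (l 196335) (n (n (n (n (l 105491) (n d (l 105491))) (l 105491)) (l 196335)) (l 196335))) (l 246995))) 
(l 246995)) (l 270961))) (l 270961)) (l 279755))) (l 282621))) (l 286546)) (l 286546))) (l 286546)) (l 287557)) 
(l 287557))) (l 288375))) (n (n (n (n (l 288023) (n (n (n (n (l 286802) (n (n (n (l 286802) (n (n (l 280967) 
(n (n (n (l 274583) (n (n (n (l 262930) (n (n (l 231054) (n (n (n (l 197531) (n (n (n d (l 105491)) 
(l 105491)) (l 105491))) (l 231054)) (l 231054))) (l 262930))) (l 262930)) (l 274583))) (l 274583)) (l 280967))) 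
(l 284604))) (l 286802)) (l 286802))) (l 286802)) (l 287581)) (l 287581))) (n (n (l 235965) (n (n (n (l 182720) 
(n (n (n (l 182720) d) (l 182720)) (l 182720))) (l 182720)) (l 235965))) (l 266071))) (l 288211)) (l 288211))) 
(l 288645)) (l 295097))) (l 298919))) (n (n (n (n (l 319621) (n (n (n (n (l 319355) (n (n (l 319145) 
(n (n (n (n (l 318215) (n (n (n (l 316086) (n (n (l 313163) (n (n (n (l 307958) (n (n (l 295705) 
(n (n (n (n (l 227360) (n (n (n (n (l 118155) (n d (l 118155))) (l 118155)) (l 227360)) (l 227360))) 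
(l 277964)) (l 277964)) (l 277964))) (l 307958))) (l 307958)) (l 313163))) (l 313163))) (l 316086)) (l 318215))) 
(l 318215)) (l 318716)) (l 318716))) (l 319355))) (n (n (n (n (l 319068) (n (n (n (n (l 318353) (n (n (n (l 316682) 
(n (n (l 314607) (n (n (n (l 307836) (n (n (l 307836) (n (n (n (n (l 262110) (n (n (n (l 210150) 
(n (n (n d (l 118155)) (l 118155)) (l 118155))) (l 262110)) (l 262110))) (l 293928)) (l 293928)) (l 293928))) 
(l 307836))) (l 307836)) (l 314607))) (l 314607))) (l 316682)) (l 318353))) (l 318353)) (l 318738)) (l 318738))) 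
(l 319230)) (l 319230)) (l 319230))) (l 319621)) (l 319621))) (n (n (n (n (l 319007) (n (n (n (l 317484) 
(n (n (n (n (l 316398) (n (n (n (l 315613) (n (n (l 312742) (n (n (n (l 307470) (n (n (l 284468) 
(n (n (n (l 284468) (n (n (n (n (l 116841) (n (n d (l 116841)) (l 116841))) (l 208791)) (l 266030)) 
(l 266030))) (l 284468)) (l 284468))) (l 298533))) (l 307470)) (l 312742))) (l 312742))) (l 315613)) (l 316398))) 
(l 316398)) (l 317068)) (l 317068))) (n (n (n (l 316558) (n (n (n (l 313543) (n (n (l 308694) (n (n (n (l 300517) 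
(n (n (l 265879) (n (n (n (l 200851) (n (n (n (n (l 200851) d) (l 200851)) (l 200851)) (l 200851))) 
(l 265879)) (l 265879))) (l 285521))) (l 300517)) (l 308694))) (l 308694))) (l 313543)) (l 316558))) (l 316558)) 
(l 317692))) (l 318401))) (n (n (l 318814) (n (n (n (n (l 316968) (n (n (n (l 313718) (n (n (l 308798) 
(n (n (n (l 308798) (n (n (l 268896) (n (n (n (l 227220) (n (n (n (l 118155) (n d (l 118155))) 
(l 118155)) (l 227220))) (l 227220)) (l 268896))) (l 289836))) (l 308798)) (l 308798))) (l 308798))) (l 313718)) 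
(l 316968))) (l 316968)) (l 318104)) (l 318104))) (l 319170))) (n (n (n (n (l 318786) (n (n (n (n (l 317427) 
(n (n (n (l 314662) (n (n (l 312219) (n (n (n (l 301776) (n (n (l 287575) (n (n (n (l 262033) 
(n (n (l 210106) (n (n (n d (l 118155)) (l 118155)) (l 118155))) (l 262033))) (l 262033)) (l 287575))) 
(l 287575))) (l 301776)) (l 312219))) (l 312219))) (l 314662)) (l 317427))) (l 317427)) (l 318293)) (l 318293))) 
(l 319059)) (l 319059)) (l 319059))) (l 319721))) (l 319950)) (l 320135))) (l 320431))) (l 336706)) (l 337597))) 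
(l 440011))) (n (n (n (n (l 476738) (n (n (n (n (l 454579) (n (n (n (l 451309) (n (n (n (n (l 448033) 
(n (n (n (l 446207) (n (n (l 441421) (n (n (n (n (l 435046) (n (n (n (n (l 354656) (n (n (n (l 302987) 
(n (n d (l 201014)) (l 201014))) (l 354656)) (l 354656))) (l 396094)) (l 421960)) (l 421960))) (l 435046)) 
(l 435046)) (l 435046))) (l 446207))) (l 446207)) (l 448033))) (l 448033)) (n (n (n (n (l 446341) (n (n (l 440542) 
(n (n (n (n (l 421087) (n (n (n (n (l 364313) (n (n (n (l 247708) (n d (l 247708))) (l 247708)) 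
(l 364313))) (l 364313)) (l 407135)) (l 407135))) (l 432031)) (l 432031)) (l 432031))) (l 446341))) (n (n (l 445881) 
(n (n (n (l 445054) (n (n (l 443372) (n (n (n (n (l 436564) (n (n (n (n (l 417555) (n (n (n (l 378884) 
(n (n (l 344707) (n (n (n (l 198633) d) (l 198633)) (l 344707))) (l 344707))) (l 378884)) (l 417555))) 
(l 417555)) (l 429677)) (l 429677))) (l 440392)) (l 440392)) (l 440392))) (l 445054))) (l 445054)) (l 445881))) 
(l 445881))) (l 448722)) (l 449061))) (l 450709))) (n (n (n (n (l 447846) (n (n (n (n (l 445708) (n (n (l 441442) 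
(n (n (n (n (l 417660) (n (n (n (n (l 392316) (n (n (l 332649) (n (n (n d (l 246651)) (l 246651)) 
(l 246651))) (l 392316))) (l 392316)) (l 417660)) (l 417660))) (l 435294)) (l 435294)) (l 435294))) (l 445708))) 
(n (n (l 445353) (n (n (n (l 444723) (n (n (l 443238) (n (n (n (n (l 434956) (n (n (n (n (l 421724) 
(n (n (l 407407) (n (n (n (n (l 344026) (n (n (n (l 199056) d) (l 199056)) (l 344026))) (l 344026)) 
(l 378203)) (l 378203))) (l 421724))) (l 421724)) (l 434956)) (l 434956))) (l 441088)) (l 441088)) (l 441088))) 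
(l 444723))) (l 444723)) (l 445353))) (l 445353))) (n (n (n (n (l 447106) (n (n (n (l 446630) (n (n (l 445335) 
(n (n (n (n (l 439647) (n (n (n (n (l 428800) (n (n (l 406223) (n (n (n (n (l 352471) (n (n (l 302550) 
(n (n d (l 200868)) (l 200868))) (l 352471))) (l 352471)) (l 406223)) (l 406223))) (l 428800))) (l 428800)) 
(l 439647)) (l 439647))) (l 443727)) (l 443727)) (l 443727))) (l 446630))) (l 446630)) (l 447106))) (l 447106)) 
(l 447380)) (l 447380))) (l 447846))) (n (n (n (n (l 445608) (n (n (l 445275) (n (n (n (n (l 444791) 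
(n (n (l 443505) (n (n (n (n (l 437660) (n (n (n (n (l 431953) (n (n (l 403004) (n (n (n (l 359768) 
(n (n (n (n (l 243890) (n d (l 243890))) (l 243890)) (l 359768)) (l 359768))) (l 403004)) (l 403004))) 
(l 420282))) (l 431953)) (l 437660)) (l 437660))) (l 442108)) (l 442108)) (l 442108))) (l 444791))) (l 444791)) 
(l 445275)) (l 445275))) (l 445608))) (n (n (l 437092) (n (n (n (n (l 398773) (n (n (n (n (l 398773) 
(n (n (l 201717) (n d (l 201717))) (l 303656))) (l 398773)) (l 398773)) (l 398773))) (l 428191)) (l 428191)) 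
(l 428191))) (l 445608))) (n (n (n (l 445332) (n (n (n (n (l 444701) (n (n (l 442945) (n (n (n (n (l 435653) 
(n (n (n (n (l 424404) (n (n (l 406037) (n (n (n (l 386353) (n (n (l 243890) (n (n d (l 243890)) 
(l 243890))) (l 329889))) (l 386353)) (l 406037))) (l 406037))) (l 424404)) (l 435653)) (l 435653))) (l 441875)) 
(l 441875)) (l 441875))) (l 444701))) (l 444701)) (l 445332)) (l 445332))) (l 445766)) (l 445766))) (l 449006))) 
(l 449300)) (l 451082))) (l 453707))) (n (n (n (n (l 434323) (n (n (n (n (l 434145) (n (n (n (l 433943) 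
(n (n (l 433691) (n (n (n (l 432871) (n (n (l 432871) (n (n (n (n (l 427330) (n (n (n (l 421034) 
(n (n (n (n (l 395570) (n (n (n (n (l 332135) (n (n (n (l 183972) d) (l 183972)) (l 332135))) (l 332135)) 
(l 366276)) (l 366276))) (l 409887)) (l 409887)) (l 409887))) (l 427330)) (l 427330))) (l 431185)) (l 431185)) 
(l 431185))) (l 432871))) (l 432871)) (l 433691))) (l 433691))) (l 433943)) (l 434145))) (l 434145)) (n (n (n (n (l 250146) 
(n (n d (l 250146)) (l 250146))) (n (n (n (n (l 336665) (n (n (n (l 335835) (n (n (l 335835) (n (n (n (n (l 328763) 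
(n (n (n (l 324022) (n (n (n (n (l 309010) (n (n (l 242137) (n (n (n (l 188834) (n (n d (l 86777)) 
(l 86777))) (l 242137)) (l 242137))) (l 283144))) (l 309010)) (l 324022)) (l 324022))) (l 328763)) (l 328763))) 
(l 331823)) (l 334202)) (l 334202))) (l 335835))) (l 335835)) (l 336665))) (l 336665)) (l 336784)) (l 336784))) 
(l 394180)) (l 394180))) (l 434248))) (l 434343)) (n (n (n (n (l 450985) (n (n (n (n (l 445548) (n (n (l 445216) 
(n (n (n (n (l 444427) (n (n (l 443694) (n (n (n (n (l 439252) (n (n (n (l 434139) (n (n (l 420227) 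
(n (n (n (n (l 359112) (n (n (n (n (l 242569) (n d (l 242569))) (l 242569)) (l 359112)) (l 359112))) 
(l 402949)) (l 402949)) (l 402949))) (l 434139))) (l 434139)) (l 439252))) (l 439252)) (l 442201)) (l 442201))) 
(l 444427))) (l 444427)) (l 445216)) (l 445216))) (l 445548))) (n (n (l 440587) (n (n (n (n (l 412205) 
(n (n (n (l 358241) (n (n (l 304937) (n (n d (l 202978)) (l 202978))) (l 358241))) (l 358241)) (l 412205))) 
(l 412205)) (l 431097)) (l 431097))) (l 445548))) (n (n (n (l 445275) (n (n (n (n (l 444246) (n (n (l 443228) 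
(n (n (n (n (l 439234) (n (n (n (l 427669) (n (n (l 405986) (n (n (n (n (l 386302) (n (n (l 242569) 
(n (n d (l 242569)) (l 242569))) (l 329163))) (l 386302)) (l 405986)) (l 405986))) (l 427669))) (l 427669)) 
(l 439234))) (l 439234)) (l 443228)) (l 443228))) (l 444246))) (l 444246)) (l 445275)) (l 445275))) (l 445707)) 
(l 445707))) (l 450884))) (n (n (n (n (l 449747) (n (n (l 449277) (n (n (n (l 448629) (n (n (l 447297) 
(n (n (n (n (l 439590) (n (n (n (l 431415) (n (n (l 416099) (n (n (n (l 348124) (n (n (n (n (l 203077) 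
d) (l 203077)) (l 348124)) (l 348124))) (l 416099)) (l 416099))) (l 416099))) (l 431415)) (l 439590))) (l 439590)) 
(l 444508)) (l 444508))) (l 448629))) (l 448629)) (l 449277))) (l 449277))) (n (n (l 449176) (n (n (n (n (l 448151) 
(n (n (l 446961) (n (n (n (n (l 439249) (n (n (n (l 439249) (n (n (l 406181) (n (n (n (l 363363) 
(n (n (n (l 246670) (n d (l 246670))) (l 246670)) (l 363363))) (l 363363)) (l 406181))) (l 420133))) 
(l 439249)) (l 439249))) (l 439249)) (l 444169)) (l 444169))) (l 448151))) (l 448151)) (l 449176)) (l 449176))) 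
(l 449747))) (n (n (n (n (l 448879) (n (n (n (n (l 447933) (n (n (l 446909) (n (n (n (n (l 442378) 
(n (n (n (l 432014) (n (n (l 417783) (n (n (n (l 392439) (n (n (l 332778) (n (n (n d (l 246394)) 
(l 246394)) (l 246394))) (l 392439))) (l 392439)) (l 417783))) (l 417783))) (l 432014)) (l 442378))) (l 442378)) 
(l 444822)) (l 444822))) (l 447933))) (l 447933)) (l 448879)) (l 448879))) (n (n (n (l 447716) (n (n (l 445981) 
(n (n (n (n (l 436992) (n (n (n (l 421170) (n (n (l 397212) (n (n (n (l 397212) (n (n (l 202923) 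
(n d (l 202923))) (l 304882))) (l 397212)) (l 397212))) (l 397212))) (l 421170)) (l 436992))) (l 436992)) 
(l 442525)) (l 442525))) (l 447716))) (l 447716)) (l 449317))) (l 449317)) (l 449929))) (l 450767))) (l 452996)) 
(l 453140))) (l 454599))) (n (n (n (n (l 426768) (n (n (n (n (l 422992) (n (n (n (l 419021) (n (n (l 410996) 
(n (n (n (n (l 399403) (n (n (l 371166) (n (n (n (n (l 276434) (n (n d (l 208500)) (l 208500))) 
(l 329723)) (l 329723)) (l 329723))) (l 399403))) (l 399403)) (l 410996)) (l 410996))) (l 419021))) (n (n (n (l 418734) 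
(n (n (n (n (l 417963) (n (n (l 416340) (n (n (n (n (l 413984) (n (n (l 407725) (n (n (n (n (l 379263) 
(n (n (n (n (l 351474) (n (n (l 210520) (n (n d (l 210520)) (l 210520))) (l 294650))) (l 351474)) 
(l 379263)) (l 379263))) (l 400924)) (l 400924)) (l 400924))) (l 413984))) (l 413984)) (l 416340)) (l 416340))) 
(l 417963))) (l 417963)) (l 418734)) (l 418734))) (l 419021)) (l 419021))) (l 422914))) (n (n (l 422526) 
(n (n (n (n (l 421637) (n (n (n (n (l 420861) (n (n (l 419247) (n (n (n (n (l 415404) (n (n (l 411836) 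
(n (n (n (n (l 390206) (n (n (n (l 365312) (n (n (l 297572) (n (n (n d (l 213442)) (l 213442)) 
(l 213442))) (l 365312))) (l 365312)) (l 390206))) (l 390206)) (l 404566)) (l 404566))) (l 415404))) (l 415404)) 
(l 419247)) (l 419247))) (l 420861))) (l 420861)) (l 421637)) (l 421637))) (n (n (n (l 420612) (n (n (l 417831) 
(n (n (n (n (l 412842) (n (n (l 407049) (n (n (n (n (l 369496) (n (n (n (l 369496) (n (n (l 208486) 
(n d (l 208486))) (l 276419))) (l 369496)) (l 369496))) (l 369496)) (l 393454)) (l 393454))) (l 412842))) 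
(l 412842)) (l 417831)) (l 417831))) (l 420612))) (l 420612)) (l 421928))) (l 421928)) (l 422411))) (l 422776))) 
(n (n (n (n (l 418716) (n (n (l 409637) (n (n (n (n (l 384047) (n (n (l 339842) (n (n (n (n (l 215240) 
(n d (l 215240))) (l 215240)) (l 339842)) (l 339842))) (l 384047))) (l 384047)) (l 409637)) (l 409637))) 
(l 418716))) (n (n (l 418102) (n (n (n (l 416281) (n (n (l 416281) (n (n (n (n (l 407156) (n (n (l 389957) 
(n (n (n (n (l 351228) (n (n (l 351228) (n (n (n (l 203475) d) (l 203475)) (l 351228))) (l 351228))) 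
(l 351228)) (l 389957)) (l 389957))) (l 407156))) (l 407156)) (l 416281)) (l 416281))) (l 416281))) (l 416281)) 
(l 418102))) (l 418102))) (l 423972)) (l 424417))) (l 426316))) (n (n (n (n (l 357374) (n (n (n (n (l 353195) 
(n (n (l 345634) (n (n (n (n (l 333943) (n (n (l 301979) (n (n (n (l 234237) (n (n (n d (l 148368)) 
(l 148368)) (l 148368))) (l 301979)) (l 301979))) (l 333943))) (l 333943)) (l 345634)) (l 345634))) (l 353195))) 
(l 353195)) (n (n (n (n (l 356907) (n (n (n (l 355831) (n (n (l 353813) (n (n (n (n (l 351980) 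
(n (n (l 338603) (n (n (n (l 316026) (n (n (n (n (l 262199) (n (n (l 208910) (n (n d (l 208910)) 
(l 208910))) (l 262199))) (l 262199)) (l 316026)) (l 316026))) (l 338603)) (l 338603))) (l 346662))) (l 351980)) 
(l 353813)) (l 353813))) (l 355831))) (l 355831)) (l 356907))) (l 356907)) (l 357279)) (l 357279))) (l 357374))) 
(n (n (l 358032) (n (n (n (l 357688) (n (n (n (n (l 356267) (n (n (l 353527) (n (n (n (n (l 353527) 
(n (n (l 336764) (n (n (n (l 318406) (n (n (n (l 290618) (n (n (l 148463) (n (n d (l 148463)) 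
(l 148463))) (l 234331))) (l 290618)) (l 318406))) (l 318406)) (l 336764))) (l 347218))) (l 353527)) (l 353527)) 
(l 353527))) (l 356267))) (l 356267)) (l 357688)) (l 357688))) (l 358032)) (l 358032))) (l 358230))) (n (n (n (n (l 209524) 
d) (n (n (l 209524) (n (n (n (n (l 207649) (n (n (l 204117) (n (n (n (n (l 196163) (n (n (l 196163) 
(n (n (n (l 165818) (n (n (l 124029) (n (n (n (l 2) (n d (l 1))) (l 2)) (l 124029))) (l 124029))) 
(l 165818)) (l 196163))) (l 196163))) (l 196163)) (l 204117)) (l 204117))) (l 207649))) (l 207649)) (l 209524)) 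
(l 209524))) (l 209524))) (l 358083)) (l 358457))) (l 426455))) (l 428914)) (l 463225))) (l 465033))) (n (n (n (n (l 450461) 
(n (n (n (n (l 432339) (n (n (n (l 430589) (n (n (n (n (l 430104) (n (n (l 429834) (n (n (n (l 429344) 
(n (n (l 427999) (n (n (n (l 425158) (n (n (n (n (l 422241) (n (n (n (n (l 384779) (n (n (n (l 318020) 
(n (n (n (n (l 197041) d) (l 197041)) (l 318020)) (l 318020))) (l 384779)) (l 384779))) (l 396285)) 
(l 411535)) (l 411535))) (l 422241)) (l 422241)) (l 422241))) (l 427999)) (l 427999))) (l 429344))) (l 429344)) 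
(l 429834))) (l 429834))) (l 430104)) (n (n (n (l 429918) (n (n (n (l 429278) (n (n (l 427528) (n (n (n (l 425687) 
(n (n (n (n (l 414840) (n (n (n (n (l 377135) (n (n (n (l 377135) (n (n (l 197041) (n d (l 197041))) 
(l 309289))) (l 377135)) (l 377135))) (l 377135)) (l 401197)) (l 401197))) (l 420633)) (l 420633)) (l 420633))) 
(l 427528)) (l 427528))) (l 429278))) (l 429278)) (l 429918))) (l 429918)) (l 430269))) (l 430469))) (n (n (n (n (l 427999) 
(n (n (l 421434) (n (n (n (l 407521) (n (n (n (n (l 359414) (n (n (n (n (l 233358) (n d (l 233358))) 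
(l 233358)) (l 359414)) (l 359414))) (l 389886)) (l 389886)) (l 389886))) (l 421434)) (l 421434))) (l 427999))) 
(n (n (l 427548) (n (n (n (l 426717) (n (n (l 424441) (n (n (n (l 419394) (n (n (n (n (l 399991) 
(n (n (n (n (l 361521) (n (n (l 315940) (n (n (n (l 194640) d) (l 194640)) (l 315940))) (l 315940))) 
(l 361521)) (l 399991)) (l 399991))) (l 416345)) (l 416345)) (l 416345))) (l 424441)) (l 424441))) (l 426717))) 
(l 426717)) (l 427548))) (l 427548))) (l 430400)) (l 430681))) (l 432233))) (n (n (n (n (l 363160) (n (n (n (n (l 361222) 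
(n (n (l 353179) (n (n (n (l 353179) (n (n (n (n (l 307494) (n (n (n (l 238226) (n (n (n d 
(l 165688)) (l 165688)) (l 165688))) (l 307494)) (l 307494))) (l 339327)) (l 339327)) (l 339327))) (l 353179)) 
(l 353179))) (l 358073))) (n (n (l 360874) (n (n (n (l 360235) (n (n (l 357448) (n (n (n (l 357448) 
(n (n (n (n (l 337136) (n (n (n (l 322979) (n (n (n (n (l 248988) (n (n (n (l 195533) d) (l 195533)) 
(l 248988))) (l 248988)) (l 294584)) (l 294584))) (l 337136)) (l 337136))) (l 348278)) (l 355214)) (l 355214))) 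
(l 357448)) (l 357448))) (l 359152))) (l 360235)) (l 360874))) (l 360874))) (l 363065)) (l 363160))) (l 364007)) 
(n (n (n (n (l 310404) (n (n (n (l 310251) (n (n (n (n (l 309764) (n (n (l 307598) (n (n (n (l 305871) 
(n (n (n (n (l 299753) (n (n (n (l 280076) (n (n (l 280076) (n (n (n (n (l 112410) (n (n d 
(l 112410)) (l 112410))) (l 184948)) (l 241366)) (l 241366))) (l 280076))) (l 280076)) (l 299753))) (l 299753)) 
(l 302564)) (l 302564))) (l 307598)) (l 307598))) (l 308926))) (l 309764)) (l 310251)) (l 310251))) (l 310404)) 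
(l 310404))) (n (n d (l 198093)) (l 198093))) (l 364035)) (l 364035))) (l 405903))) (n (n (n (n (l 431257) 
(n (n (n (n (l 430312) (n (n (l 429961) (n (n (n (l 429584) (n (n (l 426861) (n (n (n (l 422199) 
(n (n (n (n (l 415415) (n (n (l 396554) (n (n (n (n (l 318207) (n (n (n (n (l 197342) d) (l 197342)) 
(l 318207)) (l 318207))) (l 385048)) (l 385048)) (l 385048))) (l 415415))) (l 415415)) (l 422199)) (l 422199))) 
(l 426861)) (l 426861))) (l 428505))) (l 429584)) (l 429961))) (l 429961))) (n (n (l 429897) (n (n (n (n (l 429521) 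
(n (n (l 426773) (n (n (n (l 422137) (n (n (n (n (l 411082) (n (n (l 400138) (n (n (n (n (l 357232) 
(n (n (n (l 232969) (n d (l 232969))) (l 232969)) (l 357232))) (l 357232)) (l 400138)) (l 400138))) 
(l 411082))) (l 411082)) (l 422137)) (l 422137))) (l 426773)) (l 426773))) (l 428429))) (l 429521)) (l 429897)) 
(l 429897))) (l 430312))) (n (n (n (n (l 429652) (n (n (n (n (l 429244) (n (n (l 427174) (n (n (n (l 424083) 
(n (n (n (n (l 415799) (n (n (l 398363) (n (n (n (n (l 373054) (n (n (l 305807) (n (n (n d 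
(l 232727)) (l 232727)) (l 232727))) (l 373054))) (l 373054)) (l 398363)) (l 398363))) (l 415799))) (l 415799)) 
(l 424083)) (l 424083))) (l 427174)) (l 427174))) (l 428410))) (l 429244)) (l 429652)) (l 429652))) (n (n (n (l 429278) 
(n (n (l 425741) (n (n (n (l 422046) (n (n (n (n (l 406782) (n (n (l 377347) (n (n (n (n (l 377347) 
(n (n (l 197242) (n d (l 197242))) (l 309561))) (l 377347)) (l 377347)) (l 377347))) (l 406782))) (l 406782)) 
(l 422046)) (l 422046))) (l 425741)) (l 425741))) (l 427878))) (l 429278)) (l 429970))) (l 429970)) (l 430427))) 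
(l 431100))) (n (n (n (n (l 428042) (n (n (l 415905) (n (n (n (l 394197) (n (n (n (n (l 363640) 
(n (n (l 233231) (n (n d (l 233231)) (l 233231))) (l 306532))) (l 363640)) (l 394197)) (l 394197))) 
(l 415905)) (l 415905))) (l 422727))) (n (n (l 427455) (n (n (n (l 426464) (n (n (l 422267) (n (n (n (l 414387) 
(n (n (n (n (l 414387) (n (n (l 361567) (n (n (n (l 315969) (n (n (n (l 194811) d) (l 194811)) 
(l 315969))) (l 315969)) (l 361567))) (l 390050))) (l 414387)) (l 414387)) (l 414387))) (l 422267)) (l 422267))) 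
(l 424647))) (l 426464)) (l 427455))) (l 427455))) (n (n (n (n (l 430169) (n (n (n (l 429408) (n (n (l 427983) 
(n (n (n (l 421656) (n (n (n (n (l 408156) (n (n (l 389255) (n (n (n (l 363225) (n (n (l 309728) 
(n (n d (l 197655)) (l 197655))) (l 363225))) (l 363225)) (l 389255))) (l 389255))) (l 408156)) (l 421656)) 
(l 421656))) (l 427983)) (l 427983))) (l 427983))) (l 429408)) (l 430169))) (l 430169)) (l 430627)) (l 430627))) 
(l 431376))) (l 433507)) (l 433705))) (l 449810))) (n (n (l 447172) (n (n (n (n (l 441000) (n (n (n (n (l 440496) 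
(n (n (l 426408) (n (n (n (l 411987) (n (n (n (l 386515) (n (n (l 316238) (n (n (n d (l 242777)) 
(l 242777)) (l 242777))) (l 386515))) (l 386515)) (l 411987))) (l 411987)) (l 426408))) (l 433696))) (n (n (l 439899) 
(n (n (n (l 439899) (n (n (l 435064) (n (n (n (l 430014) (n (n (n (l 416799) (n (n (l 402482) 
(n (n (n (n (l 328295) (n (n (n (l 197718) d) (l 197718)) (l 328295))) (l 328295)) (l 373960)) (l 373960))) 
(l 416799))) (l 416799)) (l 430014))) (l 430014)) (l 435064))) (l 437602))) (l 439899)) (l 439899))) (l 439899))) 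
(n (n (n (n (l 439778) (n (n (n (l 439778) (n (n (l 436700) (n (n (n (l 432715) (n (n (n (l 421854) 
(n (n (l 398895) (n (n (n (n (l 357726) (n (n (l 309919) (n (n d (l 197718)) (l 197718))) (l 357726))) 
(l 357726)) (l 398895)) (l 398895))) (l 421854))) (l 421854)) (l 432715))) (l 432715)) (l 436700))) (l 437999))) 
(l 439778)) (l 439778))) (l 439778)) (l 440236)) (l 440236))) (l 441000))) (n (n (n (n (l 442261) (n (n (n (n (l 441145) 
(n (n (n (l 441145) (n (n (l 438501) (n (n (n (l 435608) (n (n (n (l 430327) (n (n (l 415881) 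
(n (n (n (l 400689) (n (n (n (n (l 311171) (n (n d (l 198576)) (l 198576))) (l 358978)) (l 358978)) 
(l 358978))) (l 415881)) (l 415881))) (l 430327))) (l 430327)) (l 435608))) (l 435608)) (l 438501))) (l 440149))) 
(l 441145)) (l 441145))) (l 441145)) (n (n (n (n (l 441498) (n (n (l 438056) (n (n (n (l 434285) 
(n (n (n (l 428578) (n (n (l 399383) (n (n (n (l 368892) (n (n (n (n (l 242922) (n d (l 242922))) 
(l 242922)) (l 368892)) (l 368892))) (l 399383)) (l 399383))) (l 417018))) (l 428578)) (l 434285))) (l 434285)) 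
(l 438056))) (l 440203))) (l 441498)) (l 441498)) (l 441498))) (l 442061))) (n (n (l 418669) (n (n (n (l 394539) 
(n (n (n (l 394539) (n (n (l 199139) (n d (l 199139))) (l 311733))) (l 394539)) (l 394539))) (l 394539)) 
(l 418669))) (l 432313))) (n (n (n (l 441905) (n (n (n (n (l 441905) (n (n (l 436989) (n (n (n (l 432745) 
(n (n (n (l 421468) (n (n (l 403336) (n (n (n (l 372752) (n (n (l 243207) (n (n d (l 243207)) 
(l 243207))) (l 316668))) (l 372752)) (l 403336))) (l 403336))) (l 421468)) (l 432745))) (l 432745)) (l 436989))) 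
(l 439640))) (l 441905)) (l 441905)) (l 441905))) (l 442638)) (l 442638))) (l 442860))) (l 443434)) (l 446450))) 
(l 449597))) (n (n (n (n (l 425688) (n (n (n (n (l 382107) (n (n (n (l 381677) (n (n (l 381381) 
(n (n (n (l 380116) (n (n (l 378395) (n (n (n (l 375300) (n (n (l 369008) (n (n (n (n (l 343549) 
(n (n (n (n (l 272454) (n (n (n (l 127822) d) (l 127822)) (l 272454))) (l 272454)) (l 317792)) (l 317792))) 
(l 357866)) (l 357866)) (l 357866))) (l 375300))) (l 375300)) (l 378395))) (l 378395))) (l 380116)) (l 381381))) 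
(l 381381))) (n (n (n (n (l 381255) (n (n (n (l 380291) (n (n (l 378966) (n (n (n (l 376607) 
(n (n (l 371054) (n (n (n (n (l 340082) (n (n (n (n (l 290591) (n (n (l 237045) (n (n d (l 127822)) 
(l 127822))) (l 290591))) (l 290591)) (l 340082)) (l 340082))) (l 363014)) (l 363014)) (l 363014))) (l 376607))) 
(l 376607)) (l 378966))) (l 378966))) (l 380291)) (l 381255))) (l 381255)) (l 381483)) (l 381483))) (l 382107))) 
(n (n (n (n (l 381844) (n (n (n (n (l 381520) (n (n (n (l 380763) (n (n (l 379823) (n (n (n (l 376754) 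
(n (n (l 376754) (n (n (n (n (l 356032) (n (n (n (l 332485) (n (n (n (n (l 237247) (n (n d 
(l 127690)) (l 127690))) (l 290794)) (l 290794)) (l 290794))) (l 356032)) (l 356032))) (l 370451)) (l 370451)) 
(l 370451))) (l 376754))) (l 376754)) (l 379823))) (l 379823))) (l 380763)) (l 381520))) (l 381520)) (l 381695)) 
(l 381695))) (l 381918)) (n (n (n (l 381329) (n (n (n (n (l 380072) (n (n (l 378313) (n (n (n (l 375890) 
(n (n (l 370911) (n (n (n (n (l 342084) (n (n (n (l 311510) (n (n (l 254228) (n (n d (l 254228)) 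
(l 254228))) (l 254228))) (l 311510)) (l 342084))) (l 342084)) (l 360480)) (l 360480))) (l 375890))) (l 375890)) 
(l 378313))) (l 378313))) (l 380072)) (l 381329)) (l 381329))) (l 381918)) (l 381918))) (l 381918))) (n (n (n (n (l 254073) 
(n (n (l 254073) (n (n (n (l 252407) (n (n (l 250112) (n (n (n (l 243301) (n (n (l 243301) 
(n (n (n (n (l 209172) (n (n (l 144847) (n (n (n (n (l 1) d) (l 2)) (l 144847)) (l 144847))) (l 209172))) 
(l 209172)) (l 243301)) (l 243301))) (l 243301))) (l 243301)) (l 250112))) (l 250112))) (l 252407)) (l 254073))) 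
(l 254073))) (n d (l 254073))) (l 254510)) (l 382333))) (l 382597))) (n (n (n (n (l 421888) (n (n (n (n (l 420548) 
(n (n (n (l 419812) (n (n (n (n (l 419194) (n (n (l 418187) (n (n (n (l 416353) (n (n (l 411321) 
(n (n (n (l 400697) (n (n (n (n (l 389786) (n (n (n (n (l 249679) (n (n d (l 249679)) (l 249679))) 
(l 292710)) (l 349748)) (l 349748))) (l 389786)) (l 389786)) (l 389786))) (l 411321)) (l 411321))) (l 416353))) 
(l 416353)) (l 418187))) (l 418187))) (l 419194)) (l 419812)) (l 419812))) (n (n (n (l 419102) (n (n (l 417416) 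
(n (n (n (l 414309) (n (n (l 405797) (n (n (n (l 386921) (n (n (n (n (l 314353) (n (n (n (n (l 170474) 
d) (l 170474)) (l 314353)) (l 314353))) (l 375518)) (l 375518)) (l 375518))) (l 405797)) (l 405797))) (l 414309))) 
(l 414309)) (l 417416))) (l 417416))) (l 419102)) (l 420153))) (l 420153))) (n (n (n (n (l 420115) (n (n (n (l 419759) 
(n (n (l 418458) (n (n (n (l 416068) (n (n (l 405644) (n (n (n (l 405644) (n (n (n (n (l 329678) 
(n (n (n (l 276727) (n (n d (l 170532)) (l 170532))) (l 329678)) (l 329678))) (l 371349)) (l 397289)) 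
(l 397289))) (l 405644)) (l 405644))) (l 412019))) (l 416068)) (l 418458))) (l 418458))) (l 419759)) (l 420115))) 
(l 420115)) (l 420418)) (l 420418))) (n (n (n (n (l 420077) (n (n (n (n (l 419273) (n (n (l 417959) 
(n (n (n (l 416552) (n (n (l 406367) (n (n (n (l 388931) (n (n (n (n (l 363560) (n (n (l 293018) 
(n (n (n d (l 249987)) (l 249987)) (l 249987))) (l 363560))) (l 363560)) (l 388931)) (l 388931))) (l 406367)) 
(l 406367))) (l 412515))) (l 416552)) (l 417959))) (l 417959))) (l 419273)) (l 420077)) (l 420077))) (n (n (n (l 419155) 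
(n (n (l 416958) (n (n (n (l 413252) (n (n (l 397555) (n (n (n (l 368085) (n (n (n (n (l 368085) 
(n (n (l 170534) (n d (l 170534))) (l 277062))) (l 368085)) (l 368085)) (l 368085))) (l 397555)) (l 397555))) 
(l 406456))) (l 413252)) (l 416958))) (l 416958))) (l 419155)) (l 420521))) (l 420521)) (l 421036))) (l 421559))) 
(n (n (l 421943) (n (n (n (n (l 421106) (n (n (n (l 419633) (n (n (l 417403) (n (n (n (l 417403) 
(n (n (l 399320) (n (n (n (l 380433) (n (n (n (l 331007) (n (n (l 277461) (n (n d (l 170791)) 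
(l 170791))) (l 331007))) (l 331007)) (l 380433))) (l 380433)) (l 399320))) (l 408810))) (l 417403)) (l 417403))) 
(l 417403))) (l 419633)) (l 421106))) (l 421106)) (l 421621)) (l 421621))) (l 422104))) (n (n (n (n (l 411089) 
(n (n (n (n (l 409748) (n (n (n (l 408495) (n (n (l 407388) (n (n (n (l 402655) (n (n (l 396220) 
(n (n (n (l 384644) (n (n (l 361112) (n (n (n (n (l 265895) (n (n d (l 169562)) (l 169562))) (l 319441)) 
(l 319441)) (l 319441))) (l 384644))) (l 384644)) (l 396220))) (l 396220))) (l 402655)) (l 407388))) (l 407388))) 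
(l 408495)) (l 409748))) (l 409748)) (n (n (n (n (l 408507) (n (n (l 408507) (n (n (n (l 402275) 
(n (n (l 393692) (n (n (n (l 368220) (n (n (l 368220) (n (n (n (n (l 240578) (n d (l 240578))) 
(l 240578)) (l 368220)) (l 368220))) (l 368220))) (l 368220)) (l 393692))) (l 393692))) (l 402275)) (l 408507))) 
(l 408507))) (l 408507)) (l 410141)) (l 410141))) (l 410866))) (n (n (n (n (l 398418) (n (n (n (n (l 397171) 
(n (n (l 395695) (n (n (n (l 391765) (n (n (l 385458) (n (n (n (l 373838) (n (n (l 342001) 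
(n (n (n (l 271405) (n (n (n d (l 228758)) (l 228758)) (l 228758))) (l 342001)) (l 342001))) (l 373838))) 
(l 373838)) (l 385458))) (l 385458))) (l 391765)) (l 395695))) (l 395695))) (l 397171)) (l 398418)) (l 398418))) 
(l 398948)) (n (n (n (l 360286) (n (n (l 314782) (n (n (n (l 170189) d) (l 170189)) (l 314782))) 
(l 314782))) (l 360286)) (l 398948))) (l 398948))) (l 411762)) (l 422099))) (l 422473))) (l 456616)) (l 459568))) 
(l 474075))) (l 493327)) (l 501724))) (l 555471))) (n (n (n (n (l 536416) (n (n (n (n (l 440380) (n (n (n (n (l 204526) 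
d) (n (n (n (n (l 365303) (n (n (n (n (l 363544) (n (n (n (l 362274) (n (n (n (n (l 360572) 
(n (n (n (n (l 344620) (n (n (n (l 321497) (n (n (n (n (l 290492) (n (n (n d (l 202214)) (l 202214)) 
(l 202214))) (l 290492)) (l 290492)) (l 290492))) (l 344620)) (l 344620))) (l 355724)) (l 355724)) (l 355724))) 
(l 360572)) (l 360572)) (l 360572))) (l 363544)) (l 363544))) (n (n (l 361985) (n (n (n (n (l 359096) 
(n (n (n (n (l 322664) (n (n (n (l 299249) (n (n (n (n (l 161939) (n d (l 161939))) (l 161939)) 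
(l 253036)) (l 253036))) (l 322664)) (l 322664))) (l 341443)) (l 353165)) (l 353165))) (l 359096)) (l 359096)) 
(l 359096))) (l 364154))) (n (n (n (l 364053) (n (n (l 363777) (n (n (n (l 363193) (n (n (n (n (l 362594) 
(n (n (n (n (l 354901) (n (n (n (l 341190) (n (n (n (n (l 316343) (n (n (l 275876) (n (n (n (l 202214) 
(n d (l 202214))) (l 202214)) (l 275876))) (l 275876))) (l 316343)) (l 341190)) (l 341190))) (l 354901)) 
(l 354901))) (l 357264)) (l 360396)) (l 360396))) (l 362594)) (l 362594)) (l 362594))) (l 363777)) (l 363777))) 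
(l 364053))) (l 364053)) (l 364154))) (l 364981))) (l 365303)) (n (n (n (n (l 364440) (n (n (l 361811) 
(n (n (n (n (l 352994) (n (n (n (n (l 327266) (n (n (n (l 274422) (n (n (l 162164) (n (n d 
(l 162164)) (l 162164))) (l 274422))) (l 274422)) (l 327266))) (l 327266)) (l 346672)) (l 346672))) (l 357954)) 
(l 357954)) (l 357954))) (l 364440))) (n (n (n (l 364100) (n (n (l 363740) (n (n (n (l 363362) (n (n (n (n (l 361134) 
(n (n (n (n (l 353391) (n (n (n (l 353391) (n (n (l 316403) (n (n (n (l 275936) (n (n (n (l 202066) 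
(n d (l 202066))) (l 202066)) (l 275936))) (l 275936)) (l 316403))) (l 339457))) (l 353391)) (l 353391))) 
(l 353391)) (l 358332)) (l 358332))) (l 362324)) (l 362324)) (l 362324))) (l 363740)) (l 363740))) (l 364100))) 
(n (n (n (n (l 363328) (n (n (n (l 362878) (n (n (n (n (l 361058) (n (n (n (n (l 356523) (n (n (n (l 345931) 
(n (n (l 332778) (n (n (n (l 289855) (n (n (l 289855) (n (n (n d (l 201691)) (l 201691)) (l 201691))) 
(l 289855))) (l 289855)) (l 332778))) (l 332778))) (l 345931)) (l 356523))) (l 356523)) (l 358964)) (l 358964))) 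
(l 362081)) (l 362081)) (l 362081))) (l 363328)) (l 363328))) (n (n (l 362842) (n (n (n (n (l 359757) 
(n (n (n (n (l 351142) (n (n (n (l 333617) (n (n (l 318128) (n (n (n (l 251930) (n (n (l 161912) 
(n d (l 161912))) (l 161912))) (l 251930)) (l 318128))) (l 318128))) (l 333617)) (l 351142))) (l 351142)) 
(l 356636)) (l 356636))) (l 361492)) (l 361492)) (l 361492))) (l 363604))) (l 363604)) (l 363979))) (l 364231))) 
(l 365519)) (l 365803))) (l 366590))) (n (n (n (n (l 364967) (n (n (n (n (l 362650) (n (n (l 360716) 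
(n (n (n (n (l 349939) (n (n (n (n (l 338453) (n (n (l 311413) (n (n (n (n (l 160661) (n (n d 
(l 160661)) (l 160661))) (l 272440)) (l 272440)) (l 272440))) (l 338453))) (l 338453)) (l 349939)) (l 349939))) 
(l 357930)) (l 357930)) (l 357930))) (l 362650))) (n (n (l 362489) (n (n (n (l 362203) (n (n (l 361530) 
(n (n (n (n (l 357777) (n (n (n (n (l 351781) (n (n (l 345292) (n (n (n (n (l 316569) (n (n (n (l 250871) 
(n (n (l 160661) (n d (l 160661))) (l 160661))) (l 250871)) (l 316569))) (l 316569)) (l 332058)) (l 332058))) 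
(l 351781))) (l 351781)) (l 357777)) (l 357777))) (l 360556)) (l 360556)) (l 360556))) (l 362203))) (l 362203)) 
(l 362489))) (l 362489))) (n (n (n (n (l 360426) (n (n (n (l 360210) (n (n (l 359623) (n (n (n (n (l 357046) 
(n (n (n (n (l 352130) (n (n (l 341898) (n (n (n (n (l 317539) (n (n (l 294915) (n (n (n (n (l 157804) 
(n d (l 157804))) (l 157804)) (l 248835)) (l 248835))) (l 317539))) (l 317539)) (l 341898)) (l 341898))) 
(l 352130))) (l 352130)) (l 357046)) (l 357046))) (l 358895)) (l 358895)) (l 358895))) (l 360210))) (l 360210)) 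
(l 360426))) (n (n (n (n (l 350546) (n (n (n (n (l 324657) (n (n (l 276731) (n (n (n (n (l 202621) 
(n d (l 202621))) (l 202621)) (l 276731)) (l 276731))) (l 324657))) (l 324657)) (l 350546)) (l 350546))) 
(l 356804)) (l 356804)) (l 356804))) (l 363408)) (l 363408))) (l 364967))) (n (n (n (n (l 362380) (n (n (n (l 359985) 
(n (n (n (n (l 352266) (n (n (n (n (l 340586) (n (n (l 289600) (n (n (n (l 289600) (n (n (n d 
(l 201791)) (l 201791)) (l 201791))) (l 289600)) (l 289600))) (l 320623))) (l 340586)) (l 352266)) (l 352266))) 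
(l 357635)) (l 357635)) (l 357635))) (n (n (n (n (l 362010) (n (n (l 361427) (n (n (n (n (l 358778) 
(n (n (n (n (l 356192) (n (n (l 343073) (n (n (n (l 323479) (n (n (n (n (l 270965) (n (n (l 160437) 
(n (n d (l 160437)) (l 160437))) (l 270965))) (l 270965)) (l 323479)) (l 323479))) (l 343073)) (l 343073))) 
(l 350903))) (l 356192)) (l 358778)) (l 358778))) (l 360794)) (l 360794)) (l 360794))) (l 362010))) (l 362010)) 
(l 362229)) (l 362229))) (l 362380))) (n (n (l 359552) (n (n (n (n (l 342186) (n (n (n (n (l 342186) 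
(n (n (l 252884) (n (n (n (l 161468) (n d (l 161468))) (l 161468)) (l 252884))) (l 299081))) (l 342186)) 
(l 342186)) (l 342186))) (l 355518)) (l 355518)) (l 355518))) (l 363411))) (n (n (n (l 363116) (n (n (n (n (l 362362) 
(n (n (l 361567) (n (n (n (n (l 358262) (n (n (n (n (l 353164) (n (n (l 344840) (n (n (n (l 335920) 
(n (n (l 271358) (n (n (n (l 160830) (n (n d (l 160830)) (l 160830))) (l 271358)) (l 271358))) (l 310331))) 
(l 335920)) (l 344840))) (l 344840))) (l 353164)) (l 358262)) (l 358262))) (l 361081)) (l 361081)) (l 361081))) 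
(l 362362))) (l 362362)) (n (n (n (l 361612) (n (n (n (n (l 357627) (n (n (n (n (l 349726) (n (n (l 340365) 
(n (n (n (l 315453) (n (n (l 275478) (n (n (n (l 201818) (n d (l 201818))) (l 201818)) (l 275478))) 
(l 275478))) (l 315453)) (l 340365))) (l 340365))) (l 349726)) (l 357627)) (l 357627))) (l 360986)) (l 360986)) 
(l 360986))) (l 362648)) (l 362648))) (l 363116))) (l 363312)) (l 363483))) (l 364951))) (l 366119)) (l 366984))) 
(l 368666))) (n (n (n (n (l 472616) (n (n (n (n (l 471525) (n (n (n (l 469339) (n (n (n (n (l 468633) 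
(n (n (n (n (l 463080) (n (n (n (l 455031) (n (n (n (n (l 444238) (n (n (n (n (l 343118) (n (n (n (l 196542) 
d) (l 343118)) (l 343118))) (l 413509)) (l 413509)) (l 413509))) (l 444238)) (l 444238)) (l 444238))) (l 463080)) 
(l 463080))) (l 466945)) (l 466945)) (l 466945))) (l 468633)) (n (n (n (l 468261) (n (n (l 468261) 
(n (n (n (n (l 465750) (n (n (n (l 462896) (n (n (n (n (l 451356) (n (n (n (n (l 422609) (n (n (n (l 355464) 
(n (n (l 272090) (n d (l 272090))) (l 272090))) (l 355464)) (l 422609))) (l 422609)) (l 438081)) (l 438081))) 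
(l 457845)) (l 457845)) (l 457845))) (l 465750)) (l 465750))) (l 467497)) (l 467497)) (l 467497))) (l 468261))) 
(l 468261)) (l 468633))) (l 468633))) (n (n (n (l 469781) (n (n (n (n (l 460398) (n (n (n (l 446173) 
(n (n (n (n (l 397246) (n (n (n (n (l 323205) (n d (l 196656))) (l 323205)) (l 397246)) (l 397246))) 
(l 431275)) (l 431275)) (l 431275))) (l 460398)) (l 460398))) (l 466936)) (l 466936)) (l 466936))) (l 469781)) 
(l 469781))) (l 470878))) (n (n (n (n (l 469352) (n (n (n (l 469352) (n (n (n (n (l 459476) (n (n (n (l 459476) 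
(n (n (n (n (l 396869) (n (n (n (l 396869) (n (n (n d (l 196748)) (l 322754)) (l 322754))) (l 396869)) 
(l 396869))) (l 427906)) (l 447784)) (l 447784))) (l 459476)) (l 459476))) (l 464372)) (l 467508)) (l 467508))) 
(l 469352)) (l 469352))) (l 470125)) (n (n (n (n (l 469483) (n (n (n (n (l 456801) (n (n (n (l 448650) 
(n (n (n (n (l 400853) (n (n (n (l 344482) (n (n (l 196748) d) (l 344482))) (l 344482)) (l 400853))) 
(l 400853)) (l 432564)) (l 432564))) (l 456801)) (l 456801))) (l 463338)) (l 467418)) (l 467418))) (n (n (l 468910) 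
(n (n (n (l 468910) (n (n (n (n (l 464739) (n (n (n (l 461831) (n (n (n (n (l 446635) (n (n (n (l 435657) 
(n (n (l 395499) (n (n (n (l 321748) (n d (l 196748))) (l 321748)) (l 395499))) (l 395499))) (l 435657)) 
(l 446635))) (l 446635)) (l 456000)) (l 456000))) (l 464739)) (l 464739))) (l 467027)) (l 468451)) (l 468451))) 
(l 468910)) (l 468910))) (l 469260))) (l 469483)) (l 469614))) (l 471375))) (n (n (n (n (l 388695) (n (n (n (l 275332) 
(n (n d (l 275332)) (l 275332))) (l 388695)) (l 388695))) (n (n (n (n (l 427808) (n (n (n (l 427432) 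
(n (n (l 427432) (n (n (n (n (l 424227) (n (n (n (l 422078) (n (n (n (n (l 415275) (n (n (l 384969) 
(n (n (n (l 360813) (n (n (n (n (l 275236) (n d (l 275236))) (l 275236)) (l 314562)) (l 314562))) 
(l 384969)) (l 384969))) (l 403553))) (l 415275)) (l 422078)) (l 422078))) (l 424227)) (l 424227))) (l 425613)) 
(l 426692)) (l 426692))) (l 427432))) (l 427432)) (l 427808))) (l 427808)) (n (n (n (l 427658) (n (n (n (n (l 427450) 
(n (n (n (n (l 424772) (n (n (n (l 419999) (n (n (n (n (l 411350) (n (n (l 397263) (n (n (n (l 371622) 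
(n (n (l 301232) (n (n (n (l 152625) d) (l 301232)) (l 301232))) (l 371622))) (l 371622)) (l 397263))) 
(l 397263))) (l 411350)) (l 419999)) (l 419999))) (l 424772)) (l 424772))) (l 425594)) (l 426685)) (l 426685))) 
(l 427450)) (l 427450)) (l 427450))) (l 427862)) (l 427862))) (l 427958))) (l 453969)) (l 454004))) (l 472470))) 
(l 472920)) (n (n (n (n (l 469052) (n (n (n (n (l 463641) (n (n (n (l 462205) (n (n (n (n (l 454665) 
(n (n (n (l 445772) (n (n (l 422466) (n (n (n (n (l 391429) (n (n (n d (l 201765)) (l 327711)) 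
(l 327711))) (l 391429)) (l 391429)) (l 391429))) (l 445772))) (l 445772)) (l 454665))) (l 454665)) (l 459667)) 
(l 459667))) (n (n (n (n (l 463133) (n (n (l 462801) (n (n (n (n (l 460788) (n (n (n (l 458471) 
(n (n (l 452166) (n (n (n (n (l 424470) (n (n (n (n (l 371654) (n (n (l 261725) (n (n d (l 261725)) 
(l 261725))) (l 371654))) (l 371654)) (l 424470)) (l 424470))) (l 444336)) (l 444336)) (l 444336))) (l 458471))) 
(l 458471)) (l 460788))) (l 460788)) (l 462124)) (l 462124))) (l 463133))) (l 463133)) (l 463490)) (l 463490))) 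
(l 463641))) (n (n (n (n (l 462324) (n (n (l 461879) (n (n (n (l 461524) (n (n (n (n (l 460268) 
(n (n (n (l 456226) (n (n (l 456226) (n (n (n (n (l 421792) (n (n (n (l 398705) (n (n (n (n (l 325613) 
(n d (l 199667))) (l 325613)) (l 398705)) (l 398705))) (l 421792)) (l 421792))) (l 436689)) (l 448276)) 
(l 448276))) (l 456226))) (l 456226)) (l 460268))) (l 460268)) (l 460845)) (l 460845))) (l 461879)) (l 461879))) 
(l 462152))) (l 462324)) (n (n (n (n (l 449561) (n (n (n (l 425106) (n (n (l 400949) (n (n (n (n (l 262756) 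
(n d (l 262756))) (l 262756)) (l 354743)) (l 354743))) (l 425106))) (l 425106)) (l 449561))) (l 449561)) 
(l 458123)) (l 458123))) (l 464672))) (n (n (n (n (l 462155) (n (n (n (n (l 453198) (n (n (n (l 434804) 
(n (n (l 395727) (n (n (n (n (l 339278) (n (n (l 201792) d) (l 339278))) (l 339278)) (l 395727)) 
(l 395727))) (l 434804))) (l 434804)) (l 453198))) (l 453198)) (l 459954)) (l 459954))) (n (n (n (n (l 463415) 
(n (n (l 462953) (n (n (n (n (l 461143) (n (n (n (l 455902) (n (n (l 446076) (n (n (n (n (l 437155) 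
(n (n (l 372018) (n (n (n (l 262089) (n (n d (l 262089)) (l 262089))) (l 372018)) (l 372018))) (l 411261))) 
(l 437155)) (l 446076)) (l 446076))) (l 455902))) (l 455902)) (l 461143))) (l 461143)) (l 462953)) (l 462953))) 
(l 463415))) (l 463415)) (l 463881)) (l 463881))) (l 464077)) (l 464077))) (l 468680))) (n (n (n (n (l 404532) 
(n (n (n (l 330347) (n d (l 203605))) (n (n (n (l 330054) (n (n (l 329450) (n (n (n (n (l 325957) 
(n (n (n (l 322253) (n (n (l 315312) (n (n (n (l 284506) (n (n (n (n (l 218773) (n (n (l 126742) 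
(n d (l 126742))) (l 126742))) (l 218773)) (l 284506)) (l 284506))) (l 315312)) (l 315312))) (l 315312))) 
(l 322253)) (l 325957))) (l 325957)) (l 328186)) (l 328186))) (l 330054))) (l 330054)) (l 330347))) (l 404319))) 
(n (n (l 404148) (n (n (n (n (l 403552) (n (n (l 403013) (n (n (n (n (l 399518) (n (n (n (l 399518) 
(n (n (l 384532) (n (n (n (l 365128) (n (n (n (l 312244) (n (n (l 200457) (n (n d (l 200457)) 
(l 200457))) (l 312244))) (l 312244)) (l 365128))) (l 365128)) (l 384532))) (l 390855))) (l 399518)) (l 399518))) 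
(l 399518)) (l 401748)) (l 401748))) (l 403552))) (n (n (n (n (l 402777) (n (n (n (n (l 400081) (n (n (n (l 400081) 
(n (n (l 387206) (n (n (n (l 373119) (n (n (n (l 347406) (n (n (l 277067) (n (n (n (l 203095) 
d) (l 277067)) (l 277067))) (l 347406))) (l 347406)) (l 373119))) (l 373119)) (l 387206))) (l 395231))) (l 400081)) 
(l 400081))) (l 400081)) (l 401801)) (l 401801))) (l 403191)) (l 403191)) (l 403191))) (l 404148)) (l 404148))) 
(l 404532))) (n (n (n (n (l 444554) (n (n (n (n (l 443969) (n (n (l 443505) (n (n (n (n (l 441451) 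
(n (n (n (l 436755) (n (n (l 430305) (n (n (n (l 418820) (n (n (l 391782) (n (n (n (n (l 240972) 
(n (n d (l 240972)) (l 240972))) (l 352634)) (l 352634)) (l 352634))) (l 418820))) (l 418820)) (l 430305))) 
(l 430305))) (l 436755)) (l 441451))) (l 441451)) (l 442559)) (l 442559))) (l 443969))) (n (n (n (n (l 443335) 
(n (n (n (n (l 441756) (n (n (n (l 438069) (n (n (l 433491) (n (n (n (l 418550) (n (n (l 418550) 
(n (n (n (n (l 317652) (n (n (n (l 202996) d) (l 317652)) (l 317652))) (l 387860)) (l 387860)) (l 387860))) 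
(l 418550))) (l 418550)) (l 433491))) (l 433491))) (l 438069)) (l 441756))) (l 441756)) (l 442606)) (l 442606))) 
(l 443691)) (l 443691)) (l 443691))) (l 444554)) (l 444554))) (n (n (n (n (l 443200) (n (n (n (l 442741) 
(n (n (n (n (l 440344) (n (n (n (l 438612) (n (n (l 432277) (n (n (n (l 420642) (n (n (l 369886) 
(n (n (n (l 369886) (n (n (n d (l 202898)) (l 329202)) (l 329202))) (l 369886)) (l 369886))) (l 400923))) 
(l 420642)) (l 432277))) (l 432277))) (l 438612)) (l 440344))) (l 440344)) (l 441821)) (l 441821))) (l 443200)) 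
(l 443200))) (n (n (l 442774) (n (n (n (n (l 438701) (n (n (n (l 431530) (n (n (l 420673) (n (n (n (l 420673) 
(n (n (l 332624) (n (n (n (l 240662) (n d (l 240662))) (l 240662)) (l 332624))) (l 378830))) (l 420673)) 
(l 420673))) (l 420673))) (l 431530)) (l 438701))) (l 438701)) (l 441208)) (l 441208))) (l 443561))) (n (n (n (n (l 442711) 
(n (n (n (n (l 439713) (n (n (n (l 433612) (n (n (l 428221) (n (n (n (l 405177) (n (n (l 373842) 
(n (n (n (l 317481) (n (n (l 202898) d) (l 317481))) (l 317481)) (l 373842))) (l 373842))) (l 405177)) 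
(l 428221))) (l 428221))) (l 433612)) (l 439713))) (l 439713)) (l 441625)) (l 441625))) (l 443315)) (l 443315)) 
(l 443315))) (l 444776))) (l 444849)) (l 445257))) (l 445779))) (l 481353)) (l 481538))) (l 491350))) (n (n (n (n (l 470336) 
(n (n (n (n (l 449741) (n (n (n (l 447197) (n (n (l 443560) (n (n (n (n (l 438306) (n (n (l 425509) 
(n (n (n (n (l 382578) (n (n (n (n (l 257302) (n d (l 257302))) (l 257302)) (l 351792)) (l 351792))) 
(l 406728)) (l 406728)) (l 406728))) (l 438306))) (l 438306)) (l 443560)) (l 443560))) (l 447197))) (n (n (n (n (l 443237) 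
(n (n (n (n (l 439239) (n (n (l 429827) (n (n (n (n (l 377350) (n (n (n (n (l 321425) (n (n (l 189764) 
d) (l 321425))) (l 321425)) (l 377350)) (l 377350))) (l 416260)) (l 416260)) (l 416260))) (l 439239))) (l 439239)) 
(l 443237)) (l 443237))) (n (n (n (n (l 445110) (n (n (l 444375) (n (n (n (n (l 443308) (n (n (l 440471) 
(n (n (n (n (l 427572) (n (n (n (n (l 414979) (n (n (l 351101) (n (n (n (l 255696) (n (n d 
(l 255696)) (l 255696))) (l 351101)) (l 351101))) (l 389227))) (l 414979)) (l 427572)) (l 427572))) (l 437389)) 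
(l 437389)) (l 437389))) (l 443308))) (l 443308)) (l 444375)) (l 444375))) (l 445110))) (l 445110)) (n (n (n (l 444502) 
(n (n (n (n (l 443109) (n (n (l 439236) (n (n (n (n (l 423145) (n (n (n (n (l 398322) (n (n (l 357793) 
(n (n (n (l 314358) (n d (l 189764))) (l 314358)) (l 357793))) (l 357793))) (l 398322)) (l 423145)) 
(l 423145))) (l 436873)) (l 436873)) (l 436873))) (l 443109))) (l 443109)) (l 444502)) (l 444502))) (l 445460)) 
(l 445460))) (l 445798))) (l 446150)) (l 446227))) (l 449634))) (n (n (n (n (l 405955) (n (n (l 405955) 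
(n (n (n d (l 191482)) (l 317664)) (l 317664))) (l 405955))) (l 405955)) (n (n (n (n (l 448809) (n (n (n (n (l 447894) 
(n (n (l 447162) (n (n (n (n (l 445421) (n (n (l 443803) (n (n (n (n (l 434001) (n (n (n (l 422719) 
(n (n (l 392021) (n (n (n (n (l 257165) (n (n d (l 257165)) (l 257165))) (l 353894)) (l 353894)) 
(l 353894))) (l 422719))) (l 422719)) (l 434001))) (l 434001)) (l 440509)) (l 440509))) (l 445421))) (l 445421)) 
(l 447162)) (l 447162))) (l 447894))) (l 447894)) (n (n (n (l 447293) (n (n (n (n (l 445022) (n (n (l 442775) 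
(n (n (n (n (l 433963) (n (n (n (l 408442) (n (n (l 360596) (n (n (n (n (l 317161) (n d (l 191079))) 
(l 317161)) (l 360596)) (l 360596))) (l 408442))) (l 408442)) (l 433963))) (l 433963)) (l 442775)) (l 442775))) 
(l 445022))) (l 445022)) (l 447293)) (l 447293))) (l 448245)) (l 448245))) (l 448585))) (n (n (n (l 448111) 
(n (n (l 446850) (n (n (n (n (l 444589) (n (n (l 441964) (n (n (n (n (l 424945) (n (n (n (l 424945) 
(n (n (l 351978) (n (n (n (l 257495) (n d (l 257495))) (l 257495)) (l 351978))) (l 382765))) (l 424945)) 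
(l 424945))) (l 424945)) (l 435803)) (l 435803))) (l 444589))) (l 444589)) (l 446850)) (l 446850))) (l 448111))) 
(n (n (n (n (l 446804) (n (n (n (n (l 444717) (n (n (l 442458) (n (n (n (n (l 432460) (n (n (n (l 409591) 
(n (n (l 378189) (n (n (n (l 322263) (n (n (l 190615) d) (l 322263))) (l 322263)) (l 378189))) (l 378189))) 
(l 409591)) (l 432460))) (l 432460)) (l 437851)) (l 437851))) (l 444717))) (l 444717)) (l 446804)) (l 446804))) 
(l 447772)) (l 447772)) (l 447772))) (l 448941))) (l 449019)) (l 449337))) (l 449588))) (n (n (n (n (l 464777) 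
(n (n (n (n (l 460504) (n (n (l 460079) (n (n (n (l 459444) (n (n (n (n (l 457743) (n (n (l 454162) 
(n (n (n (n (l 448964) (n (n (l 435153) (n (n (n (n (l 372347) (n (n (n (n (l 311030) (n d 
(l 185641))) (l 311030)) (l 372347)) (l 372347))) (l 420144)) (l 420144)) (l 420144))) (l 448964))) (l 448964)) 
(l 454162)) (l 454162))) (l 457743))) (l 457743)) (l 459444)) (l 459444))) (l 460079)) (l 460079))) (l 460333))) 
(n (n (l 460300) (n (n (n (n (l 459402) (n (n (n (n (l 457691) (n (n (l 454130) (n (n (n (n (l 445650) 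
(n (n (l 437775) (n (n (n (n (l 390047) (n (n (n (l 335115) (n (n (l 185641) d) (l 335115))) (l 335115)) 
(l 390047))) (l 390047)) (l 421734)) (l 421734))) (l 445650))) (l 445650)) (l 454130)) (l 454130))) (l 457691))) 
(l 457691)) (l 459402)) (l 459402))) (l 460046)) (l 460046)) (l 460046))) (l 460504))) (n (n (n (n (l 448991) 
(n (n (l 428957) (n (n (n (n (l 372490) (n (n (l 274946) (n (n d (l 274946)) (l 274946))) (l 372490))) 
(l 372490)) (l 428957)) (l 428957))) (l 448991))) (l 448991)) (l 460588)) (l 460588))) (l 464777))) (n (n (n (n (l 460983) 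
(n (n (n (n (l 451971) (n (n (l 435288) (n (n (n (n (l 409491) (n (n (l 338959) (n (n (n (l 189477) 
d) (l 338959)) (l 338959))) (l 409491))) (l 409491)) (l 435288)) (l 435288))) (l 451971))) (l 451971)) (l 460983)) 
(l 460983))) (n (n (l 462435) (n (n (n (l 461676) (n (n (n (n (l 458541) (n (n (l 452496) (n (n (n (n (l 452496) 
(n (n (l 415507) (n (n (n (l 374998) (n (n (n (l 313680) (n d (l 189477))) (l 313680)) (l 374998))) 
(l 374998)) (l 415507))) (l 438574))) (l 452496)) (l 452496)) (l 452496))) (l 458541))) (l 458541)) (l 461676)) 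
(l 461676))) (l 462435)) (l 462435))) (l 462874))) (n (n (n (l 462336) (n (n (l 462336) (n (n (n (n (l 458201) 
(n (n (l 450406) (n (n (n (n (l 432855) (n (n (l 432855) (n (n (n (l 365896) (n (n (l 273684) 
(n d (l 273684))) (l 273684))) (l 365896)) (l 432855))) (l 432855))) (l 432855)) (l 450406)) (l 450406))) 
(l 458201))) (l 458201)) (l 462336)) (l 462336))) (l 462336))) (l 462336)) (l 463162))) (l 463304))) (l 468262)) 
(l 468558))) (l 470099))) (n (n (n (n (l 443497) (n (n (n (n (l 438218) (n (n (l 434791) (n (n (n (n (l 429493) 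
(n (n (l 415008) (n (n (n (l 384308) (n (n (n (n (l 278155) (n (n d (l 278155)) (l 278155))) (l 345393)) 
(l 345393)) (l 345393))) (l 415008)) (l 415008))) (l 429493))) (l 429493)) (l 434791)) (l 434791))) (l 438218))) 
(n (n (n (n (l 435531) (n (n (n (n (l 431465) (n (n (l 413717) (n (n (n (l 413717) (n (n (n (n (l 312908) 
(n (n (n (l 160062) d) (l 312908)) (l 312908))) (l 383151)) (l 383151)) (l 383151))) (l 413717)) (l 413717))) 
(l 424516))) (l 431465)) (l 435531)) (l 435531))) (l 437400)) (n (n (n (n (l 436894) (n (n (n (l 436555) 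
(n (n (n (n (l 435482) (n (n (l 430701) (n (n (n (l 426890) (n (n (n (n (l 413390) (n (n (n (l 369971) 
(n (n (l 369971) (n (n (n d (l 160062)) (l 284554)) (l 284554))) (l 369971))) (l 369971)) (l 413390))) 
(l 413390)) (l 419594)) (l 419594))) (l 430701)) (l 430701))) (l 433633))) (l 435482)) (l 436555)) (l 436555))) 
(l 436894)) (l 436894))) (l 437113)) (l 437283)) (l 437283))) (l 437400))) (n (n (n (n (l 436147) (n (n (n (l 435456) 
(n (n (l 434542) (n (n (n (n (l 433711) (n (n (l 427649) (n (n (n (l 417417) (n (n (n (n (l 393024) 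
(n (n (l 368874) (n (n (n (n (l 274199) (n d (l 274199))) (l 274199)) (l 368874)) (l 368874))) (l 393024))) 
(l 393024)) (l 417417)) (l 417417))) (l 427649)) (l 427649))) (l 431301))) (l 433711)) (l 434542)) (l 434542))) 
(l 435456))) (n (n (n (n (l 434534) (n (n (n (n (l 433634) (n (n (l 429067) (n (n (n (l 422246) 
(n (n (n (n (l 403966) (n (n (l 365492) (n (n (n (n (l 309644) (n (n (l 161257) d) (l 309644))) 
(l 309644)) (l 365492)) (l 365492))) (l 403966))) (l 403966)) (l 422246)) (l 422246))) (l 429067)) (l 429067))) 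
(l 431793))) (l 433634)) (l 434534)) (l 434534))) (l 435236)) (l 435236)) (l 435236))) (l 436147))) (n (n (n (n (l 429871) 
(n (n (l 403088) (n (n (n (l 355188) (n (n (n (n (l 287759) (n d (l 161745))) (l 287759)) (l 355188)) 
(l 355188))) (l 403088)) (l 403088))) (l 418142))) (l 429871)) (l 436147)) (l 436147))) (l 440850)) (l 440850))) 
(l 442406))) (n (n (l 442691) (n (n (n (n (l 436286) (n (n (n (n (l 436286) (n (n (l 405200) 
(n (n (n (l 373379) (n (n (n (l 317172) (n (n (l 162098) d) (l 317172))) (l 317172)) (l 373379))) 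
(l 373379)) (l 405200))) (l 421281))) (l 436286)) (l 436286)) (l 436286))) (n (n (n (n (l 439421) (n (n (l 438180) 
(n (n (n (n (l 438180) (n (n (l 430583) (n (n (n (l 422263) (n (n (n (l 409670) (n (n (l 345247) 
(n (n (n (l 277966) (n (n d (l 277966)) (l 277966))) (l 345247)) (l 345247))) (l 384162))) (l 409670)) 
(l 422263))) (l 422263)) (l 430583))) (l 435320))) (l 438180)) (l 438180)) (l 438180))) (l 439421))) (l 439421)) 
(n (n (n (l 438447) (n (n (n (n (l 438447) (n (n (l 427599) (n (n (n (l 418234) (n (n (n (l 393351) 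
(n (n (l 353341) (n (n (n (l 285853) (n d (l 162098))) (l 285853)) (l 353341))) (l 353341))) (l 393351)) 
(l 418234))) (l 418234)) (l 427599))) (l 433448))) (l 438447)) (l 438447)) (l 438447))) (l 440065)) (l 440065))) 
(l 440554))) (l 441083)) (l 441286))) (l 444124))) (n (n (n (n (l 377163) (n (n (n (l 282054) (n (n (l 281761) 
(n (n (n (l 280462) (n (n (n (n (l 277689) (n (n (l 273807) (n (n (n (l 268461) (n (n (l 257474) 
(n (n (n (n (l 193863) (n (n (n (l 126399) (n d (l 1))) (l 126399)) (l 193863))) (l 193863)) (l 234457)) 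
(l 234457))) (l 268461))) (l 268461)) (l 273807))) (l 273807))) (l 277689)) (l 280462)) (l 280462))) (l 281761)) 
(l 281761))) (l 281761))) (n d (l 282054))) (l 282210))) (n (n (n (n (l 376868) (n (n (n (n (l 376169) 
(n (n (n (l 375416) (n (n (n (n (l 374051) (n (n (l 371829) (n (n (n (l 367784) (n (n (l 356680) 
(n (n (n (l 333237) (n (n (n (n (l 309160) (n (n (n d (l 94953)) (l 220813)) (l 220813))) (l 309160)) 
(l 309160)) (l 309160))) (l 356680)) (l 356680))) (l 367784))) (l 367784)) (l 371829))) (l 371829))) (l 374051)) 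
(l 375416)) (l 375416))) (l 376169)) (l 376169))) (l 376298)) (n (n (n (n (l 375320) (n (n (n (n (l 373545) 
(n (n (l 370648) (n (n (n (l 367543) (n (n (l 345069) (n (n (n (l 306595) (n (n (n (n (l 250610) 
(n (n (l 94953) d) (l 250610))) (l 250610)) (l 306595)) (l 306595))) (l 345069)) (l 345069))) (l 358635))) 
(l 367543)) (l 370648))) (l 370648))) (l 373545)) (l 375320)) (l 375320))) (l 376302)) (l 376302)) (l 376302))) 
(l 376747))) (l 376868)) (n (n (n (n (l 375758) (n (n (l 374157) (n (n (n (n (l 370552) (n (n (l 370552) 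
(n (n (n (l 356800) (n (n (l 337862) (n (n (n (l 281654) (n (n (l 281654) (n (n d (l 281654)) 
(l 281654))) (l 281654))) (l 281654)) (l 337862))) (l 337862))) (l 356800)) (l 370552))) (l 370552))) (l 370552)) 
(l 374157)) (l 374157))) (l 375758))) (n (n (n (n (l 374370) (n (n (n (n (l 371620) (n (n (l 368362) 
(n (n (n (l 359690) (n (n (l 345775) (n (n (n (l 320134) (n (n (l 249881) (n (n (n (l 94103) 
d) (l 249881)) (l 249881))) (l 320134))) (l 320134)) (l 345775))) (l 345775))) (l 359690)) (l 368362))) (l 368362))) 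
(l 371620)) (l 374370)) (l 374370))) (l 375540)) (l 375540)) (l 375540))) (l 376968)) (l 376968))) (l 377130))) 
(l 444683)) (l 444911))) (l 476407))) (l 482469)) (l 498366))) (l 505991))) (n (n (n (n (l 368658) (n (n (n (n (l 360066) 
(n (n (n (l 358512) (n (n (n (n (l 358046) (n (n (n (n (l 355991) (n (n (n (l 353189) (n (n (n (n (l 349432) 
(n (n (n (n (l 314233) (n (n (n (l 263210) (n (n (n (n (l 194794) d) (l 194794)) (l 194794)) (l 194794))) 
(l 314233)) (l 314233))) (l 338736)) (l 338736)) (l 338736))) (l 349432)) (l 349432)) (l 349432))) (l 355991)) 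
(l 355991))) (l 357337)) (n (n (n (l 357114) (n (n (l 356505) (n (n (n (l 355217) (n (n (n (n (l 353895) 
(n (n (n (n (l 336918) (n (n (n (l 306664) (n (n (n (n (l 251838) (n (n (l 162542) (n d (l 162542))) 
(l 162542))) (l 251838)) (l 306664)) (l 306664))) (l 336918)) (l 336918))) (l 342132)) (l 349044)) (l 349044))) 
(l 353895)) (l 353895)) (l 353895))) (l 356505)) (l 356505))) (l 357114))) (l 357114)) (l 357337))) (l 357337))) 
(l 358046)) (n (n (n (l 357833) (n (n (n (l 357543) (n (n (l 356749) (n (n (n (l 355915) (n (n (n (n (l 350999) 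
(n (n (n (n (l 333912) (n (n (n (l 333912) (n (n (l 252296) (n (n (n (l 163000) (n d (l 163000))) 
(l 163000)) (l 252296))) (l 303165))) (l 333912)) (l 333912))) (l 333912)) (l 344816)) (l 344816))) (l 353625)) 
(l 353625)) (l 353625))) (l 356749)) (l 356749))) (l 357543))) (n (n (n (n (l 356669) (n (n (n (l 355675) 
(n (n (n (n (l 351658) (n (n (n (n (l 341651) (n (n (n (l 318278) (n (n (l 289256) (n (n (n (l 194542) 
(n (n (l 194542) d) (l 194542))) (l 194542)) (l 289256))) (l 289256))) (l 318278)) (l 341651))) (l 341651)) 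
(l 347037)) (l 347037))) (l 353917)) (l 353917)) (l 353917))) (l 356669)) (l 356669))) (l 357277)) (l 357277)) 
(l 357277))) (l 357833))) (l 357833)) (l 358121))) (l 358211))) (n (n (n (n (l 357492) (n (n (l 354517) 
(n (n (n (l 348212) (n (n (n (n (l 326411) (n (n (n (n (l 269284) (n (n (l 163529) (n (n d 
(l 163529)) (l 163529))) (l 269284))) (l 269284)) (l 326411)) (l 326411))) (l 340220)) (l 340220)) (l 340220))) 
(l 354517)) (l 354517))) (l 357492))) (n (n (n (n (l 354021) (n (n (n (l 349069) (n (n (n (n (l 332038) 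
(n (n (n (n (l 306265) (n (n (l 193758) (n (n (n (l 193758) d) (l 193758)) (l 193758))) (l 262213))) 
(l 306265)) (l 332038)) (l 332038))) (l 343884)) (l 343884)) (l 343884))) (l 354021)) (l 354021))) (l 356297)) 
(n (n (n (l 355921) (n (n (l 354889) (n (n (n (l 352602) (n (n (n (n (l 343809) (n (n (n (n (l 326375) 
(n (n (l 305718) (n (n (n (l 250747) (n (n (l 162539) (n d (l 162539))) (l 162539))) (l 250747)) 
(l 305718))) (l 305718))) (l 326375)) (l 343809)) (l 343809))) (l 351220)) (l 351220)) (l 351220))) (l 354889)) 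
(l 354889))) (l 355921))) (l 355921)) (l 356297))) (l 356297))) (l 358580)) (l 358707))) (l 359793))) (n (n (n (n (l 327959) 
(n (n (n (n (l 327081) (n (n (l 323435) (n (n (n (l 323435) (n (n (n (n (l 302732) (n (n (n (l 271341) 
(n (n (n (n (l 163380) (n (n d (l 163380)) (l 163380))) (l 238468)) (l 238468)) (l 238468))) (l 302732)) 
(l 302732))) (l 317158)) (l 317158)) (l 317158))) (l 323435)) (l 323435))) (l 325653))) (n (n (n (n (l 323485) 
(n (n (n (l 323485) (n (n (n (n (l 301692) (n (n (n (l 301692) (n (n (n (n (l 163542) (n (n (n (l 163542) 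
d) (l 163542)) (l 163542))) (l 232030)) (l 275892)) (l 275892))) (l 301692)) (l 301692))) (l 312496)) (l 319415)) 
(l 319415))) (l 323485)) (l 323485))) (l 325189)) (n (n (n (l 325991) (n (n (l 324728) (n (n (n (l 324728) 
(n (n (n (n (l 315523) (n (n (n (l 309107) (n (n (n (n (l 275576) (n (n (n (l 251351) (n (n (l 162738) 
(n d (l 162738))) (l 162738))) (l 251351)) (l 275576))) (l 275576)) (l 296239)) (l 296239))) (l 315523)) 
(l 315523))) (l 320573)) (l 323716)) (l 323716))) (l 324728)) (l 324728))) (l 325501))) (l 325991)) (l 326281))) 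
(l 326281))) (l 327916)) (l 327959))) (l 328611)) (n (n (n (n (l 304096) (n (n (n (n (l 299612) (n (n (n (l 296775) 
(n (n (n (n (l 280137) (n (n (n (l 260514) (n (n (l 209088) (n (n (n (n (l 140601) d) (l 140601)) 
(l 140601)) (l 140601))) (l 260514))) (l 260514)) (l 280137))) (l 280137)) (l 291175)) (l 291175))) (l 299612)) 
(l 299612))) (n (n (n (n (l 301667) (n (n (l 300685) (n (n (n (l 299902) (n (n (n (n (l 297130) 
(n (n (n (l 288213) (n (n (l 288213) (n (n (n (n (l 212229) (n (n (n (l 161286) (n (n d (l 161286)) 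
(l 161286))) (l 212229)) (l 212229))) (l 245102)) (l 270670)) (l 270670))) (l 288213))) (l 288213)) (l 297130))) 
(l 297130)) (l 298404)) (l 298404))) (l 300685)) (l 300685))) (l 301287))) (l 301667)) (l 301887)) (l 301887))) 
(l 303377)) (l 303377))) (n (n (n (n (l 163226) (n d (l 163226))) (l 163226)) (n (n (n (l 252999) 
(n (n (n (n (l 251547) (n (n (n (l 250535) (n (n (n (n (l 245245) (n (n (n (l 241423) (n (n (l 227445) 
(n (n (n (l 201772) (n (n (l 89772) (n (n (n (l 89772) d) (l 89772)) (l 89772))) (l 158260))) (l 201772)) 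
(l 227445))) (l 227445))) (l 241423)) (l 245245))) (l 245245)) (l 248505)) (l 248505))) (l 251547)) (l 251547))) 
(l 252343)) (l 252839)) (l 252839))) (l 252999)) (l 252999))) (l 253121))) (l 328401)) (l 328446))) (l 348033))) 
(n (n (n (n (l 330743) (n (n (n (n (l 290853) (n (n (l 290694) (n (n (n (l 290523) (n (n (l 289289) 
(n (n (n (l 287176) (n (n (n (n (l 284102) (n (n (l 275555) (n (n (n (n (l 240049) (n (n (n (n (l 185275) 
(n (n (l 95842) (n d (l 95842))) (l 95842))) (l 185275)) (l 240049)) (l 240049))) (l 270340)) (l 270340)) 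
(l 270340))) (l 284102))) (l 284102)) (l 287176)) (l 287176))) (l 289289)) (l 289289))) (l 290034))) (l 290523)) 
(l 290694))) (l 290694))) (n (n (n (n (l 194823) (n (n (l 194823) d) (l 194823))) (l 194823)) (n (n (n (n (l 290495) 
(n (n (l 289250) (n (n (n (l 287148) (n (n (n (n (l 282138) (n (n (l 277179) (n (n (n (n (l 257735) 
(n (n (n (l 201420) (n (n (l 95842) (n (n d (l 95842)) (l 95842))) (l 201420))) (l 201420)) (l 257735))) 
(l 257735)) (l 277179)) (l 277179))) (l 282138))) (l 282138)) (l 287148)) (l 287148))) (l 289250)) (l 289250))) 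
(l 290000))) (l 290495)) (l 290665)) (l 290665))) (l 290853))) (n (n (n (n (l 330015) (n (n (n (n (l 329830) 
(n (n (l 328892) (n (n (n (l 327492) (n (n (n (n (l 323737) (n (n (l 315836) (n (n (n (n (l 304366) 
(n (n (l 273891) (n (n (n (n (l 135303) (n (n d (l 135303)) (l 135303))) (l 240772)) (l 240772)) 
(l 240772))) (l 304366))) (l 304366)) (l 315836)) (l 315836))) (l 323737))) (l 323737)) (l 327492)) (l 327492))) 
(l 328892)) (l 328892))) (l 329452))) (l 329830)) (l 330015)) (l 330015))) (n (n (n (l 329846) (n (n (l 328243) 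
(n (n (n (l 326568) (n (n (n (n (l 319651) (n (n (l 306311) (n (n (n (n (l 306311) (n (n (l 224691) 
(n (n (n (l 135303) (n d (l 135303))) (l 135303)) (l 224691))) (l 275592))) (l 306311)) (l 306311)) 
(l 306311))) (l 319651))) (l 319651)) (l 326568)) (l 326568))) (l 328243)) (l 328243))) (l 329211))) (l 329846)) 
(l 330159))) (l 330159)) (l 330366))) (l 330671))) (n (n (n (n (l 342901) (n (n (n (l 337269) (n (n (l 337269) 
(n (n (n (n (l 336154) (n (n (n (l 335406) (n (n (n (n (l 333038) (n (n (l 322488) (n (n (n (l 314080) 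
(n (n (n (n (l 284291) (n (n (n (l 188481) (n (n (l 188481) d) (l 188481))) (l 188481)) (l 284291))) 
(l 284291)) (l 297980)) (l 297980))) (l 322488)) (l 322488))) (l 328957))) (l 333038)) (l 335406)) (l 335406))) 
(l 336154)) (l 336154))) (l 336636)) (l 337012)) (l 337012))) (l 337269))) (n (n (n (l 327432) (n (n (n (n (l 313584) 
(n (n (l 254484) (n (n (n (l 148787) (n (n d (l 148787)) (l 148787))) (l 254484)) (l 254484))) (l 287703))) 
(l 313584)) (l 327432)) (l 327432))) (l 337269)) (l 337269))) (l 340492))) (n (n (l 342635) (n (n (n (l 342186) 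
(n (n (l 340284) (n (n (n (l 336713) (n (n (n (n (l 336713) (n (n (l 312775) (n (n (n (l 292111) 
(n (n (n (l 237204) (n (n (l 148918) (n d (l 148918))) (l 148918))) (l 237204)) (l 292111))) (l 292111)) 
(l 312775))) (l 325683))) (l 336713)) (l 336713)) (l 336713))) (l 340284)) (l 340284))) (l 341362))) (l 342186)) 
(l 342635))) (l 342635))) (n (n (n (n (l 343813) (n (n (n (l 343468) (n (n (l 342822) (n (n (n (l 339955) 
(n (n (n (n (l 333837) (n (n (l 325271) (n (n (n (l 313475) (n (n (l 289231) (n (n (n (n (l 148866) 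
(n d (l 148866))) (l 148866)) (l 238441)) (l 238441))) (l 313475))) (l 313475)) (l 325271))) (l 325271))) 
(l 333837)) (l 339955)) (l 339955))) (l 342822)) (l 342822))) (l 342822))) (l 343468)) (l 343813))) (n (n (n (n (l 343740) 
(n (n (n (n (l 342808) (n (n (n (l 341147) (n (n (n (n (l 338136) (n (n (l 333232) (n (n (n (l 324307) 
(n (n (l 299804) (n (n (n (l 248074) (n (n (n (n (l 194946) d) (l 194946)) (l 194946)) (l 194946))) 
(l 299804)) (l 299804))) (l 324307))) (l 324307)) (l 333232))) (l 333232))) (l 338136)) (l 341147)) (l 341147))) 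
(l 342808)) (l 342808))) (l 343094)) (l 343474)) (l 343474))) (l 343740)) (l 343740)) (l 343740))) (l 344091)) 
(l 344091))) (l 344464))) (l 354484)) (l 354586))) (l 368312))) (n (n d (n (n (n (n (l 199854) (n (n (n (n (l 199626) 
(n (n (l 193241) (n (n (n (l 186706) (n (n (n (l 175162) (n (n (l 143314) (n (n (n (n (l 1) 
(n (n d (l 1)) (l 1))) (l 110023)) (l 110023)) (l 110023))) (l 175162))) (l 175162)) (l 186706))) (l 186706)) 
(l 193241))) (l 196544))) (n (n (l 199355) (n (n (n (l 199355) (n (n (l 197164) (n (n (n (l 194876) 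
(n (n (n (l 188887) (n (n (l 182398) (n (n (n (n (l 148778) (n (n (n (l 89603) (n (n (l 1) 
(n d (l 1))) (l 1))) (l 89603)) (l 148778))) (l 148778)) (l 169473)) (l 169473))) (l 188887))) (l 188887)) 
(l 194876))) (l 194876)) (l 197164))) (l 198314))) (l 199355)) (l 199355))) (l 199355))) (n (n (n (n (l 199300) 
(n (n (n (l 199300) (n (n (l 197906) (n (n (n (l 196099) (n (n (n (l 191177) (n (n (l 180773) 
(n (n (n (n (l 162116) (n (n (l 140450) (n (n (n (n (l 1) (n d (l 1))) (l 1)) (l 89603)) (l 89603))) 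
(l 162116))) (l 162116)) (l 180773)) (l 180773))) (l 191177))) (l 191177)) (l 196099))) (l 196099)) (l 197906))) 
(l 198494))) (l 199300)) (l 199300))) (l 199300)) (l 199508)) (l 199508))) (l 199854))) (n (n (n (n (l 200426) 
(n (n (n (n (l 199920) (n (n (n (l 199920) (n (n (l 198722) (n (n (n (l 197411) (n (n (n (l 195017) 
(n (n (l 188471) (n (n (n (l 181586) (n (n (n (n (l 141018) (n (n (n (n (l 1) (n d (l 1))) (l 1)) 
(l 89991)) (l 89991))) (l 162683)) (l 162683)) (l 162683))) (l 188471)) (l 188471))) (l 195017))) (l 195017)) 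
(l 197411))) (l 197411)) (l 198722))) (l 199469))) (l 199920)) (l 199920))) (l 199920)) (n (n (n (n (l 200080) 
(n (n (l 198520) (n (n (n (l 196811) (n (n (n (l 194225) (n (n (l 180994) (n (n (n (l 167176) 
(n (n (n (n (l 110088) (n (n (l 1) (n (n d (l 1)) (l 1))) (l 110088))) (l 110088)) (l 167176)) (l 167176))) 
(l 180994)) (l 180994))) (l 188986))) (l 194225)) (l 196811))) (l 196811)) (l 198520))) (l 199493))) (l 200080)) 
(l 200080)) (l 200080))) (l 200335))) (n (n (l 189734) (n (n (n (l 178799) (n (n (n (l 178799) (n (n (l 90246) 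
(n (n (n (l 1) (n d (l 1))) (l 1)) (l 90246))) (l 141273))) (l 178799)) (l 178799))) (l 178799)) (l 189734))) 
(l 195917))) (n (n (n (l 200264) (n (n (n (n (l 200264) (n (n (l 198036) (n (n (n (l 196113) 
(n (n (n (l 191003) (n (n (l 182786) (n (n (n (l 168925) (n (n (l 110218) (n (n (n (l 1) (n (n d 
(l 1)) (l 1))) (l 110218)) (l 110218))) (l 143509))) (l 168925)) (l 182786))) (l 182786))) (l 191003)) (l 196113))) 
(l 196113)) (l 198036))) (l 199238))) (l 200264)) (l 200264)) (l 200264))) (l 200597)) (l 200597))) (l 200697))) 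
(l 200957)) (l 202324))) (l 368373))) (n (n (n (n (l 446762) (n (n (n (n (l 425025) (n (n (n (l 421437) 
(n (n (n (n (l 418678) (n (n (n (l 415582) (n (n (l 407470) (n (n (n (n (l 396666) (n (n (n (n (l 260410) 
(n (n (n (l 172836) d) (l 260410)) (l 260410))) (l 330644)) (l 374485)) (l 374485))) (l 396666)) (l 396666)) 
(l 396666))) (l 415582))) (l 415582)) (l 418678))) (l 418678)) (n (n (n (l 419846) (n (n (l 419066) 
(n (n (n (l 417663) (n (n (l 414812) (n (n (n (n (l 403274) (n (n (n (n (l 371055) (n (n (n (l 305510) 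
(n (n (l 247583) (n d (l 247583))) (l 247583))) (l 305510)) (l 371055))) (l 371055)) (l 391601)) (l 391601))) 
(l 409762)) (l 409762)) (l 409762))) (l 417663))) (l 417663)) (l 419066))) (l 419066))) (l 419846)) (l 420419))) 
(l 420419))) (n (n (n (n (l 418607) (n (n (n (l 418054) (n (n (l 417454) (n (n (n (l 416385) 
(n (n (l 413868) (n (n (n (n (l 399832) (n (n (n (n (l 377404) (n (n (l 353137) (n (n (n (n (l 245712) 
(n d (l 245712))) (l 245712)) (l 303639)) (l 303639))) (l 377404))) (l 377404)) (l 399832)) (l 399832))) 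
(l 410225)) (l 410225)) (l 410225))) (l 416385))) (l 416385)) (l 417454))) (l 417454))) (n (n (n (n (l 417353) 
(n (n (n (l 416547) (n (n (l 414352) (n (n (n (n (l 404711) (n (n (n (n (l 386326) (n (n (l 348060) 
(n (n (n (n (l 256954) (n (n (l 172342) d) (l 256954))) (l 256954)) (l 348060)) (l 348060))) (l 386326))) 
(l 386326)) (l 404711)) (l 404711))) (l 411626)) (l 411626)) (l 411626))) (l 416547))) (l 416547)) (l 417353))) 
(l 417353)) (l 417819)) (l 417819))) (l 418607))) (n (n (n (l 413375) (n (n (l 398942) (n (n (n (n (l 333994) 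
(n (n (n (n (l 333994) (n d (l 172779))) (l 333994)) (l 333994)) (l 333994))) (l 383855)) (l 383855)) 
(l 383855))) (l 413375))) (l 413375)) (l 418607))) (l 418834)) (l 421796))) (l 423628))) (n (n (n (n (l 424325) 
(n (n (n (n (l 424023) (n (n (n (l 423680) (n (n (l 423254) (n (n (n (l 421863) (n (n (l 421863) 
(n (n (n (n (l 412472) (n (n (n (l 401801) (n (n (n (n (l 358641) (n (n (n (n (l 251123) (n d 
(l 251123))) (l 251123)) (l 308991)) (l 308991))) (l 382907)) (l 382907)) (l 382907))) (l 412472)) (l 412472))) 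
(l 419007)) (l 419007)) (l 419007))) (l 421863))) (l 421863)) (l 423254))) (l 423254))) (l 423680)) (l 424023))) 
(l 424023)) (n (n (n (l 423979) (n (n (n (n (l 423541) (n (n (n (l 422134) (n (n (l 422134) 
(n (n (n (n (l 410148) (n (n (n (l 402112) (n (n (n (n (l 376668) (n (n (l 263323) (n (n (n (l 172978) 
d) (l 263323)) (l 263323))) (l 332827))) (l 376668)) (l 402112)) (l 402112))) (l 410148)) (l 410148))) (l 415334)) 
(l 419367)) (l 419367))) (l 422134))) (l 422134)) (l 423541))) (l 423541)) (l 423742)) (l 423742))) (l 424102)) 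
(l 424102))) (l 424197))) (l 424358)) (n (n (n (n (l 419649) (n (n (n (l 411136) (n (n (l 402727) 
(n (n (n (n (l 354622) (n (n (n (l 263157) (n (n (l 172812) d) (l 263157))) (l 263157)) (l 354622))) 
(l 354622)) (l 386643)) (l 386643))) (l 411136))) (l 411136)) (l 419649))) (n (n (n (n (l 418086) (n (n (l 417289) 
(n (n (n (l 416191) (n (n (l 413934) (n (n (n (n (l 400870) (n (n (n (l 387015) (n (n (l 361055) 
(n (n (n (l 245843) (n (n d (l 245843)) (l 245843))) (l 361055)) (l 361055))) (l 361055))) (l 387015)) 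
(l 400870))) (l 400870)) (l 409207)) (l 409207))) (l 416191))) (l 416191)) (l 417289))) (l 417289))) (l 418086)) 
(n (n (n (l 417618) (n (n (n (l 414904) (n (n (l 411964) (n (n (n (n (l 396728) (n (n (n (l 369910) 
(n (n (l 329303) (n (n (n (l 329303) (n d (l 172812))) (l 329303)) (l 329303))) (l 329303))) (l 369910)) 
(l 396728))) (l 396728)) (l 406106)) (l 406106))) (l 414904))) (l 414904)) (l 417618))) (l 417618)) (l 418656))) 
(l 419177))) (l 422896)) (l 422896))) (l 425175))) (n (n (n (n (l 366337) (n (n (n (n (l 363219) (n (n (n (l 356816) 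
(n (n (l 343214) (n (n (n (n (l 323564) (n (n (l 275705) (n (n (n (n (l 115142) d) (l 205462)) 
(l 205462)) (l 205462))) (l 323564))) (l 323564)) (l 343214)) (l 343214))) (l 356816))) (l 356816)) (l 363219))) 
(n (n (l 362587) (n (n (n (l 361769) (n (n (n (l 359538) (n (n (l 354823) (n (n (n (n (l 346368) 
(n (n (l 336549) (n (n (n (n (l 272899) (n (n (n (l 272899) (n d (l 115142))) (l 272899)) (l 272899))) 
(l 272899)) (l 313506)) (l 313506))) (l 346368))) (l 346368)) (l 354823)) (l 354823))) (l 359538))) (l 359538)) 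
(l 361769))) (l 361769)) (l 362587))) (l 362854))) (n (n (n (l 364815) (n (n (l 363776) (n (n (n (l 360689) 
(n (n (l 360689) (n (n (n (n (l 345222) (n (n (l 316071) (n (n (n (n (l 250428) (n (n (l 250428) 
(n d (l 250428))) (l 250428))) (l 250428)) (l 316071)) (l 316071))) (l 345222))) (l 345222)) (l 360689)) 
(l 360689))) (l 360689))) (l 360689)) (l 363776))) (l 363776))) (l 364815)) (l 365571))) (l 365571))) (n (n (n (n (l 251633) 
(n (n (l 251472) (n (n (n (n (l 250843) (n (n (n (l 249018) (n (n (l 245597) (n (n (n (n (l 242492) 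
(n (n (l 219818) (n (n (n (l 181552) (n (n (n (n (l 90320) (n (n (l 1) d) (l 90320))) (l 90320)) 
(l 181552)) (l 181552))) (l 219818)) (l 219818))) (l 233479))) (l 242492)) (l 245597)) (l 245597))) (l 249018))) 
(l 249018)) (l 250843))) (l 250843)) (l 251472)) (l 251472))) (l 251633))) (l 251633)) (n (n d (l 251796)) 
(l 251796))) (l 366938))) (l 367298)) (l 425225))) (l 427105))) (n (n (n (n (l 422840) (n (n (n (n (l 396180) 
(n (n (n (l 395846) (n (n (n (n (l 395023) (n (n (l 394567) (n (n (n (l 393736) (n (n (l 391455) 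
(n (n (n (l 386641) (n (n (n (n (l 381696) (n (n (n (n (l 318202) (n (n (n (l 205051) (n (n d 
(l 205051)) (l 205051))) (l 318202)) (l 318202))) (l 337703)) (l 363551)) (l 363551))) (l 381696)) (l 381696)) 
(l 381696))) (l 391455)) (l 391455))) (l 393736))) (l 393736)) (l 394567))) (l 394567))) (l 395023)) (n (n (n (l 394709) 
(n (n (n (l 393624) (n (n (l 390658) (n (n (n (l 387538) (n (n (n (n (l 369153) (n (n (n (n (l 305245) 
(n (n (n (l 305245) (n d (l 190252))) (l 305245)) (l 305245))) (l 305245)) (l 346028)) (l 346028))) 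
(l 378971)) (l 378971)) (l 378971))) (l 390658)) (l 390658))) (l 393624))) (l 393624)) (l 394709))) (l 394709)) 
(l 395303))) (l 395642))) (n (n (n (l 395525) (n (n (l 394761) (n (n (n (l 393353) (n (n (l 389495) 
(n (n (n (l 380941) (n (n (n (n (l 348054) (n (n (n (n (l 282850) (n (n (l 205594) (n d (l 205594))) 
(l 205594))) (l 282850)) (l 348054)) (l 348054))) (l 375773)) (l 375773)) (l 375773))) (l 389495)) (l 389495))) 
(l 393353))) (l 393353)) (l 394761))) (l 394761))) (l 395525)) (l 396001))) (l 396001))) (n (n (n (n (l 280990) 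
(n (n (n (l 280829) (n (n (l 280239) (n (n (n (l 279157) (n (n (l 274432) (n (n (n (l 274432) 
(n (n (n (n (l 240006) (n (n (n (l 216009) (n (n (n (n (l 90600) (n d (l 90600))) (l 90600)) (l 167883)) 
(l 167883))) (l 240006)) (l 240006))) (l 258890)) (l 270646)) (l 270646))) (l 274432)) (l 274432))) (l 277321))) 
(l 279157)) (l 280239))) (l 280239))) (l 280829)) (l 280990))) (l 280990)) (n (n (n (l 190527) d) (l 281128)) 
(l 281128))) (l 352002))) (n (n (n (n (l 395937) (n (n (n (n (l 394865) (n (n (l 394270) (n (n (n (l 393632) 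
(n (n (l 389017) (n (n (n (l 381115) (n (n (n (n (l 369617) (n (n (l 337649) (n (n (n (n (l 204857) 
(n (n d (l 204857)) (l 204857))) (l 318148)) (l 318148)) (l 318148))) (l 369617))) (l 369617)) (l 381115)) 
(l 381115))) (l 389017)) (l 389017))) (l 391803))) (l 393632)) (l 394270))) (l 394270))) (l 394865)) (n (n (n (l 394455) 
(n (n (n (l 393283) (n (n (l 387287) (n (n (n (l 381025) (n (n (n (n (l 355154) (n (n (l 305263) 
(n (n (n (n (l 305263) (n d (l 190372))) (l 305263)) (l 305263)) (l 305263))) (l 355154))) (l 355154)) 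
(l 381025)) (l 381025))) (l 387287)) (l 387287))) (l 390909))) (l 393283)) (l 394455))) (l 394455)) (l 395230))) 
(l 395671))) (n (n (n (l 395309) (n (n (l 394313) (n (n (n (l 392634) (n (n (l 385520) (n (n (n (l 372165) 
(n (n (n (n (l 372165) (n (n (l 282638) (n (n (n (l 205354) (n d (l 205354))) (l 205354)) (l 282638))) 
(l 330915))) (l 372165)) (l 372165)) (l 372165))) (l 385520)) (l 385520))) (l 389554))) (l 392634)) (l 394313))) 
(l 394313))) (n (n (n (n (l 394093) (n (n (n (l 392803) (n (n (l 390387) (n (n (n (l 379664) 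
(n (n (n (n (l 356783) (n (n (l 324747) (n (n (n (l 280628) (n (n (l 189954) d) (l 280628))) (l 280628)) 
(l 324747))) (l 324747))) (l 356783)) (l 379664)) (l 379664))) (l 390387)) (l 390387))) (l 390387))) (l 392803)) 
(l 394093))) (l 394093)) (l 394869)) (l 394869))) (l 396138))) (l 396138)) (l 396473))) (l 422576))) (n (n (l 417886) 
(n (n (n (n (l 412343) (n (n (n (l 411488) (n (n (l 410478) (n (n (n (l 410478) (n (n (l 402283) 
(n (n (n (l 393724) (n (n (n (l 371324) (n (n (l 347058) (n (n (n (n (l 221317) (n d (l 221317))) 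
(l 221317)) (l 298717)) (l 298717))) (l 371324))) (l 371324)) (l 393724))) (l 393724)) (l 402283))) (l 406583))) 
(l 410478)) (l 410478))) (l 410478))) (n (n (n (n (l 410272) (n (n (n (l 410272) (n (n (l 405055) 
(n (n (n (l 398300) (n (n (n (l 379892) (n (n (l 340979) (n (n (n (n (l 271200) (n (n (l 190171) 
d) (l 271200))) (l 271200)) (l 340979)) (l 340979))) (l 379892))) (l 379892)) (l 398300))) (l 398300)) (l 405055))) 
(l 407256))) (l 410272)) (l 410272))) (l 410272)) (l 411048)) (l 411048))) (l 412343))) (n (n (n (n (l 412073) 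
(n (n (n (n (l 411135) (n (n (n (l 411135) (n (n (l 406653) (n (n (n (l 401750) (n (n (n (l 392799) 
(n (n (l 368314) (n (n (n (l 342565) (n (n (n (n (l 190839) d) (l 271868)) (l 271868)) (l 271868))) 
(l 368314)) (l 368314))) (l 392799))) (l 392799)) (l 401750))) (l 401750)) (l 406653))) (l 409447))) (l 411135)) 
(l 411135))) (l 411135)) (l 411734)) (l 411734))) (n (n (l 372087) (n (n (n (l 331188) (n (n (n (l 331188) 
(n d (l 190839))) (l 331188)) (l 331188))) (l 331188)) (l 372087))) (l 395211))) (l 412218)) (l 412218))) 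
(l 412784)) (l 417740))) (l 420895))) (n (n (n (n (l 431804) (n (n (n (n (l 430993) (n (n (n (l 430263) 
(n (n (l 429762) (n (n (n (l 427617) (n (n (l 424700) (n (n (n (l 419455) (n (n (l 408790) 
(n (n (n (n (l 365639) (n (n (n (n (l 245139) (n d (l 245139))) (l 245139)) (l 321983)) (l 321983))) 
(l 389906)) (l 389906)) (l 389906))) (l 419455))) (l 419455)) (l 424700))) (l 424700))) (l 427617)) (l 429762))) 
(l 429762))) (n (n (n (n (l 429549) (n (n (n (l 427914) (n (n (l 425669) (n (n (n (l 421671) 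
(n (n (l 412259) (n (n (n (n (l 359762) (n (n (n (n (l 275880) (n (n (l 185123) d) (l 275880))) 
(l 275880)) (l 359762)) (l 359762))) (l 398632)) (l 398632)) (l 398632))) (l 421671))) (l 421671)) (l 425669))) 
(l 425669))) (l 427914)) (l 429549))) (l 429549)) (l 429934)) (l 429934))) (l 430993))) (n (n (n (n (l 430772) 
(n (n (n (n (l 430223) (n (n (n (l 428939) (n (n (l 427345) (n (n (n (l 422144) (n (n (l 422144) 
(n (n (n (n (l 387022) (n (n (n (l 347111) (n (n (n (n (l 185691) d) (l 276448)) (l 276448)) (l 276448))) 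
(l 387022)) (l 387022))) (l 411461)) (l 411461)) (l 411461))) (l 422144))) (l 422144)) (l 427345))) (l 427345))) 
(l 428939)) (l 430223))) (l 430223)) (l 430518)) (l 430518))) (l 430896)) (l 430896)) (l 430896))) (n (n (n (n (l 430634) 
(n (n (l 430634) (n (n (n (l 427810) (n (n (l 423920) (n (n (n (l 412377) (n (n (l 412377) 
(n (n (n (n (l 354531) (n (n (l 245505) (n (n d (l 245505)) (l 245505))) (l 354531))) (l 354531)) 
(l 412377)) (l 412377))) (l 412377))) (l 412377)) (l 423920))) (l 423920))) (l 427810)) (l 430634))) (l 430634))) 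
(l 430634)) (l 431375)) (l 431375))) (l 431703))) (n (n (n (n (l 425590) (n (n (n (n (l 423856) (n (n (l 423187) 
(n (n (n (l 421406) (n (n (l 418548) (n (n (n (l 413282) (n (n (l 398854) (n (n (n (l 366861) 
(n (n (n (n (l 243864) (n (n d (l 243864)) (l 243864))) (l 347534)) (l 347534)) (l 347534))) (l 398854)) 
(l 398854))) (l 413282))) (l 413282)) (l 418548))) (l 418548))) (l 421406)) (l 423187))) (l 423187))) (n (n (n (n (l 423022) 
(n (n (n (l 422419) (n (n (l 420214) (n (n (n (l 416164) (n (n (l 398495) (n (n (n (l 398495) 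
(n (n (n (n (l 269739) (n (n (n (l 179992) d) (l 269739)) (l 269739))) (l 340367)) (l 384334)) (l 384334))) 
(l 398495)) (l 398495))) (l 409300))) (l 416164)) (l 420214))) (l 420214))) (l 422419)) (l 423022))) (l 423022)) 
(l 423536)) (l 423536))) (n (n (n (l 423709) (n (n (n (l 421393) (n (n (l 417669) (n (n (n (l 411388) 
(n (n (l 384782) (n (n (n (l 334833) (n (n (n (n (l 334833) (n d (l 180557))) (l 334833)) (l 334833)) 
(l 334833))) (l 384782)) (l 384782))) (l 399870))) (l 411388)) (l 417669))) (l 417669))) (l 421393)) (l 423709))) 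
(l 423709)) (l 424581))) (l 425125))) (n (n (l 425682) (n (n (n (n (l 424264) (n (n (n (l 421768) 
(n (n (l 417989) (n (n (n (l 417989) (n (n (l 387339) (n (n (n (l 355328) (n (n (n (l 271554) 
(n (n (l 180797) d) (l 271554))) (l 271554)) (l 355328))) (l 355328)) (l 387339))) (l 403424))) (l 417989)) 
(l 417989))) (l 417989))) (l 421768)) (l 424264))) (l 424264)) (l 425137)) (l 425137))) (l 425956))) (n (n (n (n (l 408140) 
(n (n (n (n (l 407096) (n (n (n (l 404972) (n (n (l 403096) (n (n (n (l 395074) (n (n (l 384167) 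
(n (n (n (l 364548) (n (n (l 324661) (n (n (n (n (l 163276) d) (l 254033)) (l 254033)) (l 254033))) 
(l 364548))) (l 364548)) (l 384167))) (l 384167))) (l 395074)) (l 403096))) (l 403096))) (l 404972)) (l 407096))) 
(l 407096)) (l 407762)) (l 407762))) (n (n (l 387728) (n (n (n (l 322201) (n (n (l 245073) (n d 
(l 245073))) (l 245073))) (l 322201)) (l 387728))) (l 387728))) (l 408350)) (l 425871))) (l 426379))) (l 432362)) 
(l 437189))) (l 437586))) (l 465560)) (l 467581))) (l 552822))) (n (n (n (n (l 366189) (n (n (n (n (l 349168) 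
(n (n (n (l 346657) (n (n (n (n (l 344140) (n (n (n (l 342737) (n (n (l 339061) (n (n (n (n (l 334165) 
(n (n (n (n (l 272416) (n (n (n (l 232728) (n (n (n d (l 1)) (l 154402)) (l 154402))) (l 272416)) 
(l 272416))) (l 304245)) (l 324113)) (l 324113))) (l 334165)) (l 334165)) (l 334165))) (l 342737))) (l 342737)) 
(l 344140))) (l 344140)) (n (n (n (n (l 342841) (n (n (l 338386) (n (n (n (n (l 323442) (n (n (n (n (l 279834) 
(n (n (n (l 190267) (n (n (l 1) d) (l 190267))) (l 190267)) (l 279834))) (l 279834)) (l 312725)) (l 312725))) 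
(l 331848)) (l 331848)) (l 331848))) (l 342841))) (n (n (l 342487) (n (n (n (l 341852) (n (n (l 340559) 
(n (n (n (n (l 335331) (n (n (n (n (l 320730) (n (n (n (l 291025) (n (n (l 264774) (n (n (n (l 152573) 
(n d (l 1))) (l 152573)) (l 264774))) (l 264774))) (l 291025)) (l 320730))) (l 320730)) (l 330041)) (l 330041))) 
(l 338271)) (l 338271)) (l 338271))) (l 341852))) (l 341852)) (l 342487))) (l 342487))) (l 344669)) (l 344929))) 
(l 346195))) (n (n (n (n (l 343996) (n (n (n (n (l 342354) (n (n (l 339077) (n (n (n (n (l 320810) 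
(n (n (n (n (l 301343) (n (n (l 255512) (n (n (n (n (l 1) d) (l 189455)) (l 189455)) (l 189455))) 
(l 301343))) (l 301343)) (l 320810)) (l 320810))) (l 334355)) (l 334355)) (l 334355))) (l 342354))) (n (n (l 342082) 
(n (n (n (l 341597) (n (n (l 340457) (n (n (n (n (l 334096) (n (n (n (n (l 323932) (n (n (l 312934) 
(n (n (n (n (l 264251) (n (n (n (l 152898) (n d (l 1))) (l 152898)) (l 264251))) (l 264251)) (l 290503)) 
(l 290503))) (l 323932))) (l 323932)) (l 334096)) (l 334096))) (l 338805)) (l 338805)) (l 338805))) (l 341597))) 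
(l 341597)) (l 342082))) (l 342082))) (n (n (n (n (l 343428) (n (n (n (l 343062) (n (n (l 342068) 
(n (n (n (n (l 337699) (n (n (n (n (l 329367) (n (n (l 312025) (n (n (n (n (l 270737) (n (n (l 232392) 
(n (n (n d (l 1)) (l 154289)) (l 154289))) (l 270737))) (l 270737)) (l 312025)) (l 312025))) (l 329367))) 
(l 329367)) (l 337699)) (l 337699))) (l 340832)) (l 340832)) (l 340832))) (l 343062))) (l 343062)) (l 343428))) 
(l 343428)) (l 343639)) (l 343639))) (l 343996))) (n (n (n (n (l 342277) (n (n (l 342021) (n (n (n (n (l 341650) 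
(n (n (l 340662) (n (n (n (n (l 336172) (n (n (n (n (l 331788) (n (n (l 309553) (n (n (n (l 276342) 
(n (n (n (n (l 187335) (n (n (l 1) d) (l 187335))) (l 187335)) (l 276342)) (l 276342))) (l 309553)) 
(l 309553))) (l 322824))) (l 331788)) (l 336172)) (l 336172))) (l 339589)) (l 339589)) (l 339589))) (l 341650))) 
(l 341650)) (l 342021)) (l 342021))) (l 342277))) (n (n (l 335736) (n (n (n (n (l 306303) (n (n (n (n (l 306303) 
(n (n (l 154941) (n (n d (l 1)) (l 154941))) (l 233242))) (l 306303)) (l 306303)) (l 306303))) (l 328899)) 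
(l 328899)) (l 328899))) (l 342277))) (n (n (n (l 342065) (n (n (n (n (l 341580) (n (n (l 340232) 
(n (n (n (n (l 334631) (n (n (n (n (l 325990) (n (n (l 311882) (n (n (n (l 296763) (n (n (l 187335) 
(n (n (n (l 1) d) (l 187335)) (l 187335))) (l 253392))) (l 296763)) (l 311882))) (l 311882))) (l 325990)) 
(l 334631)) (l 334631))) (l 339410)) (l 339410)) (l 339410))) (l 341580))) (l 341580)) (l 342065)) (l 342065))) 
(l 342399)) (l 342399))) (l 344887))) (l 345113)) (l 346482))) (l 348498))) (n (n (n (n (l 333609) (n (n (n (n (l 333472) 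
(n (n (n (l 333317) (n (n (l 333124) (n (n (n (l 332494) (n (n (l 332494) (n (n (n (n (l 328238) 
(n (n (n (l 323402) (n (n (n (n (l 303842) (n (n (n (n (l 255117) (n (n (n (l 141311) (n d 
(l 1))) (l 141311)) (l 255117))) (l 255117)) (l 281342)) (l 281342))) (l 314839)) (l 314839)) (l 314839))) 
(l 328238)) (l 328238))) (l 331199)) (l 331199)) (l 331199))) (l 332494))) (l 332494)) (l 333124))) (l 333124))) 
(l 333317)) (l 333472))) (l 333472)) (n (n (n (n (l 192140) (n (n (n (l 1) d) (l 192140)) (l 192140))) 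
(n (n (n (n (l 258597) (n (n (n (l 257959) (n (n (l 257959) (n (n (n (n (l 252527) (n (n (n (l 248885) 
(n (n (n (n (l 237355) (n (n (l 185988) (n (n (n (l 145045) (n (n (n d (l 1)) (l 66654)) (l 66654))) 
(l 185988)) (l 185988))) (l 217486))) (l 237355)) (l 248885)) (l 248885))) (l 252527)) (l 252527))) (l 254877)) 
(l 256705)) (l 256705))) (l 257959))) (l 257959)) (l 258597))) (l 258597)) (l 258688)) (l 258688))) (l 302774)) 
(l 302774))) (l 333551))) (l 333624)) (n (n (n (n (l 346408) (n (n (n (n (l 342231) (n (n (l 341976) 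
(n (n (n (n (l 341370) (n (n (l 340807) (n (n (n (n (l 337395) (n (n (n (l 333468) (n (n (l 322782) 
(n (n (n (n (l 275839) (n (n (n (n (l 186320) (n (n (l 1) d) (l 186320))) (l 186320)) (l 275839)) 
(l 275839))) (l 309510)) (l 309510)) (l 309510))) (l 333468))) (l 333468)) (l 337395))) (l 337395)) (l 339660)) 
(l 339660))) (l 341370))) (l 341370)) (l 341976)) (l 341976))) (l 342231))) (n (n (l 338420) (n (n (n (n (l 316620) 
(n (n (n (l 275169) (n (n (l 234226) (n (n (n d (l 1)) (l 155910)) (l 155910))) (l 275169))) (l 275169)) 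
(l 316620))) (l 316620)) (l 331131)) (l 331131))) (l 342231))) (n (n (n (l 342022) (n (n (n (n (l 341231) 
(n (n (l 340449) (n (n (n (n (l 337382) (n (n (n (l 328498) (n (n (l 311843) (n (n (n (n (l 296723) 
(n (n (l 186320) (n (n (n (l 1) d) (l 186320)) (l 186320))) (l 252834))) (l 296723)) (l 311843)) (l 311843))) 
(l 328498))) (l 328498)) (l 337382))) (l 337382)) (l 340449)) (l 340449))) (l 341231))) (l 341231)) (l 342022)) 
(l 342022))) (l 342353)) (l 342353))) (l 346329))) (n (n (n (n (l 345456) (n (n (l 345095) (n (n (n (l 344597) 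
(n (n (l 343575) (n (n (n (n (l 337654) (n (n (n (l 331375) (n (n (l 319611) (n (n (n (l 267398) 
(n (n (n (n (l 155986) (n d (l 1))) (l 155986)) (l 267398)) (l 267398))) (l 319611)) (l 319611))) (l 319611))) 
(l 331375)) (l 337654))) (l 337654)) (l 341433)) (l 341433))) (l 344597))) (l 344597)) (l 345095))) (l 345095))) 
(n (n (l 345017) (n (n (n (n (l 344231) (n (n (l 343317) (n (n (n (n (l 337393) (n (n (n (l 337393) 
(n (n (l 311993) (n (n (n (l 279104) (n (n (n (l 189470) (n (n (l 1) d) (l 189470))) (l 189470)) 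
(l 279104))) (l 279104)) (l 311993))) (l 322710))) (l 337393)) (l 337393))) (l 337393)) (l 341172)) (l 341172))) 
(l 344231))) (l 344231)) (l 345017)) (l 345017))) (l 345456))) (n (n (n (n (l 344790) (n (n (n (n (l 344063) 
(n (n (l 343277) (n (n (n (n (l 339796) (n (n (n (l 331836) (n (n (l 320905) (n (n (n (l 301437) 
(n (n (l 255611) (n (n (n (n (l 1) d) (l 189258)) (l 189258)) (l 189258))) (l 301437))) (l 301437)) 
(l 320905))) (l 320905))) (l 331836)) (l 339796))) (l 339796)) (l 341673)) (l 341673))) (l 344063))) (l 344063)) 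
(l 344790)) (l 344790))) (n (n (n (l 343896) (n (n (l 342564) (n (n (n (n (l 335659) (n (n (n (l 323506) 
(n (n (l 305103) (n (n (n (l 305103) (n (n (l 155868) (n (n d (l 1)) (l 155868))) (l 234184))) (l 305103)) 
(l 305103))) (l 305103))) (l 323506)) (l 335659))) (l 335659)) (l 339909)) (l 339909))) (l 343896))) (l 343896)) 
(l 345126))) (l 345126)) (l 345596))) (l 346240))) (l 347952)) (l 348063))) (l 349183))) (n (n (n (n (l 327806) 
(n (n (n (n (l 324905) (n (n (n (l 321856) (n (n (l 315691) (n (n (n (n (l 306786) (n (n (l 285097) 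
(n (n (n (n (l 212333) (n (n (n d (l 1)) (l 160152)) (l 160152))) (l 253264)) (l 253264)) (l 253264))) 
(l 306786))) (l 306786)) (l 315691)) (l 315691))) (l 321856))) (n (n (n (l 321635) (n (n (n (n (l 321042) 
(n (n (l 319796) (n (n (n (n (l 317987) (n (n (l 313179) (n (n (n (n (l 291317) (n (n (n (n (l 269972) 
(n (n (l 161703) (n (n (n (l 1) d) (l 161703)) (l 161703))) (l 226325))) (l 269972)) (l 291317)) (l 291317))) 
(l 307954)) (l 307954)) (l 307954))) (l 317987))) (l 317987)) (l 319796)) (l 319796))) (l 321042))) (l 321042)) 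
(l 321635)) (l 321635))) (l 321856)) (l 321856))) (l 324846))) (n (n (l 324548) (n (n (n (n (l 323865) 
(n (n (n (n (l 323269) (n (n (l 322029) (n (n (n (n (l 319077) (n (n (l 316336) (n (n (n (n (l 299722) 
(n (n (n (l 280601) (n (n (l 228569) (n (n (n (n (l 1) d) (l 163948)) (l 163948)) (l 163948))) (l 280601))) 
(l 280601)) (l 299722))) (l 299722)) (l 310753)) (l 310753))) (l 319077))) (l 319077)) (l 322029)) (l 322029))) 
(l 323269))) (l 323269)) (l 323865)) (l 323865))) (n (n (n (l 323078) (n (n (l 320941) (n (n (n (n (l 317109) 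
(n (n (l 312660) (n (n (n (n (l 283814) (n (n (n (l 283814) (n (n (l 160140) (n (n d (l 1)) 
(l 160140))) (l 212321))) (l 283814)) (l 283814))) (l 283814)) (l 302217)) (l 302217))) (l 317109))) (l 317109)) 
(l 320941)) (l 320941))) (l 323078))) (l 323078)) (l 324089))) (l 324089)) (l 324460))) (l 324740))) (n (n (n (n (l 321621) 
(n (n (l 314648) (n (n (n (n (l 294991) (n (n (l 261037) (n (n (n (n (l 165329) (n (n (l 1) 
d) (l 165329))) (l 165329)) (l 261037)) (l 261037))) (l 294991))) (l 294991)) (l 314648)) (l 314648))) (l 321621))) 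
(n (n (l 321150) (n (n (n (l 319751) (n (n (l 319751) (n (n (n (n (l 312742) (n (n (l 299531) 
(n (n (n (n (l 269783) (n (n (l 269783) (n (n (n (l 156292) (n d (l 1))) (l 156292)) (l 269783))) 
(l 269783))) (l 269783)) (l 299531)) (l 299531))) (l 312742))) (l 312742)) (l 319751)) (l 319751))) (l 319751))) 
(l 319751)) (l 321150))) (l 321150))) (l 325658)) (l 326000))) (l 327459))) (n (n (n (n (l 274503) (n (n (n (n (l 271293) 
(n (n (l 265486) (n (n (n (n (l 256506) (n (n (l 231954) (n (n (n (l 179920) (n (n (n (n (l 1) 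
d) (l 113963)) (l 113963)) (l 113963))) (l 231954)) (l 231954))) (l 256506))) (l 256506)) (l 265486)) (l 265486))) 
(l 271293))) (l 271293)) (n (n (n (n (l 274145) (n (n (n (l 273318) (n (n (l 271768) (n (n (n (n (l 270361) 
(n (n (l 260085) (n (n (n (l 242744) (n (n (n (n (l 201398) (n (n (l 160467) (n (n (n d (l 1)) 
(l 160467)) (l 160467))) (l 201398))) (l 201398)) (l 242744)) (l 242744))) (l 260085)) (l 260085))) (l 266276))) 
(l 270361)) (l 271768)) (l 271768))) (l 273318))) (l 273318)) (l 274145))) (l 274145)) (l 274430)) (l 274430))) 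
(l 274503))) (n (n (l 275009) (n (n (n (l 274744) (n (n (n (n (l 273653) (n (n (l 271549) (n (n (n (n (l 271549) 
(n (n (l 258673) (n (n (n (l 244572) (n (n (n (l 223227) (n (n (l 114036) (n (n (n (l 1) d) 
(l 114036)) (l 114036))) (l 179993))) (l 223227)) (l 244572))) (l 244572)) (l 258673))) (l 266703))) (l 271549)) 
(l 271549)) (l 271549))) (l 273653))) (l 273653)) (l 274744)) (l 274744))) (l 275009)) (l 275009))) (l 275161))) 
(n (n (n (n (l 160938) (n d (l 1))) (n (n (l 160938) (n (n (n (n (l 159498) (n (n (l 156785) 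
(n (n (n (n (l 150675) (n (n (l 150675) (n (n (n (l 127367) (n (n (l 95268) (n (n (n (l 2) 
(n (n (l 1) d) (l 1))) (l 2)) (l 95268))) (l 95268))) (l 127367)) (l 150675))) (l 150675))) (l 150675)) (l 156785)) 
(l 156785))) (l 159498))) (l 159498)) (l 160938)) (l 160938))) (l 160938))) (l 275048)) (l 275335))) (l 327565))) 
(l 329454)) (l 355809))) (l 357197))) (n (n (n (n (l 346005) (n (n (n (n (l 332085) (n (n (n (l 330741) 
(n (n (n (n (l 330368) (n (n (l 330161) (n (n (n (l 329785) (n (n (l 328751) (n (n (n (l 326569) 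
(n (n (n (n (l 324328) (n (n (n (n (l 295554) (n (n (n (l 244275) (n (n (n (n (l 151349) (n d 
(l 1))) (l 151349)) (l 244275)) (l 244275))) (l 295554)) (l 295554))) (l 304391)) (l 316106)) (l 316106))) 
(l 324328)) (l 324328)) (l 324328))) (l 328751)) (l 328751))) (l 329785))) (l 329785)) (l 330161))) (l 330161))) 
(l 330368)) (n (n (n (l 330226) (n (n (n (l 329734) (n (n (l 328390) (n (n (n (l 326976) (n (n (n (n (l 318644) 
(n (n (n (n (l 289682) (n (n (n (l 289682) (n (n (l 151349) (n (n d (l 1)) (l 151349))) (l 237569))) 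
(l 289682)) (l 289682))) (l 289682)) (l 308164)) (l 308164))) (l 323094)) (l 323094)) (l 323094))) (l 328390)) 
(l 328390))) (l 329734))) (l 329734)) (l 330226))) (l 330226)) (l 330495))) (l 330648))) (n (n (n (n (l 328751) 
(n (n (l 323709) (n (n (n (l 313022) (n (n (n (n (l 276071) (n (n (n (n (l 179246) (n (n (l 1) 
d) (l 179246))) (l 179246)) (l 276071)) (l 276071))) (l 299476)) (l 299476)) (l 299476))) (l 323709)) (l 323709))) 
(l 328751))) (n (n (l 328405) (n (n (n (l 327767) (n (n (l 326018) (n (n (n (l 322142) (n (n (n (n (l 307238) 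
(n (n (n (n (l 277689) (n (n (l 242677) (n (n (n (l 149505) (n d (l 1))) (l 149505)) (l 242677))) 
(l 242677))) (l 277689)) (l 307238)) (l 307238))) (l 319800)) (l 319800)) (l 319800))) (l 326018)) (l 326018))) 
(l 327767))) (l 327767)) (l 328405))) (l 328405))) (l 330595)) (l 330811))) (l 332004))) (n (n (n (n (l 278948) 
(n (n (n (n (l 277459) (n (n (l 271281) (n (n (n (l 271281) (n (n (n (n (l 236190) (n (n (n (l 182985) 
(n (n (n (n (l 1) d) (l 127267)) (l 127267)) (l 127267))) (l 236190)) (l 236190))) (l 260641)) (l 260641)) 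
(l 260641))) (l 271281)) (l 271281))) (l 275040))) (n (n (l 277192) (n (n (n (l 276701) (n (n (l 274560) 
(n (n (n (l 274560) (n (n (n (n (l 258959) (n (n (n (l 248084) (n (n (n (n (l 191250) (n (n (n (l 150191) 
(n d (l 1))) (l 150191)) (l 191250))) (l 191250)) (l 226274)) (l 226274))) (l 258959)) (l 258959))) (l 267517)) 
(l 272844)) (l 272844))) (l 274560)) (l 274560))) (l 275870))) (l 276701)) (l 277192))) (l 277192))) (l 278875)) 
(l 278948))) (l 279598)) (n (n (n (n (l 238425) (n (n (n (l 238307) (n (n (n (n (l 237934) (n (n (l 236270) 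
(n (n (n (l 234943) (n (n (n (n (l 230244) (n (n (n (l 215130) (n (n (l 215130) (n (n (n (n (l 86344) 
(n (n (n (l 1) d) (l 86344)) (l 86344))) (l 142061)) (l 185396)) (l 185396))) (l 215130))) (l 215130)) 
(l 230244))) (l 230244)) (l 232403)) (l 232403))) (l 236270)) (l 236270))) (l 237290))) (l 237934)) (l 238307)) 
(l 238307))) (l 238425)) (l 238425))) (n (n (n d (l 1)) (l 152157)) (l 152157))) (l 279620)) (l 279620))) 
(l 311780))) (n (n (n (n (l 331254) (n (n (n (n (l 330528) (n (n (l 330258) (n (n (n (l 329969) 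
(n (n (l 327877) (n (n (n (l 324297) (n (n (n (n (l 319086) (n (n (l 304598) (n (n (n (n (l 244419) 
(n (n (n (n (l 151581) (n d (l 1))) (l 151581)) (l 244419)) (l 244419))) (l 295761)) (l 295761)) (l 295761))) 
(l 319086))) (l 319086)) (l 324297)) (l 324297))) (l 327877)) (l 327877))) (l 329140))) (l 329969)) (l 330258))) 
(l 330258))) (n (n (l 330209) (n (n (n (n (l 329920) (n (n (l 327810) (n (n (n (l 324249) (n (n (n (n (l 315757) 
(n (n (l 307351) (n (n (n (n (l 274395) (n (n (n (l 178947) (n (n (l 1) d) (l 178947))) (l 178947)) 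
(l 274395))) (l 274395)) (l 307351)) (l 307351))) (l 315757))) (l 315757)) (l 324249)) (l 324249))) (l 327810)) 
(l 327810))) (l 329082))) (l 329920)) (l 330209)) (l 330209))) (l 330528))) (n (n (n (n (l 330021) (n (n (n (n (l 329708) 
(n (n (l 328118) (n (n (n (l 325744) (n (n (n (n (l 319381) (n (n (l 305988) (n (n (n (n (l 286547) 
(n (n (l 234894) (n (n (n (n (l 1) d) (l 178761)) (l 178761)) (l 178761))) (l 286547))) (l 286547)) 
(l 305988)) (l 305988))) (l 319381))) (l 319381)) (l 325744)) (l 325744))) (l 328118)) (l 328118))) (l 329067))) 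
(l 329708)) (l 330021)) (l 330021))) (n (n (n (l 329734) (n (n (l 327017) (n (n (n (l 324179) (n (n (n (n (l 312455) 
(n (n (l 289845) (n (n (n (n (l 289845) (n (n (l 151504) (n (n d (l 1)) (l 151504))) (l 237778))) 
(l 289845)) (l 289845)) (l 289845))) (l 312455))) (l 312455)) (l 324179)) (l 324179))) (l 327017)) (l 327017))) 
(l 328658))) (l 329734)) (l 330265))) (l 330265)) (l 330616))) (l 331133))) (n (n (n (n (l 328785) (n (n (l 319462) 
(n (n (n (l 302788) (n (n (n (n (l 279316) (n (n (l 179148) (n (n (n (l 1) d) (l 179148)) (l 179148))) 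
(l 235451))) (l 279316)) (l 302788)) (l 302788))) (l 319462)) (l 319462))) (l 324702))) (n (n (l 328334) 
(n (n (n (l 327572) (n (n (l 324349) (n (n (n (l 318296) (n (n (n (n (l 318296) (n (n (l 277724) 
(n (n (n (l 242700) (n (n (n (l 149637) (n d (l 1))) (l 149637)) (l 242700))) (l 242700)) (l 277724))) 
(l 299602))) (l 318296)) (l 318296)) (l 318296))) (l 324349)) (l 324349))) (l 326177))) (l 327572)) (l 328334))) 
(l 328334))) (n (n (n (n (l 330418) (n (n (n (l 329834) (n (n (l 328739) (n (n (n (l 323879) 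
(n (n (n (n (l 313510) (n (n (l 298992) (n (n (n (l 278998) (n (n (l 237906) (n (n (n d (l 1)) 
(l 151821)) (l 151821))) (l 278998))) (l 278998)) (l 298992))) (l 298992))) (l 313510)) (l 323879)) (l 323879))) 
(l 328739)) (l 328739))) (l 328739))) (l 329834)) (l 330418))) (l 330418)) (l 330770)) (l 330770))) (l 331345))) 
(l 332982)) (l 333134))) (l 345505))) (n (n (l 343479) (n (n (n (n (l 338738) (n (n (n (n (l 338350) 
(n (n (l 327529) (n (n (n (l 316452) (n (n (n (l 296887) (n (n (l 242906) (n (n (n (n (l 1) 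
d) (l 186480)) (l 186480)) (l 186480))) (l 296887))) (l 296887)) (l 316452))) (l 316452)) (l 327529))) (l 333127))) 
(n (n (l 337892) (n (n (n (l 337892) (n (n (l 334178) (n (n (n (l 330300) (n (n (n (l 320148) 
(n (n (l 309151) (n (n (n (n (l 252167) (n (n (n (l 151870) (n d (l 1))) (l 151870)) (l 252167))) 
(l 252167)) (l 287244)) (l 287244))) (l 320148))) (l 320148)) (l 330300))) (l 330300)) (l 334178))) (l 336127))) 
(l 337892)) (l 337892))) (l 337892))) (n (n (n (n (l 337799) (n (n (n (l 337799) (n (n (l 335435) 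
(n (n (n (l 332374) (n (n (n (l 324031) (n (n (l 306396) (n (n (n (n (l 274774) (n (n (l 238053) 
(n (n (n d (l 1)) (l 151870)) (l 151870))) (l 274774))) (l 274774)) (l 306396)) (l 306396))) (l 324031))) 
(l 324031)) (l 332374))) (l 332374)) (l 335435))) (l 336432))) (l 337799)) (l 337799))) (l 337799)) (l 338151)) 
(l 338151))) (l 338738))) (n (n (n (n (l 339707) (n (n (n (n (l 338849) (n (n (n (l 338849) (n (n (l 336818) 
(n (n (n (l 334596) (n (n (n (l 330540) (n (n (l 319443) (n (n (n (l 307774) (n (n (n (n (l 239014) 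
(n (n (n d (l 1)) (l 152529)) (l 152529))) (l 275735)) (l 275735)) (l 275735))) (l 319443)) (l 319443))) 
(l 330540))) (l 330540)) (l 334596))) (l 334596)) (l 336818))) (l 338084))) (l 338849)) (l 338849))) (l 338849)) 
(n (n (n (n (l 339121) (n (n (l 336476) (n (n (n (l 333580) (n (n (n (l 329197) (n (n (l 306771) 
(n (n (n (l 283351) (n (n (n (n (l 186591) (n (n (l 1) d) (l 186591))) (l 186591)) (l 283351)) (l 283351))) 
(l 306771)) (l 306771))) (l 320317))) (l 329197)) (l 333580))) (l 333580)) (l 336476))) (l 338125))) (l 339121)) 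
(l 339121)) (l 339121))) (l 339553))) (n (n (l 321585) (n (n (n (l 303051) (n (n (n (l 303051) (n (n (l 152961) 
(n (n d (l 1)) (l 152961))) (l 239446))) (l 303051)) (l 303051))) (l 303051)) (l 321585))) (l 332065))) 
(n (n (n (l 339433) (n (n (n (n (l 339433) (n (n (l 335657) (n (n (n (l 332397) (n (n (n (l 323735) 
(n (n (l 309808) (n (n (n (l 286315) (n (n (l 186811) (n (n (n (l 1) d) (l 186811)) (l 186811))) 
(l 243237))) (l 286315)) (l 309808))) (l 309808))) (l 323735)) (l 332397))) (l 332397)) (l 335657))) (l 337693))) 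
(l 339433)) (l 339433)) (l 339433))) (l 339996)) (l 339996))) (l 340166))) (l 340607)) (l 342924))) (l 345341))) 
(n (n (n (n (l 326977) (n (n (n (n (l 293501) (n (n (n (l 293171) (n (n (l 292944) (n (n (n (l 291972) 
(n (n (l 290650) (n (n (n (l 288273) (n (n (l 283440) (n (n (n (n (l 263884) (n (n (n (n (l 209276) 
(n (n (n (l 98182) (n d (l 1))) (l 98182)) (l 209276))) (l 209276)) (l 244100)) (l 244100))) (l 274881)) 
(l 274881)) (l 274881))) (l 288273))) (l 288273)) (l 290650))) (l 290650))) (l 291972)) (l 292944))) (l 292944))) 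
(n (n (n (n (l 292847) (n (n (n (l 292106) (n (n (l 291089) (n (n (n (l 289277) (n (n (l 285012) 
(n (n (n (n (l 261221) (n (n (n (n (l 223207) (n (n (l 182077) (n (n (n d (l 1)) (l 98182)) (l 98182))) 
(l 223207))) (l 223207)) (l 261221)) (l 261221))) (l 278836)) (l 278836)) (l 278836))) (l 289277))) (l 289277)) 
(l 291089))) (l 291089))) (l 292106)) (l 292847))) (l 292847)) (l 293022)) (l 293022))) (l 293501))) (n (n (n (n (l 293300) 
(n (n (n (n (l 293051) (n (n (n (l 292469) (n (n (l 291747) (n (n (n (l 289390) (n (n (l 289390) 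
(n (n (n (n (l 273473) (n (n (n (l 255386) (n (n (n (n (l 182233) (n (n (n d (l 1)) (l 98080)) 
(l 98080))) (l 223362)) (l 223362)) (l 223362))) (l 273473)) (l 273473))) (l 284548)) (l 284548)) (l 284548))) 
(l 289390))) (l 289390)) (l 291747))) (l 291747))) (l 292469)) (l 293051))) (l 293051)) (l 293185)) (l 293185))) 
(l 293356)) (n (n (n (l 292904) (n (n (n (n (l 291938) (n (n (l 290587) (n (n (n (l 288726) 
(n (n (l 284902) (n (n (n (n (l 262759) (n (n (n (l 239275) (n (n (l 195275) (n (n (n (l 1) 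
d) (l 195275)) (l 195275))) (l 195275))) (l 239275)) (l 262759))) (l 262759)) (l 276889)) (l 276889))) (l 288726))) 
(l 288726)) (l 290587))) (l 290587))) (l 291938)) (l 292904)) (l 292904))) (l 293356)) (l 293356))) (l 293356))) 
(n (n (n (n (l 195157) (n (n (l 195157) (n (n (n (l 193877) (n (n (l 192114) (n (n (n (l 186883) 
(n (n (l 186883) (n (n (n (n (l 160668) (n (n (l 111259) (n (n (n (n (l 1) (n d (l 1))) (l 2)) 
(l 111259)) (l 111259))) (l 160668))) (l 160668)) (l 186883)) (l 186883))) (l 186883))) (l 186883)) (l 192114))) 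
(l 192114))) (l 193877)) (l 195157))) (l 195157))) (n (n (l 1) d) (l 195157))) (l 195492)) (l 293674))) 
(l 293878))) (n (n (n (n (l 324058) (n (n (n (n (l 323028) (n (n (n (l 322463) (n (n (n (n (l 321988) 
(n (n (l 321214) (n (n (n (l 319806) (n (n (l 315941) (n (n (n (l 307781) (n (n (n (n (l 299399) 
(n (n (n (n (l 191782) (n (n (n (l 1) d) (l 191782)) (l 191782))) (l 224835)) (l 268646)) (l 268646))) 
(l 299399)) (l 299399)) (l 299399))) (l 315941)) (l 315941))) (l 319806))) (l 319806)) (l 321214))) (l 321214))) 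
(l 321988)) (l 322463)) (l 322463))) (n (n (n (l 321918) (n (n (l 320623) (n (n (n (l 318236) (n (n (l 311698) 
(n (n (n (l 297199) (n (n (n (n (l 241459) (n (n (n (n (l 130943) (n d (l 1))) (l 130943)) (l 241459)) 
(l 241459))) (l 288440)) (l 288440)) (l 288440))) (l 311698)) (l 311698))) (l 318236))) (l 318236)) (l 320623))) 
(l 320623))) (l 321918)) (l 322725))) (l 322725))) (n (n (n (n (l 322695) (n (n (n (l 322422) (n (n (l 321423) 
(n (n (n (l 319587) (n (n (l 311580) (n (n (n (l 311580) (n (n (n (n (l 253230) (n (n (n (l 212558) 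
(n (n (n d (l 1)) (l 130988)) (l 130988))) (l 253230)) (l 253230))) (l 285238)) (l 305163)) (l 305163))) 
(l 311580)) (l 311580))) (l 316477))) (l 319587)) (l 321423))) (l 321423))) (l 322422)) (l 322695))) (l 322695)) 
(l 322928)) (l 322928))) (n (n (n (n (l 322666) (n (n (n (n (l 322049) (n (n (l 321040) (n (n (n (l 319959) 
(n (n (l 312136) (n (n (n (l 298743) (n (n (n (n (l 279255) (n (n (l 225071) (n (n (n (n (l 1) 
d) (l 192018)) (l 192018)) (l 192018))) (l 279255))) (l 279255)) (l 298743)) (l 298743))) (l 312136)) (l 312136))) 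
(l 316858))) (l 319959)) (l 321040))) (l 321040))) (l 322049)) (l 322666)) (l 322666))) (n (n (n (l 321958) 
(n (n (l 320271) (n (n (n (l 317424) (n (n (l 305367) (n (n (n (l 282731) (n (n (n (n (l 282731) 
(n (n (l 130989) (n (n d (l 1)) (l 130989))) (l 212815))) (l 282731)) (l 282731)) (l 282731))) (l 305367)) 
(l 305367))) (l 312204))) (l 317424)) (l 320271))) (l 320271))) (l 321958)) (l 323008))) (l 323008)) (l 323403))) 
(l 323805))) (n (n (l 324099) (n (n (n (n (l 323457) (n (n (n (l 322326) (n (n (l 320613) (n (n (n (l 320613) 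
(n (n (l 306723) (n (n (n (l 292216) (n (n (n (l 254251) (n (n (l 213121) (n (n (n d (l 1)) 
(l 131186)) (l 131186))) (l 254251))) (l 254251)) (l 292216))) (l 292216)) (l 306723))) (l 314012))) (l 320613)) 
(l 320613))) (l 320613))) (l 322326)) (l 323457))) (l 323457)) (l 323852)) (l 323852))) (l 324223))) (n (n (n (n (l 315763) 
(n (n (n (n (l 314733) (n (n (n (l 313770) (n (n (l 312920) (n (n (n (l 309285) (n (n (l 304341) 
(n (n (n (l 295450) (n (n (l 277374) (n (n (n (n (l 204237) (n (n (n d (l 1)) (l 130243)) (l 130243))) 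
(l 245367)) (l 245367)) (l 245367))) (l 295450))) (l 295450)) (l 304341))) (l 304341))) (l 309285)) (l 312920))) 
(l 312920))) (l 313770)) (l 314733))) (l 314733)) (n (n (n (n (l 313780) (n (n (l 313780) (n (n (n (l 308993) 
(n (n (l 302400) (n (n (n (l 282834) (n (n (l 282834) (n (n (n (n (l 184791) (n (n (l 1) d) 
(l 184791))) (l 184791)) (l 282834)) (l 282834))) (l 282834))) (l 282834)) (l 302400))) (l 302400))) (l 308993)) 
(l 313780))) (l 313780))) (l 313780)) (l 315034)) (l 315034))) (l 315592))) (n (n (n (n (l 306030) (n (n (n (n (l 305072) 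
(n (n (l 303938) (n (n (n (l 300919) (n (n (l 296076) (n (n (n (l 287150) (n (n (l 262695) 
(n (n (n (l 208469) (n (n (n (n (l 1) d) (l 175712)) (l 175712)) (l 175712))) (l 262695)) (l 262695))) 
(l 287150))) (l 287150)) (l 296076))) (l 296076))) (l 300919)) (l 303938))) (l 303938))) (l 305072)) (l 306030)) 
(l 306030))) (l 306437)) (n (n (n (l 276741) (n (n (l 241788) (n (n (n (l 130724) (n d (l 1))) (l 130724)) 
(l 241788))) (l 241788))) (l 276741)) (l 306437))) (l 306437))) (l 316279)) (l 324219))) (l 324507))) (l 350733)) 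
(l 353000))) (l 364143))) d) (l 385381))) (l 654039)))

/-- the certificate, words that start with `aba` -/
noncomputable def cert1 : WTree :=
(n (n (n (n (l 412028) (n (n (n (n (l 338262) 
(n (n (n (n (l 157099) (n d (l 1))) (n (n (n (n (l 280594) (n (n (n (n (l 279243) (n (n (n (l 278267) 
(n (n (n (n (l 276960) (n (n (n (n (l 264707) (n (n (n (l 246946) (n (n (n (n (l 223131) (n (n (n (n (l 1) 
d) (l 155323)) (l 155323)) (l 155323))) (l 223131)) (l 223131)) (l 223131))) (l 264707)) (l 264707))) (l 273236)) 
(l 273236)) (l 273236))) (l 276960)) (l 276960)) (l 276960))) (l 279243)) (l 279243))) (n (n (l 278045) 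
(n (n (n (n (l 275826) (n (n (n (n (l 247842) (n (n (n (l 229857) (n (n (n (n (l 124388) (n (n d 
(l 1)) (l 124388))) (l 124388)) (l 194360)) (l 194360))) (l 247842)) (l 247842))) (l 262267)) (l 271271)) 
(l 271271))) (l 275826)) (l 275826)) (l 275826))) (l 279711))) (n (n (n (l 279634) (n (n (l 279422) 
(n (n (n (l 278973) (n (n (n (n (l 278513) (n (n (n (n (l 272604) (n (n (n (l 262072) (n (n (n (n (l 242987) 
(n (n (l 211904) (n (n (n (l 155323) (n (n (l 1) d) (l 155323))) (l 155323)) (l 211904))) (l 211904))) 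
(l 242987)) (l 262072)) (l 262072))) (l 272604)) (l 272604))) (l 274419)) (l 276824)) (l 276824))) (l 278513)) 
(l 278513)) (l 278513))) (l 279422)) (l 279422))) (l 279634))) (l 279634)) (l 279711))) (l 280347))) (l 280594)) 
(n (n (n (n (l 279931) (n (n (l 277912) (n (n (n (n (l 271139) (n (n (n (n (l 251377) (n (n (n (l 210787) 
(n (n (l 124560) (n (n (n d (l 1)) (l 124560)) (l 124560))) (l 210787))) (l 210787)) (l 251377))) (l 251377)) 
(l 266283)) (l 266283))) (l 274949)) (l 274949)) (l 274949))) (l 279931))) (n (n (n (l 279670) (n (n (l 279393) 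
(n (n (n (l 279103) (n (n (n (n (l 277392) (n (n (n (n (l 271444) (n (n (n (l 271444) (n (n (l 243033) 
(n (n (n (l 211950) (n (n (n (l 155210) (n (n (l 1) d) (l 155210))) (l 155210)) (l 211950))) (l 211950)) 
(l 243033))) (l 260741))) (l 271444)) (l 271444))) (l 271444)) (l 275240)) (l 275240))) (l 278306)) (l 278306)) 
(l 278306))) (l 279393)) (l 279393))) (l 279670))) (n (n (n (n (l 279077) (n (n (n (l 278731) (n (n (n (n (l 277333) 
(n (n (n (n (l 273850) (n (n (n (l 265714) (n (n (l 255611) (n (n (n (l 222641) (n (n (l 222641) 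
(n (n (n (n (l 1) d) (l 154922)) (l 154922)) (l 154922))) (l 222641))) (l 222641)) (l 255611))) (l 255611))) 
(l 265714)) (l 273850))) (l 273850)) (l 275725)) (l 275725))) (l 278119)) (l 278119)) (l 278119))) (l 279077)) 
(l 279077))) (n (n (l 278703) (n (n (n (n (l 276334) (n (n (n (n (l 269717) (n (n (n (l 256255) 
(n (n (l 244358) (n (n (n (l 193511) (n (n (l 124367) (n (n d (l 1)) (l 124367))) (l 124367))) (l 193511)) 
(l 244358))) (l 244358))) (l 256255)) (l 269717))) (l 269717)) (l 273936)) (l 273936))) (l 277666)) (l 277666)) 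
(l 277666))) (l 279289))) (l 279289)) (l 279577))) (l 279770))) (l 280759)) (l 280978))) (l 281583))) (n (n (n (n (l 280336) 
(n (n (n (n (l 278556) (n (n (l 277071) (n (n (n (n (l 268793) (n (n (n (n (l 259970) (n (n (l 239200) 
(n (n (n (n (l 123406) (n (n (n d (l 1)) (l 123406)) (l 123406))) (l 209265)) (l 209265)) (l 209265))) 
(l 259970))) (l 259970)) (l 268793)) (l 268793))) (l 274931)) (l 274931)) (l 274931))) (l 278556))) (n (n (l 278432) 
(n (n (n (l 278213) (n (n (l 277696) (n (n (n (n (l 274813) (n (n (n (n (l 270207) (n (n (l 265223) 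
(n (n (n (n (l 243161) (n (n (n (l 192697) (n (n (l 123406) (n (n d (l 1)) (l 123406))) (l 123406))) 
(l 192697)) (l 243161))) (l 243161)) (l 255058)) (l 255058))) (l 270207))) (l 270207)) (l 274813)) (l 274813))) 
(l 276948)) (l 276948)) (l 276948))) (l 278213))) (l 278213)) (l 278432))) (l 278432))) (n (n (n (n (l 276848) 
(n (n (n (l 276682) (n (n (l 276231) (n (n (n (n (l 274251) (n (n (n (n (l 270475) (n (n (l 262617) 
(n (n (n (n (l 243906) (n (n (l 226528) (n (n (n (n (l 121211) (n (n d (l 1)) (l 121211))) (l 121211)) 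
(l 191133)) (l 191133))) (l 243906))) (l 243906)) (l 262617)) (l 262617))) (l 270475))) (l 270475)) (l 274251)) 
(l 274251))) (l 275672)) (l 275672)) (l 275672))) (l 276682))) (l 276682)) (l 276848))) (n (n (n (n (l 269259) 
(n (n (n (n (l 249373) (n (n (l 212560) (n (n (n (n (l 155636) (n (n (l 1) d) (l 155636))) (l 155636)) 
(l 212560)) (l 212560))) (l 249373))) (l 249373)) (l 269259)) (l 269259))) (l 274066)) (l 274066)) (l 274066))) 
(l 279138)) (l 279138))) (l 280336))) (n (n (n (n (l 278349) (n (n (n (l 276509) (n (n (n (n (l 270580) 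
(n (n (n (n (l 261609) (n (n (l 222445) (n (n (n (l 222445) (n (n (n (n (l 1) d) (l 154999)) 
(l 154999)) (l 154999))) (l 222445)) (l 222445))) (l 246274))) (l 261609)) (l 270580)) (l 270580))) (l 274704)) 
(l 274704)) (l 274704))) (n (n (n (n (l 278064) (n (n (l 277617) (n (n (n (n (l 275582) (n (n (n (n (l 273595) 
(n (n (l 263518) (n (n (n (l 248468) (n (n (n (n (l 208131) (n (n (l 123234) (n (n (n d (l 1)) 
(l 123234)) (l 123234))) (l 208131))) (l 208131)) (l 248468)) (l 248468))) (l 263518)) (l 263518))) (l 269533))) 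
(l 273595)) (l 275582)) (l 275582))) (l 277130)) (l 277130)) (l 277130))) (l 278064))) (l 278064)) (l 278233)) 
(l 278233))) (l 278349))) (n (n (l 276177) (n (n (n (n (l 262838) (n (n (n (n (l 262838) (n (n (l 194243) 
(n (n (n (l 124026) (n (n d (l 1)) (l 124026))) (l 124026)) (l 194243))) (l 229728))) (l 262838)) (l 262838)) 
(l 262838))) (l 273078)) (l 273078)) (l 273078))) (l 279141))) (n (n (n (l 278914) (n (n (n (n (l 278335) 
(n (n (l 277724) (n (n (n (n (l 275186) (n (n (n (n (l 271270) (n (n (l 264876) (n (n (n (l 258024) 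
(n (n (l 208433) (n (n (n (l 123536) (n (n (n d (l 1)) (l 123536)) (l 123536))) (l 208433)) (l 208433))) 
(l 238369))) (l 258024)) (l 264876))) (l 264876))) (l 271270)) (l 275186)) (l 275186))) (l 277351)) (l 277351)) 
(l 277351))) (l 278335))) (l 278335)) (n (n (n (l 277759) (n (n (n (n (l 274698) (n (n (n (n (l 268629) 
(n (n (l 261438) (n (n (n (l 242303) (n (n (l 211598) (n (n (n (l 155019) (n (n (l 1) d) (l 155019))) 
(l 155019)) (l 211598))) (l 211598))) (l 242303)) (l 261438))) (l 261438))) (l 268629)) (l 274698)) (l 274698))) 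
(l 277278)) (l 277278)) (l 277278))) (l 278555)) (l 278555))) (l 278914))) (l 279065)) (l 279196))) (l 280324))) 
(l 281220)) (l 281885))) (l 283177))) (n (n (n (n (l 363022) (n (n (n (n (l 362184) (n (n (n (l 360505) 
(n (n (n (n (l 359963) (n (n (n (n (l 355697) (n (n (n (l 349515) (n (n (n (n (l 341225) (n (n (n (n (l 263554) 
(n (n (n (l 150966) (n d (l 1))) (l 263554)) (l 263554))) (l 317621)) (l 317621)) (l 317621))) (l 341225)) 
(l 341225)) (l 341225))) (l 355697)) (l 355697))) (l 358666)) (l 358666)) (l 358666))) (l 359963)) (n (n (n (l 359677) 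
(n (n (l 359677) (n (n (n (n (l 357748) (n (n (n (l 355557) (n (n (n (n (l 346693) (n (n (n (n (l 324611) 
(n (n (n (l 273036) (n (n (l 208996) (n (n d (l 1)) (l 208996))) (l 208996))) (l 273036)) (l 324611))) 
(l 324611)) (l 336496)) (l 336496))) (l 351676)) (l 351676)) (l 351676))) (l 357748)) (l 357748))) (l 359090)) 
(l 359090)) (l 359090))) (l 359677))) (l 359677)) (l 359963))) (l 359963))) (n (n (n (l 360845) (n (n (n (n (l 353638) 
(n (n (n (l 342711) (n (n (n (n (l 305130) (n (n (n (n (l 248258) (n (n (l 1) d) (l 151054))) 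
(l 248258)) (l 305130)) (l 305130))) (l 331268)) (l 331268)) (l 331268))) (l 353638)) (l 353638))) (l 358660)) 
(l 358660)) (l 358660))) (l 360845)) (l 360845))) (l 361687))) (n (n (n (n (l 360516) (n (n (n (l 360516) 
(n (n (n (n (l 352929) (n (n (n (l 352929) (n (n (n (n (l 304840) (n (n (n (l 304840) (n (n (n (n (l 1) 
d) (l 151124)) (l 247911)) (l 247911))) (l 304840)) (l 304840))) (l 328680)) (l 343949)) (l 343949))) (l 352929)) 
(l 352929))) (l 356690)) (l 359099)) (l 359099))) (l 360516)) (l 360516))) (l 361109)) (n (n (n (n (l 360616) 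
(n (n (n (n (l 350875) (n (n (n (l 344614) (n (n (n (n (l 307900) (n (n (n (l 264601) (n (n (l 151124) 
(n d (l 1))) (l 264601))) (l 264601)) (l 307900))) (l 307900)) (l 332258)) (l 332258))) (l 350875)) (l 350875))) 
(l 355896)) (l 359030)) (l 359030))) (n (n (l 360176) (n (n (n (l 360176) (n (n (n (n (l 356972) 
(n (n (n (l 354738) (n (n (n (n (l 343066) (n (n (n (l 334634) (n (n (l 303788) (n (n (n (l 247139) 
(n (n (l 1) d) (l 151124))) (l 247139)) (l 303788))) (l 303788))) (l 334634)) (l 343066))) (l 343066)) 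
(l 350259)) (l 350259))) (l 356972)) (l 356972))) (l 358729)) (l 359824)) (l 359824))) (l 360176)) (l 360176))) 
(l 360445))) (l 360616)) (l 360716))) (l 362069))) (n (n (n (n (l 298561) (n (n (n (l 211486) (n (n (n d 
(l 1)) (l 211486)) (l 211486))) (l 298561)) (l 298561))) (n (n (n (n (l 328605) (n (n (n (l 328316) 
(n (n (l 328316) (n (n (n (n (l 325854) (n (n (n (l 324203) (n (n (n (n (l 318978) (n (n (l 295700) 
(n (n (n (l 277145) (n (n (n (n (l 211412) (n (n d (l 1)) (l 211412))) (l 211412)) (l 241619)) (l 241619))) 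
(l 295700)) (l 295700))) (l 309974))) (l 318978)) (l 324203)) (l 324203))) (l 325854)) (l 325854))) (l 326919)) 
(l 327747)) (l 327747))) (l 328316))) (l 328316)) (l 328605))) (l 328605)) (n (n (n (l 328490) (n (n (n (n (l 328330) 
(n (n (n (n (l 326273) (n (n (n (l 322607) (n (n (n (n (l 315963) (n (n (l 305143) (n (n (n (l 285448) 
(n (n (l 231380) (n (n (n (l 117233) (n d (l 1))) (l 231380)) (l 231380))) (l 285448))) (l 285448)) 
(l 305143))) (l 305143))) (l 315963)) (l 322607)) (l 322607))) (l 326273)) (l 326273))) (l 326904)) (l 327742)) 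
(l 327742))) (l 328330)) (l 328330)) (l 328330))) (l 328646)) (l 328646))) (l 328720))) (l 348699)) (l 348726))) 
(l 362910))) (l 363256)) (n (n (n (n (l 360285) (n (n (n (n (l 356128) (n (n (n (l 355025) (n (n (n (n (l 349234) 
(n (n (n (l 342403) (n (n (l 324502) (n (n (n (n (l 300662) (n (n (n (n (l 1) d) (l 154978)) 
(l 251719)) (l 251719))) (l 300662)) (l 300662)) (l 300662))) (l 342403))) (l 342403)) (l 349234))) (l 349234)) 
(l 353076)) (l 353076))) (n (n (n (n (l 355738) (n (n (l 355483) (n (n (n (n (l 353937) (n (n (n (l 352157) 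
(n (n (l 347314) (n (n (n (n (l 326041) (n (n (n (n (l 285472) (n (n (l 201034) (n (n (n d 
(l 1)) (l 201034)) (l 201034))) (l 285472))) (l 285472)) (l 326041)) (l 326041))) (l 341300)) (l 341300)) 
(l 341300))) (l 352157))) (l 352157)) (l 353937))) (l 353937)) (l 354963)) (l 354963))) (l 355738))) (l 355738)) 
(l 356013)) (l 356013))) (l 356128))) (n (n (n (n (l 355117) (n (n (l 354775) (n (n (n (l 354503) 
(n (n (n (n (l 353537) (n (n (n (l 350433) (n (n (l 350433) (n (n (n (n (l 323984) (n (n (n (l 306251) 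
(n (n (n (n (l 250107) (n (n (l 1) d) (l 153367))) (l 250107)) (l 306251)) (l 306251))) (l 323984)) 
(l 323984))) (l 335427)) (l 344327)) (l 344327))) (l 350433))) (l 350433)) (l 353537))) (l 353537)) (l 353981)) 
(l 353981))) (l 354775)) (l 354775))) (l 354985))) (l 355117)) (n (n (n (n (l 345314) (n (n (n (l 326529) 
(n (n (l 307974) (n (n (n (n (l 201826) (n (n d (l 1)) (l 201826))) (l 201826)) (l 272483)) (l 272483))) 
(l 326529))) (l 326529)) (l 345314))) (l 345314)) (l 351890)) (l 351890))) (l 356920))) (n (n (n (n (l 354987) 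
(n (n (n (n (l 348108) (n (n (n (l 333978) (n (n (l 303963) (n (n (n (n (l 260604) (n (n (l 154999) 
(n d (l 1))) (l 260604))) (l 260604)) (l 303963)) (l 303963))) (l 333978))) (l 333978)) (l 348108))) (l 348108)) 
(l 353296)) (l 353296))) (n (n (n (n (l 355955) (n (n (l 355600) (n (n (n (n (l 354210) (n (n (n (l 350184) 
(n (n (l 342636) (n (n (n (n (l 335784) (n (n (l 285751) (n (n (n (l 201314) (n (n (n d (l 1)) 
(l 201314)) (l 201314))) (l 285751)) (l 285751))) (l 315895))) (l 335784)) (l 342636)) (l 342636))) (l 350184))) 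
(l 350184)) (l 354210))) (l 354210)) (l 355600)) (l 355600))) (l 355955))) (l 355955)) (l 356313)) (l 356313))) 
(l 356463)) (l 356463))) (l 359999))) (n (n (n (n (l 310726) (n (n (n (l 253744) (n (n (l 1) d) (l 156392))) 
(n (n (n (l 253518) (n (n (l 253055) (n (n (n (n (l 250372) (n (n (n (l 247526) (n (n (l 242195) 
(n (n (n (l 218533) (n (n (n (n (l 168042) (n (n (l 97352) (n (n d (l 1)) (l 97352))) (l 97352))) 
(l 168042)) (l 218533)) (l 218533))) (l 242195)) (l 242195))) (l 242195))) (l 247526)) (l 250372))) (l 250372)) 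
(l 252084)) (l 252084))) (l 253518))) (l 253518)) (l 253744))) (l 310563))) (n (n (l 310431) (n (n (n (n (l 309974) 
(n (n (l 309560) (n (n (n (n (l 306875) (n (n (n (l 306875) (n (n (l 295364) (n (n (n (l 280459) 
(n (n (n (l 239839) (n (n (l 153973) (n (n (n d (l 1)) (l 153973)) (l 153973))) (l 239839))) (l 239839)) 
(l 280459))) (l 280459)) (l 295364))) (l 300221))) (l 306875)) (l 306875))) (l 306875)) (l 308588)) (l 308588))) 
(l 309974))) (n (n (n (n (l 309378) (n (n (n (n (l 307307) (n (n (n (l 307307) (n (n (l 297418) 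
(n (n (n (l 286598) (n (n (n (l 266847) (n (n (l 212819) (n (n (n (l 156000) (n d (l 1))) (l 212819)) 
(l 212819))) (l 266847))) (l 266847)) (l 286598))) (l 286598)) (l 297418))) (l 303582))) (l 307307)) (l 307307))) 
(l 307307)) (l 308629)) (l 308629))) (l 309696)) (l 309696)) (l 309696))) (l 310431)) (l 310431))) (l 310726))) 
(n (n (n (n (l 341468) (n (n (n (n (l 341018) (n (n (l 340662) (n (n (n (n (l 339084) (n (n (n (l 335477) 
(n (n (l 330523) (n (n (n (l 321701) (n (n (l 300933) (n (n (n (n (l 185094) (n (n (n d (l 1)) 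
(l 185094)) (l 185094))) (l 270863)) (l 270863)) (l 270863))) (l 321701))) (l 321701)) (l 330523))) (l 330523))) 
(l 335477)) (l 339084))) (l 339084)) (l 339935)) (l 339935))) (l 341018))) (n (n (n (n (l 340531) (n (n (n (n (l 339319) 
(n (n (n (l 336487) (n (n (l 332970) (n (n (n (l 321493) (n (n (l 321493) (n (n (n (n (l 243992) 
(n (n (n (l 155924) (n d (l 1))) (l 243992)) (l 243992))) (l 297920)) (l 297920)) (l 297920))) (l 321493))) 
(l 321493)) (l 332970))) (l 332970))) (l 336487)) (l 339319))) (l 339319)) (l 339971)) (l 339971))) (l 340805)) 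
(l 340805)) (l 340805))) (l 341468)) (l 341468))) (n (n (n (n (l 340427) (n (n (n (l 340075) (n (n (n (n (l 338234) 
(n (n (n (l 336903) (n (n (l 332037) (n (n (n (l 323101) (n (n (l 284114) (n (n (n (l 284114) 
(n (n (n (n (l 1) d) (l 155848)) (l 252864)) (l 252864))) (l 284114)) (l 284114))) (l 307954))) (l 323101)) 
(l 332037))) (l 332037))) (l 336903)) (l 338234))) (l 338234)) (l 339368)) (l 339368))) (l 340427)) (l 340427))) 
(n (n (l 340101) (n (n (n (n (l 336971) (n (n (n (l 331464) (n (n (l 323124) (n (n (n (l 323124) 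
(n (n (l 255493) (n (n (n (l 184856) (n (n d (l 1)) (l 184856))) (l 184856)) (l 255493))) (l 290984))) 
(l 323124)) (l 323124))) (l 323124))) (l 331464)) (l 336971))) (l 336971)) (l 338898)) (l 338898))) (l 340705))) 
(n (n (n (n (l 340052) (n (n (n (n (l 337749) (n (n (n (l 333063) (n (n (l 328922) (n (n (n (l 311222) 
(n (n (l 287153) (n (n (n (l 243861) (n (n (l 155848) (n d (l 1))) (l 243861))) (l 243861)) (l 287153))) 
(l 287153))) (l 311222)) (l 328922))) (l 328922))) (l 333063)) (l 337749))) (l 337749)) (l 339218)) (l 339218))) 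
(l 340516)) (l 340516)) (l 340516))) (l 341638))) (l 341694)) (l 342007))) (l 342409))) (l 369734)) (l 369876))) 
(l 377412))) (n (n (n (n (l 361271) (n (n (n (n (l 345452) (n (n (n (l 343498) (n (n (l 340704) 
(n (n (n (n (l 336668) (n (n (l 326839) (n (n (n (n (l 293863) (n (n (n (n (l 197637) (n (n d 
(l 1)) (l 197637))) (l 197637)) (l 270216)) (l 270216))) (l 312413)) (l 312413)) (l 312413))) (l 336668))) 
(l 336668)) (l 340704)) (l 340704))) (l 343498))) (n (n (n (n (l 340456) (n (n (n (n (l 337385) (n (n (l 330155) 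
(n (n (n (n (l 289848) (n (n (n (n (l 246890) (n (n (l 145760) (n d (l 1))) (l 246890))) (l 246890)) 
(l 289848)) (l 289848))) (l 319735)) (l 319735)) (l 319735))) (l 337385))) (l 337385)) (l 340456)) (l 340456))) 
(n (n (n (n (l 341895) (n (n (l 341330) (n (n (n (n (l 340510) (n (n (l 338331) (n (n (n (n (l 328424) 
(n (n (n (n (l 318751) (n (n (l 269685) (n (n (n (l 196403) (n (n (n d (l 1)) (l 196403)) (l 196403))) 
(l 269685)) (l 269685))) (l 298970))) (l 318751)) (l 328424)) (l 328424))) (l 335964)) (l 335964)) (l 335964))) 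
(l 340510))) (l 340510)) (l 341330)) (l 341330))) (l 341895))) (l 341895)) (n (n (n (l 341428) (n (n (n (n (l 340358) 
(n (n (l 337382) (n (n (n (n (l 325023) (n (n (n (n (l 305956) (n (n (l 274825) (n (n (n (l 241462) 
(n (n (l 1) d) (l 145760))) (l 241462)) (l 274825))) (l 274825))) (l 305956)) (l 325023)) (l 325023))) 
(l 335567)) (l 335567)) (l 335567))) (l 340358))) (l 340358)) (l 341428)) (l 341428))) (l 342163)) (l 342163))) 
(l 342423))) (l 342693)) (l 342753))) (l 345369))) (n (n (n (n (l 311819) (n (n (l 311819) (n (n (n (n (l 1) 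
d) (l 147080)) (l 244002)) (l 244002))) (l 311819))) (l 311819)) (n (n (n (n (l 344736) (n (n (n (n (l 344033) 
(n (n (l 343471) (n (n (n (n (l 342133) (n (n (l 340891) (n (n (n (n (l 333362) (n (n (n (l 324696) 
(n (n (l 301116) (n (n (n (n (l 197532) (n (n (n d (l 1)) (l 197532)) (l 197532))) (l 271831)) (l 271831)) 
(l 271831))) (l 324696))) (l 324696)) (l 333362))) (l 333362)) (l 338360)) (l 338360))) (l 342133))) (l 342133)) 
(l 343471)) (l 343471))) (l 344033))) (l 344033)) (n (n (n (l 343571) (n (n (n (n (l 341827) (n (n (l 340101) 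
(n (n (n (n (l 333332) (n (n (n (l 313730) (n (n (l 276978) (n (n (n (n (l 243616) (n (n (l 1) 
d) (l 146770))) (l 243616)) (l 276978)) (l 276978))) (l 313730))) (l 313730)) (l 333332))) (l 333332)) (l 340101)) 
(l 340101))) (l 341827))) (l 341827)) (l 343571)) (l 343571))) (l 344303)) (l 344303))) (l 344564))) (n (n (n (l 344200) 
(n (n (l 343231) (n (n (n (n (l 341495) (n (n (l 339478) (n (n (n (n (l 326406) (n (n (n (l 326406) 
(n (n (l 270359) (n (n (n (l 197785) (n (n d (l 1)) (l 197785))) (l 197785)) (l 270359))) (l 294006))) 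
(l 326406)) (l 326406))) (l 326406)) (l 334746)) (l 334746))) (l 341495))) (l 341495)) (l 343231)) (l 343231))) 
(l 344200))) (n (n (n (n (l 343196) (n (n (n (n (l 341593) (n (n (l 339858) (n (n (n (n (l 332178) 
(n (n (n (l 314612) (n (n (l 290492) (n (n (n (l 247534) (n (n (l 146414) (n d (l 1))) (l 247534))) 
(l 247534)) (l 290492))) (l 290492))) (l 314612)) (l 332178))) (l 332178)) (l 336319)) (l 336319))) (l 341593))) 
(l 341593)) (l 343196)) (l 343196))) (l 343939)) (l 343939)) (l 343939))) (l 344838))) (l 344897)) (l 345142))) 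
(l 345334))) (n (n (n (n (l 357001) (n (n (n (n (l 353719) (n (n (l 353392) (n (n (n (l 352905) 
(n (n (n (n (l 351598) (n (n (l 348847) (n (n (n (n (l 344855) (n (n (l 334246) (n (n (n (n (l 286005) 
(n (n (n (n (l 238906) (n (n (l 1) d) (l 142593))) (l 238906)) (l 286005)) (l 286005))) (l 322718)) 
(l 322718)) (l 322718))) (l 344855))) (l 344855)) (l 348847)) (l 348847))) (l 351598))) (l 351598)) (l 352905)) 
(l 352905))) (l 353392)) (l 353392))) (l 353587))) (n (n (l 353562) (n (n (n (n (l 352873) (n (n (n (n (l 351558) 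
(n (n (l 348823) (n (n (n (n (l 342309) (n (n (l 336260) (n (n (n (n (l 299600) (n (n (n (l 257406) 
(n (n (l 142593) (n d (l 1))) (l 257406))) (l 257406)) (l 299600))) (l 299600)) (l 323940)) (l 323940))) 
(l 342309))) (l 342309)) (l 348823)) (l 348823))) (l 351558))) (l 351558)) (l 352873)) (l 352873))) (l 353367)) 
(l 353367)) (l 353367))) (l 353719))) (n (n (n (n (l 344875) (n (n (l 329488) (n (n (n (n (l 286114) 
(n (n (l 211190) (n (n (n d (l 1)) (l 211190)) (l 211190))) (l 286114))) (l 286114)) (l 329488)) (l 329488))) 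
(l 344875))) (l 344875)) (l 353783)) (l 353783))) (l 357001))) (n (n (n (n (l 354087) (n (n (n (n (l 347165) 
(n (n (l 334350) (n (n (n (n (l 314535) (n (n (l 260359) (n (n (n (l 145540) (n d (l 1))) (l 260359)) 
(l 260359))) (l 314535))) (l 314535)) (l 334350)) (l 334350))) (l 347165))) (l 347165)) (l 354087)) (l 354087))) 
(n (n (l 355202) (n (n (n (l 354619) (n (n (n (n (l 352211) (n (n (l 347568) (n (n (n (n (l 347568) 
(n (n (l 319156) (n (n (n (l 288041) (n (n (n (l 240942) (n (n (l 1) d) (l 145540))) (l 240942)) 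
(l 288041))) (l 288041)) (l 319156))) (l 336875))) (l 347568)) (l 347568)) (l 347568))) (l 352211))) (l 352211)) 
(l 354619)) (l 354619))) (l 355202)) (l 355202))) (l 355539))) (n (n (n (l 355126) (n (n (l 355126) 
(n (n (n (n (l 351950) (n (n (l 345963) (n (n (n (n (l 332481) (n (n (l 332481) (n (n (n (l 281049) 
(n (n (l 210220) (n (n d (l 1)) (l 210220))) (l 210220))) (l 281049)) (l 332481))) (l 332481))) (l 332481)) 
(l 345963)) (l 345963))) (l 351950))) (l 351950)) (l 355126)) (l 355126))) (l 355126))) (l 355126)) (l 355760))) 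
(l 355869))) (l 359678)) (l 359905))) (l 361089))) (n (n (n (n (l 340656) (n (n (n (n (l 336601) (n (n (l 333969) 
(n (n (n (n (l 329899) (n (n (l 318773) (n (n (n (l 295192) (n (n (n (n (l 213654) (n (n (n d 
(l 1)) (l 213654)) (l 213654))) (l 265301)) (l 265301)) (l 265301))) (l 318773)) (l 318773))) (l 329899))) 
(l 329899)) (l 333969)) (l 333969))) (l 336601))) (n (n (n (n (l 334537) (n (n (n (n (l 331414) (n (n (l 317781) 
(n (n (n (l 317781) (n (n (n (n (l 240348) (n (n (n (l 122946) (n d (l 1))) (l 240348)) (l 240348))) 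
(l 294303)) (l 294303)) (l 294303))) (l 317781)) (l 317781))) (l 326076))) (l 331414)) (l 334537)) (l 334537))) 
(l 335972)) (n (n (n (n (l 335584) (n (n (n (l 335324) (n (n (n (n (l 334499) (n (n (l 330827) 
(n (n (n (l 327900) (n (n (n (n (l 317530) (n (n (n (l 284180) (n (n (l 284180) (n (n (n (n (l 1) 
d) (l 122946)) (l 218570)) (l 218570))) (l 284180))) (l 284180)) (l 317530))) (l 317530)) (l 322296)) (l 322296))) 
(l 330827)) (l 330827))) (l 333079))) (l 334499)) (l 335324)) (l 335324))) (l 335584)) (l 335584))) (l 335752)) 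
(l 335883)) (l 335883))) (l 335972))) (n (n (n (n (l 335010) (n (n (n (l 334479) (n (n (l 333777) 
(n (n (n (n (l 333139) (n (n (l 328482) (n (n (n (l 320623) (n (n (n (n (l 301886) (n (n (l 283337) 
(n (n (n (n (l 210616) (n (n d (l 1)) (l 210616))) (l 210616)) (l 283337)) (l 283337))) (l 301886))) 
(l 301886)) (l 320623)) (l 320623))) (l 328482)) (l 328482))) (l 331288))) (l 333139)) (l 333777)) (l 333777))) 
(l 334479))) (n (n (n (n (l 333771) (n (n (n (n (l 333080) (n (n (l 329572) (n (n (n (l 324333) 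
(n (n (n (n (l 310292) (n (n (l 280739) (n (n (n (n (l 237842) (n (n (l 123863) (n d (l 1))) 
(l 237842))) (l 237842)) (l 280739)) (l 280739))) (l 310292))) (l 310292)) (l 324333)) (l 324333))) (l 329572)) 
(l 329572))) (l 331665))) (l 333080)) (l 333771)) (l 333771))) (l 334310)) (l 334310)) (l 334310))) (l 335010))) 
(n (n (n (n (l 330189) (n (n (l 309617) (n (n (n (l 272824) (n (n (n (n (l 221032) (n (n (l 1) 
d) (l 124238))) (l 221032)) (l 272824)) (l 272824))) (l 309617)) (l 309617))) (l 321180))) (l 330189)) (l 335010)) 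
(l 335010))) (l 338622)) (l 338622))) (l 339818))) (n (n (l 340036) (n (n (n (n (l 335117) (n (n (n (n (l 335117) 
(n (n (l 311239) (n (n (n (l 286797) (n (n (n (l 243624) (n (n (l 124510) (n d (l 1))) (l 243624))) 
(l 243624)) (l 286797))) (l 286797)) (l 311239))) (l 323592))) (l 335117)) (l 335117)) (l 335117))) (n (n (n (n (l 337525) 
(n (n (l 336571) (n (n (n (n (l 336571) (n (n (l 330736) (n (n (n (l 324346) (n (n (n (l 314673) 
(n (n (l 265189) (n (n (n (l 213509) (n (n (n d (l 1)) (l 213509)) (l 213509))) (l 265189)) (l 265189))) 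
(l 295080))) (l 314673)) (l 324346))) (l 324346)) (l 330736))) (l 334375))) (l 336571)) (l 336571)) (l 336571))) 
(l 337525))) (l 337525)) (n (n (n (l 336777) (n (n (n (n (l 336777) (n (n (l 328444) (n (n (n (l 321251) 
(n (n (n (l 302138) (n (n (l 271406) (n (n (n (l 219568) (n (n (l 1) d) (l 124510))) (l 219568)) 
(l 271406))) (l 271406))) (l 302138)) (l 321251))) (l 321251)) (l 328444))) (l 332937))) (l 336777)) (l 336777)) 
(l 336777))) (l 338020)) (l 338020))) (l 338395))) (l 338801)) (l 338958))) (l 341137))) (n (n (n (n (l 289704) 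
(n (n (n (l 216649) (n (n (l 216424) (n (n (n (l 215426) (n (n (n (n (l 213297) (n (n (l 210315) 
(n (n (n (l 206209) (n (n (l 197769) (n (n (n (n (l 148909) (n (n (n (l 97089) (n (n (l 1) 
d) (l 1))) (l 97089)) (l 148909))) (l 148909)) (l 180090)) (l 180090))) (l 206209))) (l 206209)) (l 210315))) 
(l 210315))) (l 213297)) (l 215426)) (l 215426))) (l 216424)) (l 216424))) (l 216424))) (n (n d (l 1)) 
(l 216649))) (l 216769))) (n (n (n (n (l 289477) (n (n (n (n (l 288940) (n (n (n (l 288362) (n (n (n (n (l 287314) 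
(n (n (l 285607) (n (n (n (l 282500) (n (n (l 273970) (n (n (n (l 255963) (n (n (n (n (l 237470) 
(n (n (n (n (l 1) d) (l 72934)) (l 169609)) (l 169609))) (l 237470)) (l 237470)) (l 237470))) (l 273970)) 
(l 273970))) (l 282500))) (l 282500)) (l 285607))) (l 285607))) (l 287314)) (l 288362)) (l 288362))) (l 288940)) 
(l 288940))) (l 289040)) (n (n (n (n (l 288288) (n (n (n (n (l 286925) (n (n (l 284699) (n (n (n (l 282314) 
(n (n (l 265052) (n (n (n (l 235499) (n (n (n (n (l 192497) (n (n (l 72934) (n d (l 1))) (l 192497))) 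
(l 192497)) (l 235499)) (l 235499))) (l 265052)) (l 265052))) (l 275472))) (l 282314)) (l 284699))) (l 284699))) 
(l 286925)) (l 288288)) (l 288288))) (l 289042)) (l 289042)) (l 289042))) (l 289384))) (l 289477)) (n (n (n (n (l 288624) 
(n (n (l 287395) (n (n (n (n (l 284626) (n (n (l 284626) (n (n (n (l 274063) (n (n (l 259516) 
(n (n (n (l 216342) (n (n (l 216342) (n (n (n d (l 1)) (l 216342)) (l 216342))) (l 216342))) (l 216342)) 
(l 259516))) (l 259516))) (l 274063)) (l 284626))) (l 284626))) (l 284626)) (l 287395)) (l 287395))) (l 288624))) 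
(n (n (n (n (l 287559) (n (n (n (n (l 285446) (n (n (l 282943) (n (n (n (l 276282) (n (n (l 265594) 
(n (n (n (l 245899) (n (n (l 191937) (n (n (n (l 72282) (n d (l 1))) (l 191937)) (l 191937))) (l 245899))) 
(l 245899)) (l 265594))) (l 265594))) (l 276282)) (l 282943))) (l 282943))) (l 285446)) (l 287559)) (l 287559))) 
(l 288457)) (l 288457)) (l 288457))) (l 289554)) (l 289554))) (l 289679))) (l 341566)) (l 341742))) (l 365934))) 
(l 370591)) (l 382801))) (l 388658))) (n (n (n (n (l 283171) (n (n (n (n (l 276571) (n (n (n (l 275378) 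
(n (n (n (n (l 275020) (n (n (n (n (l 273441) (n (n (n (l 271289) (n (n (n (n (l 268403) (n (n (n (n (l 241366) 
(n (n (n (l 202175) (n (n (n (n (l 149624) (n d (l 1))) (l 149624)) (l 149624)) (l 149624))) (l 241366)) 
(l 241366))) (l 260187)) (l 260187)) (l 260187))) (l 268403)) (l 268403)) (l 268403))) (l 273441)) (l 273441))) 
(l 274475)) (n (n (n (l 274304) (n (n (l 273836) (n (n (n (l 272847) (n (n (n (n (l 271831) 
(n (n (n (n (l 258791) (n (n (n (l 235553) (n (n (n (n (l 193440) (n (n (l 124850) (n (n d 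
(l 1)) (l 124850))) (l 124850))) (l 193440)) (l 235553)) (l 235553))) (l 258791)) (l 258791))) (l 262796)) 
(l 268105)) (l 268105))) (l 271831)) (l 271831)) (l 271831))) (l 273836)) (l 273836))) (l 274304))) (l 274304)) 
(l 274475))) (l 274475))) (l 275020)) (n (n (n (l 274856) (n (n (n (l 274633) (n (n (l 274024) (n (n (n (l 273383) 
(n (n (n (n (l 269607) (n (n (n (n (l 256482) (n (n (n (l 256482) (n (n (l 193792) (n (n (n (l 125202) 
(n (n d (l 1)) (l 125202))) (l 125202)) (l 193792))) (l 232865))) (l 256482)) (l 256482))) (l 256482)) 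
(l 264858)) (l 264858))) (l 271624)) (l 271624)) (l 271624))) (l 274024)) (l 274024))) (l 274633))) (n (n (n (n (l 273962) 
(n (n (n (l 273199) (n (n (n (n (l 270113) (n (n (n (n (l 262427) (n (n (n (l 244474) (n (n (l 222181) 
(n (n (n (l 149430) (n (n (l 149430) (n d (l 1))) (l 149430))) (l 149430)) (l 222181))) (l 222181))) 
(l 244474)) (l 262427))) (l 262427)) (l 266564)) (l 266564))) (l 271848)) (l 271848)) (l 271848))) (l 273962)) 
(l 273962))) (l 274429)) (l 274429)) (l 274429))) (l 274856))) (l 274856)) (l 275077))) (l 275147))) (n (n (n (n (l 274594) 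
(n (n (l 272309) (n (n (n (l 267466) (n (n (n (n (l 250720) (n (n (n (n (l 206840) (n (n (l 125609) 
(n (n (n d (l 1)) (l 125609)) (l 125609))) (l 206840))) (l 206840)) (l 250720)) (l 250720))) (l 261327)) 
(l 261327)) (l 261327))) (l 272309)) (l 272309))) (l 274594))) (n (n (n (n (l 271928) (n (n (n (l 268125) 
(n (n (n (n (l 255043) (n (n (n (n (l 235246) (n (n (l 148828) (n (n (n (l 148828) (n d (l 1))) 
(l 148828)) (l 148828))) (l 201409))) (l 235246)) (l 255043)) (l 255043))) (l 264141)) (l 264141)) (l 264141))) 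
(l 271928)) (l 271928))) (l 273676)) (n (n (n (l 273387) (n (n (l 272595) (n (n (n (l 270838) (n (n (n (n (l 264084) 
(n (n (n (n (l 250693) (n (n (l 234826) (n (n (n (l 192602) (n (n (l 124848) (n (n d (l 1)) 
(l 124848))) (l 124848))) (l 192602)) (l 234826))) (l 234826))) (l 250693)) (l 264084)) (l 264084))) (l 269777)) 
(l 269777)) (l 269777))) (l 272595)) (l 272595))) (l 273387))) (l 273387)) (l 273676))) (l 273676))) (l 275430)) 
(l 275528))) (l 276361))) (n (n (n (n (l 251909) (n (n (n (n (l 251235) (n (n (l 248435) (n (n (n (l 248435) 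
(n (n (n (n (l 232532) (n (n (n (l 208420) (n (n (n (n (l 125494) (n (n (n d (l 1)) (l 125494)) 
(l 125494))) (l 183170)) (l 183170)) (l 183170))) (l 232532)) (l 232532))) (l 243613)) (l 243613)) (l 243613))) 
(l 248435)) (l 248435))) (l 250138))) (n (n (n (n (l 248473) (n (n (n (l 248473) (n (n (n (n (l 231733) 
(n (n (n (l 231733) (n (n (n (n (l 125619) (n (n (n (l 125619) (n d (l 1))) (l 125619)) (l 125619))) 
(l 178225)) (l 211916)) (l 211916))) (l 231733)) (l 231733))) (l 240032)) (l 245347)) (l 245347))) (l 248473)) 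
(l 248473))) (l 249782)) (n (n (n (l 250398) (n (n (l 249428) (n (n (n (l 249428) (n (n (n (n (l 242357) 
(n (n (n (l 237429) (n (n (n (n (l 211673) (n (n (n (l 193066) (n (n (l 125001) (n (n d (l 1)) 
(l 125001))) (l 125001))) (l 193066)) (l 211673))) (l 211673)) (l 227545)) (l 227545))) (l 242357)) (l 242357))) 
(l 246236)) (l 248650)) (l 248650))) (l 249428)) (l 249428))) (l 250021))) (l 250398)) (l 250620))) (l 250620))) 
(l 251876)) (l 251909))) (l 252411)) (n (n (n (n (l 233580) (n (n (n (n (l 230136) (n (n (n (l 227956) 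
(n (n (n (n (l 215176) (n (n (n (l 200104) (n (n (l 160603) (n (n (n (n (l 107997) (n d (l 1))) 
(l 107997)) (l 107997)) (l 107997))) (l 200104))) (l 200104)) (l 215176))) (l 215176)) (l 223655)) (l 223655))) 
(l 230136)) (l 230136))) (n (n (n (n (l 231714) (n (n (l 230960) (n (n (n (l 230359) (n (n (n (n (l 228229) 
(n (n (n (l 221380) (n (n (l 221380) (n (n (n (n (l 163016) (n (n (n (l 123886) (n (n (n d 
(l 1)) (l 123886)) (l 123886))) (l 163016)) (l 163016))) (l 188266)) (l 207905)) (l 207905))) (l 221380))) 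
(l 221380)) (l 228229))) (l 228229)) (l 229208)) (l 229208))) (l 230960)) (l 230960))) (l 231423))) (l 231714)) 
(l 231884)) (l 231884))) (l 233028)) (l 233028))) (n (n (n (n (l 125376) (n (n d (l 1)) (l 125376))) 
(l 125376)) (n (n (n (l 194332) (n (n (n (n (l 193216) (n (n (n (l 192439) (n (n (n (n (l 188376) 
(n (n (n (l 185440) (n (n (l 174703) (n (n (n (l 154984) (n (n (l 68955) (n (n (n (l 68955) 
(n d (l 1))) (l 68955)) (l 68955))) (l 121561))) (l 154984)) (l 174703))) (l 174703))) (l 185440)) (l 188376))) 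
(l 188376)) (l 190880)) (l 190880))) (l 193216)) (l 193216))) (l 193828)) (l 194209)) (l 194209))) (l 194332)) 
(l 194332))) (l 194425))) (l 252249)) (l 252284))) (l 267329))) (n (n (n (n (l 254048) (n (n (n (n (l 223408) 
(n (n (l 223286) (n (n (n (l 223155) (n (n (l 222207) (n (n (n (l 220584) (n (n (n (n (l 218222) 
(n (n (l 211657) (n (n (n (n (l 184385) (n (n (n (n (l 142312) (n (n (l 73617) (n (n d (l 1)) 
(l 73617))) (l 73617))) (l 142312)) (l 184385)) (l 184385))) (l 207652)) (l 207652)) (l 207652))) (l 218222))) 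
(l 218222)) (l 220584)) (l 220584))) (l 222207)) (l 222207))) (l 222779))) (l 223155)) (l 223286))) (l 223286))) 
(n (n (n (n (l 149646) (n (n (l 149646) (n d (l 1))) (l 149646))) (l 149646)) (n (n (n (n (l 223133) 
(n (n (l 222176) (n (n (n (l 220562) (n (n (n (n (l 216714) (n (n (l 212904) (n (n (n (n (l 197969) 
(n (n (n (l 154714) (n (n (l 73617) (n (n (n d (l 1)) (l 73617)) (l 73617))) (l 154714))) (l 154714)) 
(l 197969))) (l 197969)) (l 212904)) (l 212904))) (l 216714))) (l 216714)) (l 220562)) (l 220562))) (l 222176)) 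
(l 222176))) (l 222752))) (l 223133)) (l 223264)) (l 223264))) (l 223408))) (n (n (n (n (l 253489) (n (n (n (n (l 253347) 
(n (n (l 252626) (n (n (n (l 251550) (n (n (n (n (l 248667) (n (n (l 242597) (n (n (n (n (l 233787) 
(n (n (l 210379) (n (n (n (n (l 103928) (n (n (n d (l 1)) (l 103928)) (l 103928))) (l 184940)) (l 184940)) 
(l 184940))) (l 233787))) (l 233787)) (l 242597)) (l 242597))) (l 248667))) (l 248667)) (l 251550)) (l 251550))) 
(l 252626)) (l 252626))) (l 253056))) (l 253347)) (l 253489)) (l 253489))) (n (n (n (l 253359) (n (n (l 252127) 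
(n (n (n (l 250841) (n (n (n (n (l 245528) (n (n (l 235282) (n (n (n (n (l 235282) (n (n (l 172588) 
(n (n (n (l 103928) (n (n d (l 1)) (l 103928))) (l 103928)) (l 172588))) (l 211686))) (l 235282)) (l 235282)) 
(l 235282))) (l 245528))) (l 245528)) (l 250841)) (l 250841))) (l 252127)) (l 252127))) (l 252871))) (l 253359)) 
(l 253600))) (l 253600)) (l 253759))) (l 253993))) (n (n (n (n (l 263387) (n (n (n (l 259061) (n (n (l 259061) 
(n (n (n (n (l 258204) (n (n (n (l 257629) (n (n (n (n (l 255810) (n (n (l 247707) (n (n (n (l 241248) 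
(n (n (n (n (l 218367) (n (n (n (l 144775) (n (n (l 144775) (n d (l 1))) (l 144775))) (l 144775)) 
(l 218367))) (l 218367)) (l 228882)) (l 228882))) (l 247707)) (l 247707))) (l 252676))) (l 255810)) (l 257629)) 
(l 257629))) (l 258204)) (l 258204))) (l 258575)) (l 258863)) (l 258863))) (l 259061))) (n (n (n (l 251505) 
(n (n (n (n (l 240868) (n (n (l 195473) (n (n (n (l 114285) (n (n (n d (l 1)) (l 114285)) (l 114285))) 
(l 195473)) (l 195473))) (l 220988))) (l 240868)) (l 251505)) (l 251505))) (l 259061)) (l 259061))) (l 261536))) 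
(n (n (l 263182) (n (n (n (l 262837) (n (n (l 261376) (n (n (n (l 258633) (n (n (n (n (l 258633) 
(n (n (l 240246) (n (n (n (l 224374) (n (n (n (l 182199) (n (n (l 114386) (n (n d (l 1)) (l 114386))) 
(l 114386))) (l 182199)) (l 224374))) (l 224374)) (l 240246))) (l 250161))) (l 258633)) (l 258633)) (l 258633))) 
(l 261376)) (l 261376))) (l 262205))) (l 262837)) (l 263182))) (l 263182))) (n (n (n (n (l 264087) (n (n (n (l 263822) 
(n (n (l 263326) (n (n (n (l 261124) (n (n (n (n (l 256424) (n (n (l 249845) (n (n (n (l 240784) 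
(n (n (l 222162) (n (n (n (n (l 114346) (n (n d (l 1)) (l 114346))) (l 114346)) (l 183149)) (l 183149))) 
(l 240784))) (l 240784)) (l 249845))) (l 249845))) (l 256424)) (l 261124)) (l 261124))) (l 263326)) (l 263326))) 
(l 263326))) (l 263822)) (l 264087))) (n (n (n (n (l 264031) (n (n (n (n (l 263315) (n (n (n (l 262039) 
(n (n (n (n (l 259726) (n (n (l 255960) (n (n (n (l 249104) (n (n (l 230283) (n (n (n (l 190549) 
(n (n (n (n (l 149740) (n d (l 1))) (l 149740)) (l 149740)) (l 149740))) (l 230283)) (l 230283))) (l 249104))) 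
(l 249104)) (l 255960))) (l 255960))) (l 259726)) (l 262039)) (l 262039))) (l 263315)) (l 263315))) (l 263535)) 
(l 263827)) (l 263827))) (l 264031)) (l 264031)) (l 264031))) (l 264301)) (l 264301))) (l 264587))) (l 272284)) 
(l 272362))) (l 282905))) (n (n (n (l 1) d) (n (n (n (n (l 153511) (n (n (n (n (l 153335) (n (n (l 148431) 
(n (n (n (l 143411) (n (n (n (l 134544) (n (n (l 110081) (n (n (n (n (l 1) (n (n (n d (l 1)) 
(l 1)) (l 1))) (l 84510)) (l 84510)) (l 84510))) (l 134544))) (l 134544)) (l 143411))) (l 143411)) (l 148431))) 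
(l 150968))) (n (n (l 153127) (n (n (n (l 153127) (n (n (l 151444) (n (n (n (l 149686) (n (n (n (l 145086) 
(n (n (l 140102) (n (n (n (n (l 114278) (n (n (n (l 68825) (n (n (l 1) (n (n d (l 1)) (l 1))) 
(l 1))) (l 68825)) (l 114278))) (l 114278)) (l 130174)) (l 130174))) (l 145086))) (l 145086)) (l 149686))) 
(l 149686)) (l 151444))) (l 152328))) (l 153127)) (l 153127))) (l 153127))) (n (n (n (n (l 153085) (n (n (n (l 153085) 
(n (n (l 152014) (n (n (n (l 150626) (n (n (n (l 146846) (n (n (l 138854) (n (n (n (n (l 124523) 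
(n (n (l 107882) (n (n (n (n (l 1) (n (n d (l 1)) (l 1))) (l 1)) (l 68825)) (l 68825))) (l 124523))) 
(l 124523)) (l 138854)) (l 138854))) (l 146846))) (l 146846)) (l 150626))) (l 150626)) (l 152014))) (l 152466))) 
(l 153085)) (l 153085))) (l 153085)) (l 153244)) (l 153244))) (l 153511))) (n (n (n (n (l 153950) (n (n (n (n (l 153561) 
(n (n (n (l 153561) (n (n (l 152641) (n (n (n (l 151634) (n (n (n (l 149795) (n (n (l 144767) 
(n (n (n (l 139478) (n (n (n (n (l 108317) (n (n (n (n (l 1) (n (n d (l 1)) (l 1))) (l 1)) (l 69123)) 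
(l 69123))) (l 124959)) (l 124959)) (l 124959))) (l 144767)) (l 144767))) (l 149795))) (l 149795)) (l 151634))) 
(l 151634)) (l 152641))) (l 153214))) (l 153561)) (l 153561))) (l 153561)) (n (n (n (n (l 153684) (n (n (l 152486) 
(n (n (n (l 151173) (n (n (n (l 149187) (n (n (l 139024) (n (n (n (l 128410) (n (n (n (n (l 84560) 
(n (n (l 1) (n (n (n d (l 1)) (l 1)) (l 1))) (l 84560))) (l 84560)) (l 128410)) (l 128410))) (l 139024)) 
(l 139024))) (l 145163))) (l 149187)) (l 151173))) (l 151173)) (l 152486))) (l 153233))) (l 153684)) (l 153684)) 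
(l 153684))) (l 153880))) (n (n (l 145737) (n (n (n (l 137338) (n (n (n (l 137338) (n (n (l 69319) 
(n (n (n (l 1) (n (n d (l 1)) (l 1))) (l 1)) (l 69319))) (l 108513))) (l 137338)) (l 137338))) (l 137338)) 
(l 145737))) (l 150487))) (n (n (n (l 153826) (n (n (n (n (l 153826) (n (n (l 152114) (n (n (n (l 150637) 
(n (n (n (l 146712) (n (n (l 140400) (n (n (n (l 129754) (n (n (l 84659) (n (n (n (l 1) (n (n (n d 
(l 1)) (l 1)) (l 1))) (l 84659)) (l 84659))) (l 110231))) (l 129754)) (l 140400))) (l 140400))) (l 146712)) 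
(l 150637))) (l 150637)) (l 152114))) (l 153037))) (l 153826)) (l 153826)) (l 153826))) (l 154081)) (l 154081))) 
(l 154158))) (l 154358)) (l 155408))) (l 282952))) (n (n (n (n (l 343164) (n (n (n (n (l 326467) (n (n (n (l 323711) 
(n (n (n (n (l 321592) (n (n (n (l 319214) (n (n (l 312983) (n (n (n (n (l 304684) (n (n (n (n (l 200024) 
(n (n (n (l 132757) (n d (l 1))) (l 200024)) (l 200024))) (l 253972)) (l 287647)) (l 287647))) (l 304684)) 
(l 304684)) (l 304684))) (l 319214))) (l 319214)) (l 321592))) (l 321592)) (n (n (n (l 322489) (n (n (l 321890) 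
(n (n (n (l 320812) (n (n (l 318622) (n (n (n (n (l 309760) (n (n (n (n (l 285012) (n (n (n (l 234666) 
(n (n (l 190171) (n (n d (l 1)) (l 190171))) (l 190171))) (l 234666)) (l 285012))) (l 285012)) (l 300794)) 
(l 300794))) (l 314744)) (l 314744)) (l 314744))) (l 320812))) (l 320812)) (l 321890))) (l 321890))) (l 322489)) 
(l 322929))) (l 322929))) (n (n (n (n (l 321537) (n (n (n (l 321113) (n (n (l 320652) (n (n (n (l 319830) 
(n (n (l 317898) (n (n (n (n (l 307116) (n (n (n (n (l 289889) (n (n (l 271249) (n (n (n (n (l 188734) 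
(n (n d (l 1)) (l 188734))) (l 188734)) (l 233229)) (l 233229))) (l 289889))) (l 289889)) (l 307116)) 
(l 307116))) (l 315099)) (l 315099)) (l 315099))) (l 319830))) (l 319830)) (l 320652))) (l 320652))) (n (n (n (n (l 320574) 
(n (n (n (l 319955) (n (n (l 318269) (n (n (n (n (l 310864) (n (n (n (n (l 296742) (n (n (l 267349) 
(n (n (n (n (l 197370) (n (n (l 132378) (n d (l 1))) (l 197370))) (l 197370)) (l 267349)) (l 267349))) 
(l 296742))) (l 296742)) (l 310864)) (l 310864))) (l 316175)) (l 316175)) (l 316175))) (l 319955))) (l 319955)) 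
(l 320574))) (l 320574)) (l 320932)) (l 320932))) (l 321537))) (n (n (n (l 317519) (n (n (l 306433) 
(n (n (n (n (l 256545) (n (n (n (n (l 256545) (n (n (l 1) d) (l 132714))) (l 256545)) (l 256545)) 
(l 256545))) (l 294844)) (l 294844)) (l 294844))) (l 317519))) (l 317519)) (l 321537))) (l 321712)) (l 323987))) 
(l 325394))) (n (n (n (n (l 325929) (n (n (n (n (l 325697) (n (n (n (l 325434) (n (n (l 325107) 
(n (n (n (l 324038) (n (n (l 324038) (n (n (n (n (l 316825) (n (n (n (l 308628) (n (n (n (n (l 275476) 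
(n (n (n (n (l 192891) (n (n d (l 1)) (l 192891))) (l 192891)) (l 237340)) (l 237340))) (l 294116)) 
(l 294116)) (l 294116))) (l 316825)) (l 316825))) (l 321844)) (l 321844)) (l 321844))) (l 324038))) (l 324038)) 
(l 325107))) (l 325107))) (l 325434)) (l 325697))) (l 325697)) (n (n (n (l 325663) (n (n (n (n (l 325327) 
(n (n (n (l 324247) (n (n (l 324247) (n (n (n (n (l 315040) (n (n (n (l 308867) (n (n (n (n (l 289324) 
(n (n (l 202262) (n (n (n (l 132867) (n d (l 1))) (l 202262)) (l 202262))) (l 255648))) (l 289324)) 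
(l 308867)) (l 308867))) (l 315040)) (l 315040))) (l 319023)) (l 322121)) (l 322121))) (l 324247))) (l 324247)) 
(l 325327))) (l 325327)) (l 325482)) (l 325482))) (l 325758)) (l 325758))) (l 325831))) (l 325955)) (n (n (n (n (l 322337) 
(n (n (n (l 315798) (n (n (l 309340) (n (n (n (n (l 272390) (n (n (n (l 202134) (n (n (l 132739) 
(n d (l 1))) (l 202134))) (l 202134)) (l 272390))) (l 272390)) (l 296985)) (l 296985))) (l 315798))) (l 315798)) 
(l 322337))) (n (n (n (n (l 321137) (n (n (l 320525) (n (n (n (l 319682) (n (n (l 317948) (n (n (n (n (l 307914) 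
(n (n (n (l 297271) (n (n (l 277331) (n (n (n (l 188835) (n (n (n d (l 1)) (l 188835)) (l 188835))) 
(l 277331)) (l 277331))) (l 277331))) (l 297271)) (l 307914))) (l 307914)) (l 314317)) (l 314317))) (l 319682))) 
(l 319682)) (l 320525))) (l 320525))) (l 321137)) (n (n (n (l 320778) (n (n (n (l 318693) (n (n (l 316435) 
(n (n (n (n (l 304732) (n (n (n (l 284133) (n (n (l 252942) (n (n (n (l 252942) (n (n (l 1) 
d) (l 132739))) (l 252942)) (l 252942))) (l 252942))) (l 284133)) (l 304732))) (l 304732)) (l 311935)) (l 311935))) 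
(l 318693))) (l 318693)) (l 320778))) (l 320778)) (l 321575))) (l 321975))) (l 324832)) (l 324832))) (l 326583))) 
(n (n (n (n (l 281388) (n (n (n (n (l 278993) (n (n (n (l 274075) (n (n (l 263627) (n (n (n (n (l 248533) 
(n (n (l 211773) (n (n (n (n (l 88442) (n d (l 1))) (l 157818)) (l 157818)) (l 157818))) (l 248533))) 
(l 248533)) (l 263627)) (l 263627))) (l 274075))) (l 274075)) (l 278993))) (n (n (l 278508) (n (n (n (l 277879) 
(n (n (n (l 276166) (n (n (l 272544) (n (n (n (n (l 266049) (n (n (l 258508) (n (n (n (n (l 209617) 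
(n (n (n (l 209617) (n (n (l 1) d) (l 88442))) (l 209617)) (l 209617))) (l 209617)) (l 240808)) (l 240808))) 
(l 266049))) (l 266049)) (l 272544)) (l 272544))) (l 276166))) (l 276166)) (l 277879))) (l 277879)) (l 278508))) 
(l 278713))) (n (n (n (l 280219) (n (n (l 279421) (n (n (n (l 277050) (n (n (l 277050) (n (n (n (n (l 265170) 
(n (n (l 242778) (n (n (n (n (l 192357) (n (n (l 192357) (n (n d (l 1)) (l 192357))) (l 192357))) 
(l 192357)) (l 242778)) (l 242778))) (l 265170))) (l 265170)) (l 277050)) (l 277050))) (l 277050))) (l 277050)) 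
(l 279421))) (l 279421))) (l 280219)) (l 280799))) (l 280799))) (n (n (n (n (l 193283) (n (n (l 193159) 
(n (n (n (n (l 192675) (n (n (n (l 191274) (n (n (l 188646) (n (n (n (n (l 186261) (n (n (l 168845) 
(n (n (n (l 139452) (n (n (n (n (l 69376) (n (n (l 1) (n d (l 1))) (l 69376))) (l 69376)) (l 139452)) 
(l 139452))) (l 168845)) (l 168845))) (l 179338))) (l 186261)) (l 188646)) (l 188646))) (l 191274))) (l 191274)) 
(l 192675))) (l 192675)) (l 193159)) (l 193159))) (l 193283))) (l 193283)) (n (n (n d (l 1)) (l 193407)) 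
(l 193407))) (l 281850))) (l 282126)) (l 326621))) (l 328065))) (n (n (n (n (l 324789) (n (n (n (n (l 304311) 
(n (n (n (l 304055) (n (n (n (n (l 303422) (n (n (l 303072) (n (n (n (l 302434) (n (n (l 300682) 
(n (n (n (l 296984) (n (n (n (n (l 293185) (n (n (n (n (l 244415) (n (n (n (l 157502) (n (n (n d 
(l 1)) (l 157502)) (l 157502))) (l 244415)) (l 244415))) (l 259394)) (l 279249)) (l 279249))) (l 293185)) 
(l 293185)) (l 293185))) (l 300682)) (l 300682))) (l 302434))) (l 302434)) (l 303072))) (l 303072))) (l 303422)) 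
(n (n (n (l 303181) (n (n (n (l 302348) (n (n (l 300069) (n (n (n (l 297672) (n (n (n (n (l 283551) 
(n (n (n (n (l 234463) (n (n (n (l 234463) (n (n (l 1) d) (l 146135))) (l 234463)) (l 234463))) (l 234463)) 
(l 265789)) (l 265789))) (l 291092)) (l 291092)) (l 291092))) (l 300069)) (l 300069))) (l 302348))) (l 302348)) 
(l 303181))) (l 303181)) (l 303637))) (l 303897))) (n (n (n (l 303808) (n (n (l 303221) (n (n (n (l 302139) 
(n (n (l 299176) (n (n (n (l 292605) (n (n (n (n (l 267345) (n (n (n (n (l 217261) (n (n (l 157919) 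
(n (n d (l 1)) (l 157919))) (l 157919))) (l 217261)) (l 267345)) (l 267345))) (l 288636)) (l 288636)) 
(l 288636))) (l 299176)) (l 299176))) (l 302139))) (l 302139)) (l 303221))) (l 303221))) (l 303808)) (l 304173))) 
(l 304173))) (n (n (n (n (l 215832) (n (n (n (l 215708) (n (n (l 215255) (n (n (n (l 214424) 
(n (n (l 210795) (n (n (n (l 210795) (n (n (n (n (l 184352) (n (n (n (l 165920) (n (n (n (n (l 69591) 
(n (n d (l 1)) (l 69591))) (l 69591)) (l 128953)) (l 128953))) (l 184352)) (l 184352))) (l 198857)) (l 207887)) 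
(l 207887))) (l 210795)) (l 210795))) (l 213014))) (l 214424)) (l 215255))) (l 215255))) (l 215708)) (l 215832))) 
(l 215832)) (n (n (n (l 146346) (n d (l 1))) (l 215938)) (l 215938))) (l 270377))) (n (n (n (n (l 304124) 
(n (n (n (n (l 303301) (n (n (l 302844) (n (n (n (l 302354) (n (n (l 298809) (n (n (n (l 292739) 
(n (n (n (n (l 283908) (n (n (l 259352) (n (n (n (n (l 157353) (n (n (n d (l 1)) (l 157353)) 
(l 157353))) (l 244373)) (l 244373)) (l 244373))) (l 283908))) (l 283908)) (l 292739)) (l 292739))) (l 298809)) 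
(l 298809))) (l 300949))) (l 302354)) (l 302844))) (l 302844))) (l 303301)) (n (n (n (l 302986) (n (n (n (l 302086) 
(n (n (l 297480) (n (n (n (l 292670) (n (n (n (n (l 272798) (n (n (l 234476) (n (n (n (n (l 234476) 
(n (n (l 1) d) (l 146227))) (l 234476)) (l 234476)) (l 234476))) (l 272798))) (l 272798)) (l 292670)) 
(l 292670))) (l 297480)) (l 297480))) (l 300262))) (l 302086)) (l 302986))) (l 302986)) (l 303581))) (l 303920))) 
(n (n (n (l 303642) (n (n (l 302877) (n (n (n (l 301587) (n (n (l 296123) (n (n (n (l 285864) 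
(n (n (n (n (l 285864) (n (n (l 217097) (n (n (n (l 157735) (n (n d (l 1)) (l 157735))) (l 157735)) 
(l 217097))) (l 254180))) (l 285864)) (l 285864)) (l 285864))) (l 296123)) (l 296123))) (l 299221))) (l 301587)) 
(l 302877))) (l 302877))) (n (n (n (n (l 302708) (n (n (n (l 301717) (n (n (l 299861) (n (n (n (l 291625) 
(n (n (n (n (l 274049) (n (n (l 249442) (n (n (n (l 215554) (n (n (l 145906) (n d (l 1))) (l 215554))) 
(l 215554)) (l 249442))) (l 249442))) (l 274049)) (l 291625)) (l 291625))) (l 299861)) (l 299861))) (l 299861))) 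
(l 301717)) (l 302708))) (l 302708)) (l 303304)) (l 303304))) (l 304279))) (l 304279)) (l 304536))) (l 324586))) 
(n (n (l 320983) (n (n (n (n (l 316726) (n (n (n (l 316069) (n (n (l 315293) (n (n (n (l 315293) 
(n (n (l 308999) (n (n (n (l 302424) (n (n (n (l 285219) (n (n (l 266580) (n (n (n (n (l 169996) 
(n (n d (l 1)) (l 169996))) (l 169996)) (l 229448)) (l 229448))) (l 285219))) (l 285219)) (l 302424))) 
(l 302424)) (l 308999))) (l 312302))) (l 315293)) (l 315293))) (l 315293))) (n (n (n (n (l 315135) (n (n (n (l 315135) 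
(n (n (l 311128) (n (n (n (l 305940) (n (n (n (l 291800) (n (n (l 261910) (n (n (n (n (l 208312) 
(n (n (l 146073) (n d (l 1))) (l 208312))) (l 208312)) (l 261910)) (l 261910))) (l 291800))) (l 291800)) 
(l 305940))) (l 305940)) (l 311128))) (l 312819))) (l 315135)) (l 315135))) (l 315135)) (l 315731)) (l 315731))) 
(l 316726))) (n (n (n (n (l 316519) (n (n (n (n (l 315798) (n (n (n (l 315798) (n (n (l 312356) 
(n (n (n (l 308589) (n (n (n (l 301714) (n (n (l 282907) (n (n (n (l 263128) (n (n (n (n (l 146585) 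
(n d (l 1))) (l 208825)) (l 208825)) (l 208825))) (l 282907)) (l 282907))) (l 301714))) (l 301714)) (l 308589))) 
(l 308589)) (l 312356))) (l 314501))) (l 315798)) (l 315798))) (l 315798)) (l 316258)) (l 316258))) (n (n (l 285805) 
(n (n (n (l 254390) (n (n (n (l 254390) (n (n (l 1) d) (l 146585))) (l 254390)) (l 254390))) (l 254390)) 
(l 285805))) (l 303567))) (l 316630)) (l 316630))) (l 317065)) (l 320871))) (l 323295))) (n (n (n (n (l 331674) 
(n (n (n (n (l 331051) (n (n (n (l 330491) (n (n (l 330105) (n (n (n (l 328458) (n (n (l 326218) 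
(n (n (n (l 322189) (n (n (l 313997) (n (n (n (n (l 280852) (n (n (n (n (l 188295) (n (n d 
(l 1)) (l 188295))) (l 188295)) (l 247319)) (l 247319))) (l 299491)) (l 299491)) (l 299491))) (l 322189))) 
(l 322189)) (l 326218))) (l 326218))) (l 328458)) (l 330105))) (l 330105))) (n (n (n (n (l 329942) (n (n (n (l 328686) 
(n (n (l 326962) (n (n (n (l 323891) (n (n (l 316661) (n (n (n (n (l 276338) (n (n (n (n (l 211907) 
(n (n (l 142196) (n d (l 1))) (l 211907))) (l 211907)) (l 276338)) (l 276338))) (l 306194)) (l 306194)) 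
(l 306194))) (l 323891))) (l 323891)) (l 326962))) (l 326962))) (l 328686)) (l 329942))) (l 329942)) (l 330238)) 
(l 330238))) (l 331051))) (n (n (n (n (l 330882) (n (n (n (n (l 330459) (n (n (n (l 329474) (n (n (l 328249) 
(n (n (n (l 324255) (n (n (l 324255) (n (n (n (n (l 297277) (n (n (n (l 266620) (n (n (n (n (l 142632) 
(n d (l 1))) (l 212343)) (l 212343)) (l 212343))) (l 297277)) (l 297277))) (l 316049)) (l 316049)) (l 316049))) 
(l 324255))) (l 324255)) (l 328249))) (l 328249))) (l 329474)) (l 330459))) (l 330459)) (l 330687)) (l 330687))) 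
(l 330977)) (l 330977)) (l 330977))) (n (n (n (n (l 330776) (n (n (l 330776) (n (n (n (l 328606) 
(n (n (l 325619) (n (n (n (l 316752) (n (n (l 316752) (n (n (n (n (l 272320) (n (n (l 188575) 
(n (n (n d (l 1)) (l 188575)) (l 188575))) (l 272320))) (l 272320)) (l 316752)) (l 316752))) (l 316752))) 
(l 316752)) (l 325619))) (l 325619))) (l 328606)) (l 330776))) (l 330776))) (l 330776)) (l 331344)) (l 331344))) 
(l 331597))) (n (n (n (n (l 326901) (n (n (n (n (l 325569) (n (n (l 325055) (n (n (n (l 323687) 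
(n (n (l 321492) (n (n (n (l 317447) (n (n (l 306365) (n (n (n (l 281790) (n (n (n (n (l 187315) 
(n (n (n d (l 1)) (l 187315)) (l 187315))) (l 266945)) (l 266945)) (l 266945))) (l 306365)) (l 306365))) 
(l 317447))) (l 317447)) (l 321492))) (l 321492))) (l 323687)) (l 325055))) (l 325055))) (n (n (n (n (l 324928) 
(n (n (n (l 324465) (n (n (l 322771) (n (n (n (l 319661) (n (n (l 306089) (n (n (n (l 306089) 
(n (n (n (n (l 207190) (n (n (n (l 138254) (n d (l 1))) (l 207190)) (l 207190))) (l 261441)) (l 295212)) 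
(l 295212))) (l 306089)) (l 306089))) (l 314388))) (l 319661)) (l 322771))) (l 322771))) (l 324465)) (l 324928))) 
(l 324928)) (l 325323)) (l 325323))) (n (n (n (l 325456) (n (n (n (l 323677) (n (n (l 320817) (n (n (n (l 315992) 
(n (n (l 295556) (n (n (n (l 257190) (n (n (n (n (l 257190) (n (n (l 1) d) (l 138688))) (l 257190)) 
(l 257190)) (l 257190))) (l 295556)) (l 295556))) (l 307145))) (l 315992)) (l 320817))) (l 320817))) (l 323677)) 
(l 325456))) (l 325456)) (l 326126))) (l 326544))) (n (n (l 326972) (n (n (n (n (l 325883) (n (n (n (l 323966) 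
(n (n (l 321063) (n (n (n (l 321063) (n (n (l 297520) (n (n (n (l 272932) (n (n (n (l 208584) 
(n (n (l 138872) (n d (l 1))) (l 208584))) (l 208584)) (l 272932))) (l 272932)) (l 297520))) (l 309875))) 
(l 321063)) (l 321063))) (l 321063))) (l 323966)) (l 325883))) (l 325883)) (l 326553)) (l 326553))) (l 327182))) 
(n (n (n (n (l 313497) (n (n (n (n (l 312696) (n (n (n (l 311065) (n (n (l 309623) (n (n (n (l 303462) 
(n (n (l 295083) (n (n (n (l 280014) (n (n (l 249377) (n (n (n (n (l 125414) (n d (l 1))) (l 195126)) 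
(l 195126)) (l 195126))) (l 280014))) (l 280014)) (l 295083))) (l 295083))) (l 303462)) (l 309623))) (l 309623))) 
(l 311065)) (l 312696))) (l 312696)) (l 313207)) (l 313207))) (n (n (l 297819) (n (n (n (l 247486) 
(n (n (l 188244) (n (n d (l 1)) (l 188244))) (l 188244))) (l 247486)) (l 297819))) (l 297819))) (l 313659)) 
(l 327117))) (l 327507))) (l 332103)) (l 335810))) (l 336115))) (l 357603)) (l 359155))) (l 424630))) (n (n (n (n (l 281274) 
(n (n (n (n (l 268201) (n (n (n (l 266271) (n (n (n (n (l 264338) (n (n (n (l 263261) (n (n (l 260437) 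
(n (n (n (n (l 256676) (n (n (n (n (l 209246) (n (n (n (l 178762) (n (n (n (n (l 1) d) (l 1)) 
(l 118598)) (l 118598))) (l 209246)) (l 209246))) (l 233694)) (l 248955)) (l 248955))) (l 256676)) (l 256676)) 
(l 256676))) (l 263261))) (l 263261)) (l 264338))) (l 264338)) (n (n (n (n (l 263340) (n (n (l 259919) 
(n (n (n (n (l 248440) (n (n (n (n (l 214944) (n (n (n (l 146147) (n (n (l 1) (n d (l 1))) (l 146147))) 
(l 146147)) (l 214944))) (l 214944)) (l 240208)) (l 240208))) (l 254897)) (l 254897)) (l 254897))) (l 263340))) 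
(n (n (l 263069) (n (n (n (l 262581) (n (n (l 261588) (n (n (n (n (l 257572) (n (n (n (n (l 246356) 
(n (n (n (l 223540) (n (n (l 203376) (n (n (n (l 117193) (n (n (l 1) d) (l 1))) (l 117193)) (l 203376))) 
(l 203376))) (l 223540)) (l 246356))) (l 246356)) (l 253508)) (l 253508))) (l 259830)) (l 259830)) (l 259830))) 
(l 262581))) (l 262581)) (l 263069))) (l 263069))) (l 264745)) (l 264945))) (l 265917))) (n (n (n (n (l 264228) 
(n (n (n (n (l 262966) (n (n (l 260449) (n (n (n (n (l 246418) (n (n (n (n (l 231465) (n (n (l 196262) 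
(n (n (n (n (l 1) (n d (l 1))) (l 145523)) (l 145523)) (l 145523))) (l 231465))) (l 231465)) (l 246418)) 
(l 246418))) (l 256822)) (l 256822)) (l 256822))) (l 262966))) (n (n (l 262757) (n (n (n (l 262385) 
(n (n (l 261509) (n (n (n (n (l 256623) (n (n (n (n (l 248816) (n (n (l 240369) (n (n (n (n (l 202974) 
(n (n (n (l 117443) (n (n (l 1) d) (l 1))) (l 117443)) (l 202974))) (l 202974)) (l 223139)) (l 223139))) 
(l 248816))) (l 248816)) (l 256623)) (l 256623))) (l 260241)) (l 260241)) (l 260241))) (l 262385))) (l 262385)) 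
(l 262757))) (l 262757))) (n (n (n (n (l 263791) (n (n (n (l 263511) (n (n (l 262747) (n (n (n (n (l 259391) 
(n (n (n (n (l 252991) (n (n (l 239671) (n (n (n (n (l 207957) (n (n (l 178503) (n (n (n (n (l 1) 
d) (l 1)) (l 118512)) (l 118512))) (l 207957))) (l 207957)) (l 239671)) (l 239671))) (l 252991))) (l 252991)) 
(l 259391)) (l 259391))) (l 261798)) (l 261798)) (l 261798))) (l 263511))) (l 263511)) (l 263791))) (l 263791)) 
(l 263953)) (l 263953))) (l 264228))) (n (n (n (n (l 262907) (n (n (l 262711) (n (n (n (n (l 262425) 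
(n (n (l 261667) (n (n (n (n (l 258218) (n (n (n (n (l 254851) (n (n (l 237771) (n (n (n (l 212262) 
(n (n (n (n (l 143895) (n (n (l 1) (n d (l 1))) (l 143895))) (l 143895)) (l 212262)) (l 212262))) (l 237771)) 
(l 237771))) (l 247965))) (l 254851)) (l 258218)) (l 258218))) (l 260843)) (l 260843)) (l 260843))) (l 262425))) 
(l 262425)) (l 262711)) (l 262711))) (l 262907))) (n (n (l 257883) (n (n (n (n (l 235275) (n (n (n (n (l 235275) 
(n (n (l 119012) (n (n (n (l 1) d) (l 1)) (l 119012))) (l 179156))) (l 235275)) (l 235275)) (l 235275))) 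
(l 252631)) (l 252631)) (l 252631))) (l 262907))) (n (n (n (l 262745) (n (n (n (n (l 262372) (n (n (l 261337) 
(n (n (n (n (l 257034) (n (n (n (n (l 250397) (n (n (l 239561) (n (n (n (l 227947) (n (n (l 143895) 
(n (n (n (l 1) (n d (l 1))) (l 143895)) (l 143895))) (l 194633))) (l 227947)) (l 239561))) (l 239561))) 
(l 250397)) (l 257034)) (l 257034))) (l 260705)) (l 260705)) (l 260705))) (l 262372))) (l 262372)) (l 262745)) 
(l 262745))) (l 263001)) (l 263001))) (l 264912))) (l 265085)) (l 266137))) (l 267686))) (n (n (n (n (l 256249) 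
(n (n (n (n (l 256144) (n (n (n (l 256025) (n (n (l 255877) (n (n (n (l 255393) (n (n (l 255393) 
(n (n (n (n (l 252124) (n (n (n (l 248409) (n (n (n (n (l 233385) (n (n (n (n (l 195959) (n (n (n (l 108543) 
(n (n (l 1) d) (l 1))) (l 108543)) (l 195959))) (l 195959)) (l 216102)) (l 216102))) (l 241832)) (l 241832)) 
(l 241832))) (l 252124)) (l 252124))) (l 254398)) (l 254398)) (l 254398))) (l 255393))) (l 255393)) (l 255877))) 
(l 255877))) (l 256025)) (l 256144))) (l 256144)) (n (n (n (n (l 147585) (n (n (n (l 1) (n d (l 1))) 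
(l 147585)) (l 147585))) (n (n (n (n (l 198631) (n (n (n (l 198142) (n (n (l 198142) (n (n (n (n (l 193969) 
(n (n (n (l 191172) (n (n (n (n (l 182315) (n (n (l 142860) (n (n (n (l 111411) (n (n (n (n (l 1) 
d) (l 1)) (l 51198)) (l 51198))) (l 142860)) (l 142860))) (l 167054))) (l 182315)) (l 191172)) (l 191172))) 
(l 193969)) (l 193969))) (l 195774)) (l 197178)) (l 197178))) (l 198142))) (l 198142)) (l 198631))) (l 198631)) 
(l 198701)) (l 198701))) (l 232565)) (l 232565))) (l 256205))) (l 256261)) (n (n (n (n (l 266080) (n (n (n (n (l 262872) 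
(n (n (l 262676) (n (n (n (n (l 262211) (n (n (l 261778) (n (n (n (n (l 259157) (n (n (n (l 256141) 
(n (n (l 247933) (n (n (n (n (l 211875) (n (n (n (n (l 143115) (n (n (l 1) (n d (l 1))) (l 143115))) 
(l 143115)) (l 211875)) (l 211875))) (l 237739)) (l 237739)) (l 237739))) (l 256141))) (l 256141)) (l 259157))) 
(l 259157)) (l 260897)) (l 260897))) (l 262211))) (l 262211)) (l 262676)) (l 262676))) (l 262872))) (n (n (l 259945) 
(n (n (n (n (l 243200) (n (n (n (l 211361) (n (n (l 179912) (n (n (n (n (l 1) d) (l 1)) (l 119757)) 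
(l 119757))) (l 211361))) (l 211361)) (l 243200))) (l 243200)) (l 254346)) (l 254346))) (l 262872))) (n (n (n (l 262711) 
(n (n (n (n (l 262104) (n (n (l 261503) (n (n (n (n (l 259147) (n (n (n (l 252323) (n (n (l 239530) 
(n (n (n (n (l 227917) (n (n (l 143115) (n (n (n (l 1) (n d (l 1))) (l 143115)) (l 143115))) (l 194205))) 
(l 227917)) (l 239530)) (l 239530))) (l 252323))) (l 252323)) (l 259147))) (l 259147)) (l 261503)) (l 261503))) 
(l 262104))) (l 262104)) (l 262711)) (l 262711))) (l 262966)) (l 262966))) (l 266020))) (n (n (n (n (l 265349) 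
(n (n (l 265072) (n (n (n (l 264690) (n (n (l 263904) (n (n (n (n (l 259357) (n (n (n (l 254534) 
(n (n (l 245497) (n (n (n (l 205392) (n (n (n (n (l 119815) (n (n (l 1) d) (l 1))) (l 119815)) 
(l 205392)) (l 205392))) (l 245497)) (l 245497))) (l 245497))) (l 254534)) (l 259357))) (l 259357)) (l 262259)) 
(l 262259))) (l 264690))) (l 264690)) (l 265072))) (l 265072))) (n (n (l 265012) (n (n (n (n (l 264408) 
(n (n (l 263706) (n (n (n (n (l 259155) (n (n (n (l 259155) (n (n (l 239646) (n (n (n (l 214383) 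
(n (n (n (l 145534) (n (n (l 1) (n d (l 1))) (l 145534))) (l 145534)) (l 214383))) (l 214383)) (l 239646))) 
(l 247877))) (l 259155)) (l 259155))) (l 259155)) (l 262059)) (l 262059))) (l 264408))) (l 264408)) (l 265012)) 
(l 265012))) (l 265349))) (n (n (n (n (l 264837) (n (n (n (n (l 264279) (n (n (l 263675) (n (n (n (n (l 261002) 
(n (n (n (l 254887) (n (n (l 246491) (n (n (n (l 231538) (n (n (l 196338) (n (n (n (n (l 1) 
(n d (l 1))) (l 145371)) (l 145371)) (l 145371))) (l 231538))) (l 231538)) (l 246491))) (l 246491))) (l 254887)) 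
(l 261002))) (l 261002)) (l 262443)) (l 262443))) (l 264279))) (l 264279)) (l 264837)) (l 264837))) (n (n (n (l 264151) 
(n (n (l 263128) (n (n (n (n (l 257824) (n (n (n (l 248489) (n (n (l 234354) (n (n (n (l 234354) 
(n (n (l 119724) (n (n (n (l 1) d) (l 1)) (l 119724))) (l 179880))) (l 234354)) (l 234354))) (l 234354))) 
(l 248489)) (l 257824))) (l 257824)) (l 261089)) (l 261089))) (l 264151))) (l 264151)) (l 265096))) (l 265096)) 
(l 265457))) (l 265951))) (l 267266)) (l 267351))) (l 268212))) (n (n (n (n (l 251792) (n (n (n (n (l 249564) 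
(n (n (n (l 247221) (n (n (l 242486) (n (n (n (n (l 235646) (n (n (l 218987) (n (n (n (n (l 163095) 
(n (n (n (n (l 1) d) (l 1)) (l 123015)) (l 123015))) (l 194535)) (l 194535)) (l 194535))) (l 235646))) 
(l 235646)) (l 242486)) (l 242486))) (l 247221))) (n (n (n (l 247052) (n (n (n (n (l 246597) (n (n (l 245639) 
(n (n (n (n (l 244249) (n (n (l 240557) (n (n (n (n (l 223764) (n (n (n (n (l 207369) (n (n (l 124206) 
(n (n (n (l 1) (n d (l 1))) (l 124206)) (l 124206))) (l 173843))) (l 207369)) (l 223764)) (l 223764))) 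
(l 236544)) (l 236544)) (l 236544))) (l 244249))) (l 244249)) (l 245639)) (l 245639))) (l 246597))) (l 246597)) 
(l 247052)) (l 247052))) (l 247221)) (l 247221))) (l 249518))) (n (n (l 249289) (n (n (n (n (l 248765) 
(n (n (n (n (l 248307) (n (n (l 247355) (n (n (n (n (l 245087) (n (n (l 242982) (n (n (n (n (l 230220) 
(n (n (n (l 215533) (n (n (l 175567) (n (n (n (n (l 1) (n d (l 1))) (l 125930)) (l 125930)) (l 125930))) 
(l 215533))) (l 215533)) (l 230220))) (l 230220)) (l 238693)) (l 238693))) (l 245087))) (l 245087)) (l 247355)) 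
(l 247355))) (l 248307))) (l 248307)) (l 248765)) (l 248765))) (n (n (n (l 248160) (n (n (l 246519) 
(n (n (n (n (l 243576) (n (n (l 240158) (n (n (n (n (l 218001) (n (n (n (l 218001) (n (n (l 123006) 
(n (n (n (l 1) d) (l 1)) (l 123006))) (l 163086))) (l 218001)) (l 218001))) (l 218001)) (l 232136)) (l 232136))) 
(l 243576))) (l 243576)) (l 246519)) (l 246519))) (l 248160))) (l 248160)) (l 248937))) (l 248937)) (l 249222))) 
(l 249437))) (n (n (n (n (l 247041) (n (n (l 241685) (n (n (n (n (l 226587) (n (n (l 200506) 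
(n (n (n (n (l 126991) (n (n (l 1) (n d (l 1))) (l 126991))) (l 126991)) (l 200506)) (l 200506))) (l 226587))) 
(l 226587)) (l 241685)) (l 241685))) (l 247041))) (n (n (l 246679) (n (n (n (l 245605) (n (n (l 245605) 
(n (n (n (n (l 240221) (n (n (l 230073) (n (n (n (n (l 207223) (n (n (l 207223) (n (n (n (l 120050) 
(n (n (l 1) d) (l 1))) (l 120050)) (l 207223))) (l 207223))) (l 207223)) (l 230073)) (l 230073))) (l 240221))) 
(l 240221)) (l 245605)) (l 245605))) (l 245605))) (l 245605)) (l 246679))) (l 246679))) (l 250142)) (l 250405))) 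
(l 251525))) (n (n (n (n (l 210849) (n (n (n (n (l 208384) (n (n (l 203923) (n (n (n (n (l 197026) 
(n (n (l 178167) (n (n (n (l 138199) (n (n (n (n (l 1) (n d (l 1))) (l 87537)) (l 87537)) (l 87537))) 
(l 178167)) (l 178167))) (l 197026))) (l 197026)) (l 203923)) (l 203923))) (l 208384))) (l 208384)) (n (n (n (n (l 210574) 
(n (n (n (l 209939) (n (n (l 208748) (n (n (n (n (l 207667) (n (n (l 199775) (n (n (n (l 186454) 
(n (n (n (n (l 154697) (n (n (l 123256) (n (n (n (n (l 1) d) (l 1)) (l 123256)) (l 123256))) (l 154697))) 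
(l 154697)) (l 186454)) (l 186454))) (l 199775)) (l 199775))) (l 204530))) (l 207667)) (l 208748)) (l 208748))) 
(l 209939))) (l 209939)) (l 210574))) (l 210574)) (l 210793)) (l 210793))) (l 210849))) (n (n (l 211238) 
(n (n (n (l 211035) (n (n (n (n (l 210196) (n (n (l 208580) (n (n (n (n (l 208580) (n (n (l 198690) 
(n (n (n (l 187859) (n (n (n (l 171464) (n (n (l 87592) (n (n (n (l 1) (n d (l 1))) (l 87592)) 
(l 87592))) (l 138255))) (l 171464)) (l 187859))) (l 187859)) (l 198690))) (l 204858))) (l 208580)) (l 208580)) 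
(l 208580))) (l 210196))) (l 210196)) (l 211035)) (l 211035))) (l 211238)) (l 211238))) (l 211355))) (n (n (n (n (l 123618) 
(n (n (l 1) d) (l 1))) (n (n (l 123618) (n (n (n (n (l 122512) (n (n (l 120428) (n (n (n (n (l 115736) 
(n (n (l 115736) (n (n (n (l 97832) (n (n (l 73177) (n (n (n (l 2) (n (n (l 1) (n d (l 1))) (l 1))) 
(l 2)) (l 73177))) (l 73177))) (l 97832)) (l 115736))) (l 115736))) (l 115736)) (l 120428)) (l 120428))) 
(l 122512))) (l 122512)) (l 123618)) (l 123618))) (l 123618))) (l 211268)) (l 211488))) (l 251607))) (l 253058)) 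
(l 273302))) (l 274368))) (n (n (n (n (l 265771) (n (n (n (n (l 255079) (n (n (n (l 254046) (n (n (n (n (l 253760) 
(n (n (l 253601) (n (n (n (l 253312) (n (n (l 252518) (n (n (n (l 250842) (n (n (n (n (l 249121) 
(n (n (n (n (l 227019) (n (n (n (l 187631) (n (n (n (n (l 116253) (n (n (l 1) d) (l 1))) (l 116253)) 
(l 187631)) (l 187631))) (l 227019)) (l 227019))) (l 233807)) (l 242805)) (l 242805))) (l 249121)) (l 249121)) 
(l 249121))) (l 252518)) (l 252518))) (l 253312))) (l 253312)) (l 253601))) (l 253601))) (l 253760)) (n (n (n (l 253651) 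
(n (n (n (l 253273) (n (n (l 252240) (n (n (n (l 251154) (n (n (n (n (l 244754) (n (n (n (n (l 222509) 
(n (n (n (l 222509) (n (n (l 116253) (n (n (n (l 1) d) (l 1)) (l 116253))) (l 182480))) (l 222509)) 
(l 222509))) (l 222509)) (l 236705)) (l 236705))) (l 248172)) (l 248172)) (l 248172))) (l 252240)) (l 252240))) 
(l 253273))) (l 253273)) (l 253651))) (l 253651)) (l 253857))) (l 253975))) (n (n (n (n (l 252518) (n (n (l 248645) 
(n (n (n (l 240436) (n (n (n (n (l 212053) (n (n (n (n (l 137681) (n (n (l 1) (n d (l 1))) (l 137681))) 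
(l 137681)) (l 212053)) (l 212053))) (l 230031)) (l 230031)) (l 230031))) (l 248645)) (l 248645))) (l 252518))) 
(n (n (l 252252) (n (n (n (l 251762) (n (n (l 250419) (n (n (n (l 247441) (n (n (n (n (l 235993) 
(n (n (n (n (l 213296) (n (n (l 186403) (n (n (n (l 114837) (n (n (l 1) d) (l 1))) (l 114837)) 
(l 186403))) (l 186403))) (l 213296)) (l 235993)) (l 235993))) (l 245642)) (l 245642)) (l 245642))) (l 250419)) 
(l 250419))) (l 251762))) (l 251762)) (l 252252))) (l 252252))) (l 253935)) (l 254100))) (l 255016))) (n (n (n (n (l 214263) 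
(n (n (n (n (l 213120) (n (n (l 208374) (n (n (n (l 208374) (n (n (n (n (l 181420) (n (n (n (l 140553) 
(n (n (n (n (l 1) (n d (l 1))) (l 97755)) (l 97755)) (l 97755))) (l 181420)) (l 181420))) (l 200202)) 
(l 200202)) (l 200202))) (l 208374)) (l 208374))) (l 211262))) (n (n (l 212915) (n (n (n (l 212538) 
(n (n (l 210893) (n (n (n (l 210893) (n (n (n (n (l 198909) (n (n (n (l 190556) (n (n (n (n (l 146902) 
(n (n (n (l 115364) (n (n (l 1) d) (l 1))) (l 115364)) (l 146902))) (l 146902)) (l 173804)) (l 173804))) 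
(l 198909)) (l 198909))) (l 205483)) (l 209575)) (l 209575))) (l 210893)) (l 210893))) (l 211899))) (l 212538)) 
(l 212915))) (l 212915))) (l 214207)) (l 214263))) (l 214763)) (n (n (n (n (l 183138) (n (n (n (l 183047) 
(n (n (n (n (l 182760) (n (n (l 181482) (n (n (n (l 180463) (n (n (n (n (l 176853) (n (n (n (l 165244) 
(n (n (l 165244) (n (n (n (n (l 66322) (n (n (n (l 1) (n d (l 1))) (l 66322)) (l 66322))) (l 109119)) 
(l 142405)) (l 142405))) (l 165244))) (l 165244)) (l 176853))) (l 176853)) (l 178512)) (l 178512))) (l 181482)) 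
(l 181482))) (l 182265))) (l 182760)) (l 183047)) (l 183047))) (l 183138)) (l 183138))) (n (n (n (n (l 1) 
d) (l 1)) (l 116874)) (l 116874))) (l 214779)) (l 214779))) (l 239482))) (n (n (n (n (l 254440) (n (n (n (n (l 253883) 
(n (n (l 253675) (n (n (n (l 253454) (n (n (l 251847) (n (n (n (l 249096) (n (n (n (n (l 245094) 
(n (n (l 233966) (n (n (n (n (l 187741) (n (n (n (n (l 116431) (n (n (l 1) d) (l 1))) (l 116431)) 
(l 187741)) (l 187741))) (l 227177)) (l 227177)) (l 227177))) (l 245094))) (l 245094)) (l 249096)) (l 249096))) 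
(l 251847)) (l 251847))) (l 252817))) (l 253454)) (l 253675))) (l 253675))) (n (n (l 253638) (n (n (n (n (l 253416) 
(n (n (l 251795) (n (n (n (l 249059) (n (n (n (n (l 242537) (n (n (l 236080) (n (n (n (n (l 210766) 
(n (n (n (l 137451) (n (n (l 1) (n d (l 1))) (l 137451))) (l 137451)) (l 210766))) (l 210766)) (l 236080)) 
(l 236080))) (l 242537))) (l 242537)) (l 249059)) (l 249059))) (l 251795)) (l 251795))) (l 252772))) (l 253416)) 
(l 253638)) (l 253638))) (l 253883))) (n (n (n (n (l 253493) (n (n (n (n (l 253253) (n (n (l 252032) 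
(n (n (n (l 250208) (n (n (n (n (l 245320) (n (n (l 235033) (n (n (n (n (l 220101) (n (n (l 180425) 
(n (n (n (n (l 1) (n d (l 1))) (l 137308)) (l 137308)) (l 137308))) (l 220101))) (l 220101)) (l 235033)) 
(l 235033))) (l 245320))) (l 245320)) (l 250208)) (l 250208))) (l 252032)) (l 252032))) (l 252760))) (l 253253)) 
(l 253493)) (l 253493))) (n (n (n (l 253273) (n (n (l 251186) (n (n (n (l 249006) (n (n (n (n (l 240000) 
(n (n (l 222634) (n (n (n (n (l 222634) (n (n (l 116372) (n (n (n (l 1) d) (l 1)) (l 116372))) 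
(l 182640))) (l 222634)) (l 222634)) (l 222634))) (l 240000))) (l 240000)) (l 249006)) (l 249006))) (l 251186)) 
(l 251186))) (l 252447))) (l 253273)) (l 253681))) (l 253681)) (l 253951))) (l 254348))) (n (n (n (n (l 252544) 
(n (n (l 245383) (n (n (n (l 232575) (n (n (n (n (l 214546) (n (n (l 137606) (n (n (n (l 1) 
(n d (l 1))) (l 137606)) (l 137606))) (l 180853))) (l 214546)) (l 232575)) (l 232575))) (l 245383)) (l 245383))) 
(l 249408))) (n (n (l 252197) (n (n (n (l 251613) (n (n (l 249136) (n (n (n (l 244487) (n (n (n (n (l 244487) 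
(n (n (l 213323) (n (n (n (l 186421) (n (n (n (l 114938) (n (n (l 1) d) (l 1))) (l 114938)) (l 186421))) 
(l 186421)) (l 213323))) (l 230128))) (l 244487)) (l 244487)) (l 244487))) (l 249136)) (l 249136))) (l 250541))) 
(l 251613)) (l 252197))) (l 252197))) (n (n (n (n (l 253799) (n (n (n (l 253350) (n (n (l 252509) 
(n (n (n (l 248776) (n (n (n (n (l 240811) (n (n (l 229659) (n (n (n (l 214302) (n (n (l 182738) 
(n (n (n (n (l 1) d) (l 1)) (l 116616)) (l 116616))) (l 214302))) (l 214302)) (l 229659))) (l 229659))) 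
(l 240811)) (l 248776)) (l 248776))) (l 252509)) (l 252509))) (l 252509))) (l 253350)) (l 253799))) (l 253799)) 
(l 254069)) (l 254069))) (l 254510))) (l 255768)) (l 255885))) (l 265387))) (n (n (l 263830) (n (n (n (n (l 260189) 
(n (n (n (n (l 259891) (n (n (l 251579) (n (n (n (l 243071) (n (n (n (l 228043) (n (n (l 186579) 
(n (n (n (n (l 1) (n d (l 1))) (l 143238)) (l 143238)) (l 143238))) (l 228043))) (l 228043)) (l 243071))) 
(l 243071)) (l 251579))) (l 255879))) (n (n (l 259539) (n (n (n (l 259539) (n (n (l 256687) (n (n (n (l 253707) 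
(n (n (n (l 245910) (n (n (l 237463) (n (n (n (n (l 193693) (n (n (n (l 116653) (n (n (l 1) 
d) (l 1))) (l 116653)) (l 193693))) (l 193693)) (l 220636)) (l 220636))) (l 245910))) (l 245910)) (l 253707))) 
(l 253707)) (l 256687))) (l 258184))) (l 259539)) (l 259539))) (l 259539))) (n (n (n (n (l 259468) (n (n (n (l 259468) 
(n (n (l 257652) (n (n (n (l 255300) (n (n (n (l 248892) (n (n (l 235347) (n (n (n (n (l 211057) 
(n (n (l 182851) (n (n (n (n (l 1) d) (l 1)) (l 116653)) (l 116653))) (l 211057))) (l 211057)) (l 235347)) 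
(l 235347))) (l 248892))) (l 248892)) (l 255300))) (l 255300)) (l 257652))) (l 258418))) (l 259468)) (l 259468))) 
(l 259468)) (l 259738)) (l 259738))) (l 260189))) (n (n (n (n (l 260933) (n (n (n (n (l 260274) (n (n (n (l 260274) 
(n (n (l 258714) (n (n (n (l 257007) (n (n (n (l 253892) (n (n (l 245369) (n (n (n (l 236405) 
(n (n (n (n (l 183590) (n (n (n (n (l 1) d) (l 1)) (l 117159)) (l 117159))) (l 211796)) (l 211796)) 
(l 211796))) (l 245369)) (l 245369))) (l 253892))) (l 253892)) (l 257007))) (l 257007)) (l 258714))) (l 259687))) 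
(l 260274)) (l 260274))) (l 260274)) (n (n (n (n (l 260483) (n (n (l 258452) (n (n (n (l 256227) 
(n (n (n (l 252860) (n (n (l 235635) (n (n (n (l 217645) (n (n (n (n (l 143323) (n (n (l 1) 
(n d (l 1))) (l 143323))) (l 143323)) (l 217645)) (l 217645))) (l 235635)) (l 235635))) (l 246040))) (l 252860)) 
(l 256227))) (l 256227)) (l 258452))) (l 259718))) (l 260483)) (l 260483)) (l 260483))) (l 260815))) (n (n (l 247014) 
(n (n (n (l 232777) (n (n (n (l 232777) (n (n (l 117491) (n (n (n (l 1) d) (l 1)) (l 117491))) 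
(l 183922))) (l 232777)) (l 232777))) (l 232777)) (l 247014))) (l 255063))) (n (n (n (l 260723) (n (n (n (n (l 260723) 
(n (n (l 257822) (n (n (n (l 255318) (n (n (n (l 248665) (n (n (l 237967) (n (n (n (l 219923) 
(n (n (l 143491) (n (n (n (l 1) (n d (l 1))) (l 143491)) (l 143491))) (l 186833))) (l 219923)) (l 237967))) 
(l 237967))) (l 248665)) (l 255318))) (l 255318)) (l 257822))) (l 259386))) (l 260723)) (l 260723)) (l 260723))) 
(l 261155)) (l 261155))) (l 261286))) (l 261625)) (l 263404))) (l 265261))) (n (n (n (n (l 251155) (n (n (n (n (l 225442) 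
(n (n (n (l 225188) (n (n (l 225014) (n (n (n (l 224267) (n (n (l 223252) (n (n (n (l 221426) 
(n (n (l 217714) (n (n (n (n (l 202693) (n (n (n (n (l 160747) (n (n (n (l 75415) (n (n (l 1) 
d) (l 1))) (l 75415)) (l 160747))) (l 160747)) (l 187496)) (l 187496))) (l 211140)) (l 211140)) (l 211140))) 
(l 221426))) (l 221426)) (l 223252))) (l 223252))) (l 224267)) (l 225014))) (l 225014))) (n (n (n (n (l 224940) 
(n (n (n (l 224370) (n (n (l 223589) (n (n (n (l 222197) (n (n (l 218921) (n (n (n (n (l 200647) 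
(n (n (n (n (l 171448) (n (n (l 139856) (n (n (n (n (l 1) d) (l 1)) (l 75415)) (l 75415))) (l 171448))) 
(l 171448)) (l 200647)) (l 200647))) (l 214177)) (l 214177)) (l 214177))) (l 222197))) (l 222197)) (l 223589))) 
(l 223589))) (l 224370)) (l 224940))) (l 224940)) (l 225074)) (l 225074))) (l 225442))) (n (n (n (n (l 225287) 
(n (n (n (n (l 225096) (n (n (n (l 224649) (n (n (l 224094) (n (n (n (l 222284) (n (n (l 222284) 
(n (n (n (n (l 210058) (n (n (n (l 196165) (n (n (n (n (l 139975) (n (n (n (n (l 1) d) (l 1)) 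
(l 75336)) (l 75336))) (l 171567)) (l 171567)) (l 171567))) (l 210058)) (l 210058))) (l 218565)) (l 218565)) 
(l 218565))) (l 222284))) (l 222284)) (l 224094))) (l 224094))) (l 224649)) (l 225096))) (l 225096)) (l 225199)) 
(l 225199))) (l 225330)) (n (n (n (l 224983) (n (n (n (n (l 224242) (n (n (l 223204) (n (n (n (l 221774) 
(n (n (l 218837) (n (n (n (n (l 201828) (n (n (n (l 183790) (n (n (l 149993) (n (n (n (l 1) 
(n d (l 1))) (l 149993)) (l 149993))) (l 149993))) (l 183790)) (l 201828))) (l 201828)) (l 212682)) (l 212682))) 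
(l 221774))) (l 221774)) (l 223204))) (l 223204))) (l 224242)) (l 224983)) (l 224983))) (l 225330)) (l 225330))) 
(l 225330))) (n (n (n (n (l 149902) (n (n (l 149902) (n (n (n (l 148919) (n (n (l 147565) (n (n (n (l 143547) 
(n (n (l 143547) (n (n (n (n (l 123411) (n (n (l 85459) (n (n (n (n (l 1) (n (n (l 1) d) (l 1))) 
(l 2)) (l 85459)) (l 85459))) (l 123411))) (l 123411)) (l 143547)) (l 143547))) (l 143547))) (l 143547)) 
(l 147565))) (l 147565))) (l 148919)) (l 149902))) (l 149902))) (n (n (l 1) (n d (l 1))) (l 149902))) (l 150160)) 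
(l 225575))) (l 225731))) (n (n (n (n (l 248913) (n (n (n (n (l 248122) (n (n (n (l 247688) (n (n (n (n (l 247323) 
(n (n (l 246729) (n (n (n (l 245647) (n (n (l 242678) (n (n (n (l 236410) (n (n (n (n (l 229973) 
(n (n (n (n (l 147310) (n (n (n (l 1) (n d (l 1))) (l 147310)) (l 147310))) (l 172698)) (l 206351)) 
(l 206351))) (l 229973)) (l 229973)) (l 229973))) (l 242678)) (l 242678))) (l 245647))) (l 245647)) (l 246729))) 
(l 246729))) (l 247323)) (l 247688)) (l 247688))) (n (n (n (l 247269) (n (n (l 246274) (n (n (n (l 244441) 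
(n (n (l 239419) (n (n (n (l 228282) (n (n (n (n (l 185467) (n (n (n (n (l 100579) (n (n (l 1) 
d) (l 1))) (l 100579)) (l 185467)) (l 185467))) (l 221555)) (l 221555)) (l 221555))) (l 239419)) (l 239419))) 
(l 244441))) (l 244441)) (l 246274))) (l 246274))) (l 247269)) (l 247889))) (l 247889))) (n (n (n (n (l 247866) 
(n (n (n (l 247657) (n (n (l 246889) (n (n (n (l 245479) (n (n (l 239329) (n (n (n (l 239329) 
(n (n (n (n (l 194509) (n (n (n (l 163268) (n (n (n (n (l 1) d) (l 1)) (l 100614)) (l 100614))) 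
(l 194509)) (l 194509))) (l 219095)) (l 234399)) (l 234399))) (l 239329)) (l 239329))) (l 243090))) (l 245479)) 
(l 246889))) (l 246889))) (l 247657)) (l 247866))) (l 247866)) (l 248045)) (l 248045))) (n (n (n (n (l 247844) 
(n (n (n (n (l 247370) (n (n (l 246595) (n (n (n (l 245765) (n (n (l 239756) (n (n (n (l 229468) 
(n (n (n (n (l 214499) (n (n (l 172880) (n (n (n (n (l 1) (n d (l 1))) (l 147492)) (l 147492)) 
(l 147492))) (l 214499))) (l 214499)) (l 229468)) (l 229468))) (l 239756)) (l 239756))) (l 243383))) (l 245765)) 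
(l 246595))) (l 246595))) (l 247370)) (l 247844)) (l 247844))) (n (n (n (l 247300) (n (n (l 246004) 
(n (n (n (l 243818) (n (n (l 234556) (n (n (n (l 217169) (n (n (n (n (l 217169) (n (n (l 100614) 
(n (n (n (l 1) d) (l 1)) (l 100614))) (l 163466))) (l 217169)) (l 217169)) (l 217169))) (l 234556)) (l 234556))) 
(l 239808))) (l 243818)) (l 246004))) (l 246004))) (l 247300)) (l 248106))) (l 248106)) (l 248410))) (l 248719))) 
(n (n (l 248945) (n (n (n (n (l 248451) (n (n (n (l 247582) (n (n (l 246267) (n (n (n (l 246267) 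
(n (n (l 235598) (n (n (n (l 224455) (n (n (n (l 195293) (n (n (l 163701) (n (n (n (n (l 1) 
d) (l 1)) (l 100766)) (l 100766))) (l 195293))) (l 195293)) (l 224455))) (l 224455)) (l 235598))) (l 241197))) 
(l 246267)) (l 246267))) (l 246267))) (l 247582)) (l 248451))) (l 248451)) (l 248755)) (l 248755))) (l 249040))) 
(n (n (n (n (l 242541) (n (n (n (n (l 241750) (n (n (n (l 241011) (n (n (l 240358) (n (n (n (l 237565) 
(n (n (l 233768) (n (n (n (l 226939) (n (n (l 213055) (n (n (n (n (l 156877) (n (n (n (n (l 1) 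
d) (l 1)) (l 100041)) (l 100041))) (l 188469)) (l 188469)) (l 188469))) (l 226939))) (l 226939)) (l 233768))) 
(l 233768))) (l 237565)) (l 240358))) (l 240358))) (l 241011)) (l 241750))) (l 241750)) (n (n (n (n (l 241018) 
(n (n (l 241018) (n (n (n (l 237341) (n (n (l 232277) (n (n (n (l 217249) (n (n (l 217249) 
(n (n (n (n (l 141940) (n (n (l 1) (n d (l 1))) (l 141940))) (l 141940)) (l 217249)) (l 217249))) (l 217249))) 
(l 217249)) (l 232277))) (l 232277))) (l 237341)) (l 241018))) (l 241018))) (l 241018)) (l 241982)) (l 241982))) 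
(l 242410))) (n (n (n (n (l 235065) (n (n (n (n (l 234330) (n (n (l 233459) (n (n (n (l 231140) 
(n (n (l 227419) (n (n (n (l 220564) (n (n (l 201780) (n (n (n (l 160128) (n (n (n (n (l 1) 
(n d (l 1))) (l 134967)) (l 134967)) (l 134967))) (l 201780)) (l 201780))) (l 220564))) (l 220564)) (l 227419))) 
(l 227419))) (l 231140)) (l 233459))) (l 233459))) (l 234330)) (l 235065)) (l 235065))) (l 235378)) (n (n (n (l 212568) 
(n (n (l 185720) (n (n (n (l 100411) (n (n (l 1) d) (l 1))) (l 100411)) (l 185720))) (l 185720))) (l 212568)) 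
(l 235378))) (l 235378))) (l 242938)) (l 249037))) (l 249258))) (l 269402)) (l 271144))) (l 279703))) (n d 
(l 1))) (l 296016))) d)

theorem cert_ok : ok (n cert0 cert1) [1, 0] 0 1 2 = true := by decide +kernel

theorem cert_dep : dep (n cert0 cert1) 48 = true := by decide +kernel

theorem cert_chk : chk 130193811 100000000 (n cert0 cert1) cert0 cert1 = true := by
  decide +kernel

/-- The entropy `S` of ternary square-free words satisfies
`exp S < 1.30193812`. -/
theorem ternary_squareFree_entropy_upper_bound (S : ℝ)
    (hS : Filter.Tendsto (fun n : ℕ => Real.log (s n) / n) Filter.atTop (nhds S)) :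
    Real.exp S < 1.30193812 := by
  obtain ⟨C, hC, h⟩ := bound_of_cert cert0 cert1 48 cert_ok cert_dep cert_chk
  exact final 48 C hC h S hS
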